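/- There exists an absolute constant C > 0 with the following property. Let p be a prime and A ⊆ F_p² with p ≤ |A| ≤ p^{4/3}. Set k := √(8|A|) and K := |A|^{4/3}·p^{−2/3}; let Γ be the set of all lines and circles containing at least k points of A. For c ∈ F_p² let A_c be the set of points of A lying on some circle in Γ centred at c, and for a direction v let A_v be the set of points of A lying on some line in Γ with direction v. Let C₁ := {c : |A_c| > K}, V₁ := {v : |A_v| > K}; let L₁ be the set of lines ℓ with b*_A(ℓ) > 0 that pass through some point of C₁ or whose direction w satisfies w·v = 0 for some v ∈ V₁, and let L₂ be the set of lines ℓ with b*_A(ℓ) > 0 not in L₁. Define T*₂(A) := Σ_{ℓ ∈ L₂} ( i_A(ℓ) − |A|/p )·b*_A(ℓ). If T*(A) − |A|³/p ≤ 4·T*₂(A), then T*₂(A) ≤ C·( p^{2/3}|A|^{5/3} + p^{1/4}|A|² + p^{1/2}|A|^{7/4} + p·K^{1/2}·|A| ). -/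

import Mathlib

namespace Stmt16

/-- The (algebraic) squared distance in the plane `F²`. -/
def dist2 {F : Type*} [CommRing F] (x y : F × F) : F :=
  (x.1 - y.1) ^ 2 + (x.2 - y.2) ^ 2

/-- The dot product on `F²`. -/
def dot {F : Type*} [CommRing F] (x y : F × F) : F :=
  x.1 * y.1 + x.2 * y.2

/-- A line in `F²`. -/
def IsLine {F : Type*} [CommRing F] (L : Set (F × F)) : Prop :=
  ∃ x v : F × F, v ≠ 0 ∧ L = {y | ∃ t : F, y = x + t • v}

/-- `L` is a line with direction `v`. -/
def HasDir {F : Type*} [CommRing F] (L : Set (F × F)) (v : F × F) : Prop :=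
  ∃ x : F × F, L = {y | ∃ t : F, y = x + t • v}

/-- A circle in `F²`: centre `c`, radius `r ≠ 0`. -/
def IsCircle {F : Type*} [CommRing F] (S : Set (F × F)) : Prop :=
  ∃ (c : F × F) (r : F), r ≠ 0 ∧ S = {x | dist2 x c = r}

/-- `γ` is a circle centred at `c` (of non-zero radius). -/
def IsCircleCentred {F : Type*} [CommRing F] (γ : Set (F × F)) (c : F × F) : Prop :=
  ∃ r : F, r ≠ 0 ∧ γ = {x | dist2 x c = r}

/-- The perpendicular bisector `B(a,b) = {x | d(a,x) = d(b,x)}`. -/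
def bisector {F : Type*} [CommRing F] (a b : F × F) : Set (F × F) :=
  {x | dist2 a x = dist2 b x}

/-- `b*_A(ℓ)`: pairs `(b,c) ∈ A²`, `b ≠ c`, `(b-c)·(b-c) ≠ 0`, with bisector `ℓ`. -/
noncomputable def bstarL {F : Type*} [CommRing F] (A : Finset (F × F)) (ℓ : Set (F × F)) : ℕ :=
  Set.ncard {q : (F × F) × (F × F) |
    q.1 ∈ A ∧ q.2 ∈ A ∧ q.1 ≠ q.2 ∧
    dot (q.1 - q.2) (q.1 - q.2) ≠ 0 ∧ bisector q.1 q.2 = ℓ}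

/-- `i_A(ℓ) = |A ∩ ℓ|`. -/
noncomputable def iA {F : Type*} [CommRing F] (A : Finset (F × F)) (ℓ : Set (F × F)) : ℕ :=
  ((A : Set (F × F)) ∩ ℓ).ncard

/-- `T*(A)`: the number of non-degenerate isosceles triangles. -/
noncomputable def Tstar {F : Type*} [CommRing F] (A : Finset (F × F)) : ℕ :=
  Set.ncard {t : (F × F) × (F × F) × (F × F) |
    t.1 ∈ A ∧ t.2.1 ∈ A ∧ t.2.2 ∈ A ∧
    dist2 t.1 t.2.1 = dist2 t.1 t.2.2 ∧
    dot (t.2.1 - t.2.2) (t.2.1 - t.2.2) ≠ 0}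

section Bezout

open MvPolynomial

lemma totalDegree_det_le {σ R : Type*} [CommRing R] {n : ℕ}
    (M : Matrix (Fin n) (Fin n) (MvPolynomial σ R)) (b : Fin n → ℕ)
    (h : ∀ i j, (M i j).totalDegree ≤ b j) : M.det.totalDegree ≤ ∑ j, b j := by
  rw [Matrix.det_apply]
  refine MvPolynomial.totalDegree_finsetSum_le fun τ _ => ?_
  refine (totalDegree_smul_le _ _).trans ?_
  exact (totalDegree_finsetProd _ _).trans (Finset.sum_le_sum fun i _ => h _ _)

lemma totalDegree_coeff_finSuccEquiv_le {R : Type*} [CommSemiring R] {n : ℕ}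
    (P : MvPolynomial (Fin (n + 1)) R) (i : ℕ) :
    ((finSuccEquiv R n P).coeff i).totalDegree ≤ P.totalDegree := by
  by_cases h : (finSuccEquiv R n P).coeff i = 0
  · simp [h]
  · have := totalDegree_coeff_finSuccEquiv_add_le P i h
    omega

lemma natDegree_finSuccEquiv_le {R : Type*} [CommSemiring R] {n : ℕ}
    (P : MvPolynomial (Fin (n + 1)) R) :
    (finSuccEquiv R n P).natDegree ≤ P.totalDegree := by
  rw [natDegree_finSuccEquiv]
  exact degreeOf_le_totalDegree _ _

lemma totalDegree_resultant_le {R : Type*} [CommRing R] {n : ℕ}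
    (P Q : MvPolynomial (Fin (n + 1)) R) :
    (Polynomial.resultant (finSuccEquiv R n P) (finSuccEquiv R n Q)).totalDegree ≤
      2 * P.totalDegree * Q.totalDegree := by
  set f := finSuccEquiv R n P
  set g := finSuccEquiv R n Q
  have hb : ∀ i j, (Polynomial.sylvester f g f.natDegree g.natDegree i j).totalDegree ≤
      Fin.addCases (fun _ : Fin f.natDegree => Q.totalDegree)
        (fun _ : Fin g.natDegree => P.totalDegree) j := by
    intro i j
    induction j using Fin.addCases with
    | left j =>
      simp only [Polynomial.sylvester, Matrix.of_apply, Fin.addCases_left]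
      split_ifs
      · exact totalDegree_coeff_finSuccEquiv_le _ _
      · simp
    | right j =>
      simp only [Polynomial.sylvester, Matrix.of_apply, Fin.addCases_right]
      split_ifs
      · exact totalDegree_coeff_finSuccEquiv_le _ _
      · simp
  refine (totalDegree_det_le _ _ hb).trans ?_
  rw [Fin.sum_univ_add]
  simp only [Fin.addCases_left, Fin.addCases_right, Finset.sum_const, Finset.card_univ,
    Fintype.card_fin, smul_eq_mul]
  have h1 : f.natDegree ≤ P.totalDegree := natDegree_finSuccEquiv_le _
  have h2 : g.natDegree ≤ Q.totalDegree := natDegree_finSuccEquiv_le _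
  nlinarith [Nat.mul_le_mul_right Q.totalDegree h1, Nat.mul_le_mul_right P.totalDegree h2]

/-- An eliminant of two coprime polynomials in three variables. -/
lemma exists_eliminant {F : Type*} [Field F] {n : ℕ} {P Q : MvPolynomial (Fin (n + 1)) F}
    (hP : Irreducible P) (hPQ : ¬ P ∣ Q) (hQ : 0 < Q.totalDegree) :
    ∃ R : MvPolynomial (Fin n) F, R ≠ 0 ∧
      R.totalDegree ≤ 2 * P.totalDegree * Q.totalDegree ∧
      ∃ U V, P * U + Q * V = rename Fin.succ R := by
  set f := finSuccEquiv F n P with hf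
  set g := finSuccEquiv F n Q with hg
  have hfi : Irreducible f := (MulEquiv.irreducible_iff (finSuccEquiv F n)).2 hP
  have hren : ∀ R : MvPolynomial (Fin n) F,
      finSuccEquiv F n (rename Fin.succ R) = Polynomial.C R := by
    intro R
    have : ((finSuccEquiv F n).toAlgHom.comp (rename Fin.succ)) =
        (IsScalarTower.toAlgHom F (MvPolynomial (Fin n) F) _) := by
      apply MvPolynomial.algHom_ext
      intro i
      simp [finSuccEquiv_X_succ, Polynomial.algebraMap_eq]
    exact congrArg (fun φ => φ R) this
  by_cases h0 : f.natDegree = 0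
  · obtain ⟨R, hR⟩ := Polynomial.natDegree_eq_zero.1 h0
    refine ⟨R, ?_, ?_, 1, 0, ?_⟩
    · rintro rfl
      exact hfi.ne_zero (by simp [← hR])
    · have : R = f.coeff 0 := by simp [← hR]
      rw [this]
      refine (totalDegree_coeff_finSuccEquiv_le _ _).trans ?_
      nlinarith
    · apply (finSuccEquiv F n).injective
      rw [hren, hR]; simp [hf]
  · refine ⟨Polynomial.resultant f g, ?_, totalDegree_resultant_le P Q, ?_⟩
    · have hprim : f.IsPrimitive := hfi.isPrimitive h0
      let L := FractionRing (MvPolynomial (Fin n) F)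
      have hinj : Function.Injective (algebraMap (MvPolynomial (Fin n) F) L) :=
        IsFractionRing.injective _ _
      have hirr := (hprim.irreducible_iff_irreducible_map_fraction_map (K := L)).1 hfi
      have hnd : ¬ f.map (algebraMap _ L) ∣ g.map (algebraMap _ L) := by
        rw [← Polynomial.IsPrimitive.dvd_iff_fraction_map_dvd_fraction_map L hprim]
        intro h
        exact hPQ ((map_dvd_iff (finSuccEquiv F n)).1 h)
      have hcop := (hirr.coprime_iff_not_dvd).2 hnd
      have hres : Polynomial.resultant (f.map (algebraMap _ L)) (g.map (algebraMap _ L)) ≠ 0 := by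
        intro h
        exact (Polynomial.resultant_eq_zero_iff.1 h).2 hcop
      rw [Polynomial.natDegree_map_eq_of_injective hinj,
        Polynomial.natDegree_map_eq_of_injective hinj, Polynomial.resultant_map_map] at hres
      exact fun h => hres (by rw [h, map_zero])
    · obtain ⟨u, v, -, -, huv⟩ := Polynomial.exists_mul_add_mul_eq_C_resultant f g le_rfl le_rfl
        (Or.inl h0)
      refine ⟨(finSuccEquiv F n).symm u, (finSuccEquiv F n).symm v, ?_⟩
      apply (finSuccEquiv F n).injective
      rw [hren, ← huv]
      simp [hf, hg]

variable {F : Type*} [Field F]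

/-- `P` vanishes on the line `x₁ = a`, `x₀ = b + c x₂`. -/
def VanishA (P : MvPolynomial (Fin 3) F) (b c a : F) : Prop :=
  ∀ t : F, eval ![b + c * t, a, t] P = 0

/-- `P` vanishes on the line `x₂ = a`, `x₀ = b + c x₁`. -/
def VanishB (P : MvPolynomial (Fin 3) F) (b c a : F) : Prop :=
  ∀ t : F, eval ![b + c * t, t, a] P = 0

/-- Restriction of a polynomial to the parametrised line `u + t v`. -/
noncomputable def restr (u v : Fin 3 → F) : MvPolynomial (Fin 3) F →ₐ[F] Polynomial F :=
  aeval fun i => Polynomial.C (u i) + Polynomial.C (v i) * Polynomial.X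

lemma natDegree_restr_le (u v : Fin 3 → F) (P : MvPolynomial (Fin 3) F) :
    (restr u v P).natDegree ≤ P.totalDegree := by
  have := MvPolynomial.aeval_natDegree_le (m := P.totalDegree) (n := 1) P le_rfl
    (fun i => Polynomial.C (u i) + Polynomial.C (v i) * Polynomial.X) (fun i => by compute_degree)
  simpa [restr] using this

lemma eval_restr (u v : Fin 3 → F) (P : MvPolynomial (Fin 3) F) (t : F) :
    (restr u v P).eval t = eval (fun i => u i + v i * t) P := by
  have : (Polynomial.evalRingHom t).comp (restr u v).toRingHom = eval (fun i => u i + v i * t) := by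
    apply MvPolynomial.ringHom_ext
    · intro r; simp [restr]
    · intro i; simp [restr]
  exact congrArg (fun φ => φ P) this

lemma eval_line_eq_zero {P : MvPolynomial (Fin 3) F} {u v : Fin 3 → F} {T : Finset F}
    (hT : P.totalDegree < T.card) (h : ∀ t ∈ T, eval (fun i => u i + v i * t) P = 0) (t : F) :
    eval (fun i => u i + v i * t) P = 0 := by
  have : restr u v P = 0 := by
    apply Polynomial.eq_zero_of_natDegree_lt_card_of_eval_eq_zero' _ T
    · intro i hi; rw [eval_restr]; exact h i hi
    · have := natDegree_restr_le u v P
      omega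
  rw [← eval_restr, this]; simp

lemma vanishA_of_card {P : MvPolynomial (Fin 3) F} {b c a : F} {T : Finset F}
    (hT : P.totalDegree < T.card) (h : ∀ t ∈ T, eval ![b + c * t, a, t] P = 0) :
    VanishA P b c a := by
  have key : ∀ t : F, (![b + c * t, a, t] : Fin 3 → F) = fun i => ![b, a, 0] i + ![c, 0, 1] i * t := by
    intro t; ext i; fin_cases i <;> simp
  intro t
  rw [key]
  apply eval_line_eq_zero hT
  intro t ht
  rw [← key]; exact h t ht

lemma vanishB_of_card {P : MvPolynomial (Fin 3) F} {b c a : F} {T : Finset F}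
    (hT : P.totalDegree < T.card) (h : ∀ t ∈ T, eval ![b + c * t, t, a] P = 0) :
    VanishB P b c a := by
  have key : ∀ t : F, (![b + c * t, t, a] : Fin 3 → F) = fun i => ![b, 0, a] i + ![c, 1, 0] i * t := by
    intro t; ext i; fin_cases i <;> simp
  intro t
  rw [key]
  apply eval_line_eq_zero hT
  intro t ht
  rw [← key]; exact h t ht

/-- Two polynomials without common factor vanish together on few lines. -/
lemma card_vanishB_le [Infinite F] {ι : Type*} {P Q : MvPolynomial (Fin 3) F}
    (hP : Irreducible P) (hPQ : ¬ P ∣ Q) {β γ α : ι → F} (J : Finset ι)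
    (hα : Set.InjOn α J) (h1 : ∀ j ∈ J, VanishB P (β j) (γ j) (α j))
    (h2 : ∀ j ∈ J, VanishB Q (β j) (γ j) (α j)) :
    J.card ≤ 2 * P.totalDegree * Q.totalDegree := by
  classical
  rcases Nat.eq_zero_or_pos Q.totalDegree with h0 | h0
  · have hQ := totalDegree_eq_zero_iff_eq_C.1 h0
    have hc : Q.coeff 0 ≠ 0 := by
      intro h
      rw [h] at hQ
      exact hPQ (by rw [hQ]; simp)
    have : J = ∅ := by
      refine Finset.eq_empty_of_forall_notMem fun j hj => hc ?_
      have := h2 j hj 0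
      rw [hQ] at this
      simpa using this
    simp [this]
  · obtain ⟨R, hR0, hRd, U, V, hUV⟩ := exists_eliminant hP hPQ h0
    have hex : ∃ x : Fin 2 → F, eval x R ≠ 0 := by
      by_contra! h
      exact hR0 (MvPolynomial.funext (by simpa using h))
    obtain ⟨x, hx⟩ := hex
    have hRj : ∀ j ∈ J, ∀ t, eval ![t, α j] R = 0 := by
      intro j hj t
      have := congrArg (eval ![β j + γ j * t, t, α j]) hUV
      rw [map_add, map_mul, map_mul, h1 j hj, h2 j hj, eval_rename] at this
      have h3 : (![β j + γ j * t, t, α j] : Fin 3 → F) ∘ Fin.succ = ![t, α j] := by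
        ext i; fin_cases i <;> rfl
      rw [h3] at this
      simpa using this.symm
    let f : Polynomial F := aeval ![Polynomial.C (x 0), Polynomial.X] R
    have hfd : f.natDegree ≤ R.totalDegree := by
      have := MvPolynomial.aeval_natDegree_le (m := R.totalDegree) (n := 1) R le_rfl
        ![Polynomial.C (x 0), Polynomial.X] (by intro i; fin_cases i <;> simp)
      simpa using this
    have hfe : ∀ t, f.eval t = eval ![x 0, t] R := by
      intro t
      have : (Polynomial.evalRingHom t).comp
          (aeval (R := F) ![Polynomial.C (x 0), Polynomial.X]).toRingHom
          = eval ![x 0, t] := by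
        apply MvPolynomial.ringHom_ext
        · intro r; simp
        · intro i; fin_cases i <;> simp
      exact congrArg (fun φ => φ R) this
    by_contra! hlt
    have hf0 : f = 0 := by
      apply Polynomial.eq_zero_of_natDegree_lt_card_of_eval_eq_zero' f (J.image α)
      · intro i hi
        obtain ⟨j, hj, rfl⟩ := Finset.mem_image.1 hi
        rw [hfe]; exact hRj j hj _
      · rw [Finset.card_image_of_injOn hα]; omega
    apply hx
    have := hfe (x 1)
    rw [hf0] at this
    have h3 : x = ![x 0, x 1] := by ext i; fin_cases i <;> rfl
    rw [h3, ← this]; simp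

end Bezout

section Interpolation

open MvPolynomial

variable {F : Type*} [Field F]

lemma exists_vanishA [Infinite F] {ι : Type*} (S : Finset ι) (β γ α : ι → F) (e : ℕ)
    (he : 3 * S.card ≤ (e + 1) ^ 2) :
    ∃ P : MvPolynomial (Fin 3) F, P ≠ 0 ∧ P.totalDegree ≤ 3 * e ∧
      ∀ i ∈ S, VanishA P (β i) (γ i) (α i) := by
  classical
  obtain ⟨T, hT⟩ := Infinite.exists_subset_card_eq F (3 * e + 1)
  let mon : (Fin 3 → Fin (e + 1)) → (Fin 3 →₀ ℕ) :=
    fun m => Finsupp.equivFunOnFinite.symm fun i => (m i : ℕ)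
  have hmon : Function.Injective mon := by
    intro m m' h
    have h' := Finsupp.equivFunOnFinite.symm.injective h
    ext i
    exact congrFun h' i
  let Φ : ((Fin 3 → Fin (e + 1)) → F) →ₗ[F] MvPolynomial (Fin 3) F :=
    ∑ m, (monomial (mon m)).comp (LinearMap.proj m)
  have hΦ : ∀ c, Φ c = ∑ m, monomial (mon m) (c m) := by
    intro c; simp [Φ, LinearMap.sum_apply]
  let Ψ : ((Fin 3 → Fin (e + 1)) → F) →ₗ[F] (S × T → F) :=
    LinearMap.pi fun x =>
      (aeval (R := F) ![β x.1 + γ x.1 * x.2, α x.1, (x.2 : F)]).toLinearMap.comp Φ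
  have hlt : Module.finrank F (S × T → F) < Module.finrank F ((Fin 3 → Fin (e + 1)) → F) := by
    simp only [Module.finrank_fintype_fun_eq_card, Fintype.card_prod, Fintype.card_coe,
      Fintype.card_fun, Fintype.card_fin, hT]
    nlinarith
  obtain ⟨c, hc, hc0⟩ := (Submodule.ne_bot_iff _).1 (LinearMap.ker_ne_bot_of_finrank_lt (f := Ψ) hlt)
  have hdeg : (Φ c).totalDegree ≤ 3 * e := by
    rw [hΦ]
    refine totalDegree_finsetSum_le fun m _ => (totalDegree_monomial_le _ _).trans ?_
    rw [Finsupp.sum_fintype _ _ (by simp)]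
    simp only [mon, Finsupp.equivFunOnFinite_symm_apply_apply]
    have : ∀ i, (m i : ℕ) ≤ e := fun i => by have := (m i).2; omega
    rw [Fin.sum_univ_three]
    simp only [id]
    linarith [this 0, this 1, this 2]
  refine ⟨Φ c, ?_, ?_, ?_⟩
  · intro h
    apply hc0
    ext m
    have := congrArg (coeff (mon m)) h
    rw [hΦ, coeff_sum] at this
    simpa [coeff_monomial, hmon.eq_iff] using this
  · exact hdeg
  · intro i hi
    apply vanishA_of_card (T := T) (by omega)
    intro t ht
    have := congrFun (LinearMap.mem_ker.1 hc) (⟨i, hi⟩, ⟨t, ht⟩)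
    simpa [Ψ, aeval_eq_eval] using this

/-- Greedy choice of a small set saturating the neighbourhoods of all other vertices. -/
lemma exists_saturating {ι : Type*} [DecidableEq ι] (I J : Finset ι) (r : ι → ι → Prop)
    [∀ i j, Decidable (r i j)] (D d s : ℕ)
    (hI : ∀ i ∈ I, 2 * D ≤ (J.filter (r i)).card) (hs : J.card * (d + 1) < s * D) :
    ∃ S ⊆ I, S.card ≤ s ∧ ∀ i ∈ I \ S,
      D ≤ (J.filter fun j => r i j ∧ d + 1 ≤ (S.filter fun i' => r i' j).card).card := by
  have key : ∀ s : ℕ, ∃ S ⊆ I, S.card ≤ s ∧ ((∀ i ∈ I \ S,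
      D ≤ (J.filter fun j => r i j ∧ d + 1 ≤ (S.filter fun i' => r i' j).card).card) ∨
      s * D ≤ ∑ j ∈ J, min (S.filter fun i' => r i' j).card (d + 1)) := by
    intro s
    induction s with
    | zero => exact ⟨∅, by simp, by simp, Or.inr (by simp)⟩
    | succ s ih =>
      obtain ⟨S, hSI, hSc, h⟩ := ih
      by_cases hsat : ∀ i ∈ I \ S,
          D ≤ (J.filter fun j => r i j ∧ d + 1 ≤ (S.filter fun i' => r i' j).card).card
      · exact ⟨S, hSI, by omega, Or.inl hsat⟩
      · have h := h.resolve_left hsat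
        push Not at hsat
        obtain ⟨i, hi, hlt⟩ := hsat
        rw [Finset.mem_sdiff] at hi
        refine ⟨insert i S, Finset.insert_subset hi.1 hSI,
          (Finset.card_insert_le _ _).trans (by omega), Or.inr ?_⟩
        set U := J.filter fun j => r i j ∧ ¬ d + 1 ≤ (S.filter fun i' => r i' j).card with hU
        have hUc : D ≤ U.card := by
          have h1 : (J.filter fun j => r i j ∧
              d + 1 ≤ (S.filter fun i' => r i' j).card).card + U.card = (J.filter (r i)).card := by
            rw [← Finset.card_filter_add_card_filter_not (s := J.filter (r i))
              (fun j => d + 1 ≤ (S.filter fun i' => r i' j).card), Finset.filter_filter,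
              Finset.filter_filter]
          have := hI i hi.1
          omega
        have hstep : ∀ j ∈ J, min (S.filter fun i' => r i' j).card (d + 1) +
            (if r i j ∧ ¬ d + 1 ≤ (S.filter fun i' => r i' j).card then 1 else 0) ≤
            min ((insert i S).filter fun i' => r i' j).card (d + 1) := by
          intro j _
          rw [Finset.filter_insert]
          by_cases hr : r i j
          · rw [if_pos hr, Finset.card_insert_of_notMem (by simp [hi.2])]
            split_ifs <;> omega
          · simp [hr]
        have hsum := Finset.sum_le_sum hstep
        have hsumU : ∑ j ∈ J, (if r i j ∧ ¬ d + 1 ≤ (S.filter fun i' => r i' j).card then 1 else 0)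
            = U.card := by
          rw [hU, Finset.card_filter]
        rw [Finset.sum_add_distrib, hsumU] at hsum
        rw [Nat.succ_mul]
        omega
  obtain ⟨S, hSI, hSc, h | h⟩ := key s
  · exact ⟨S, hSI, hSc, h⟩
  · exfalso
    have : ∑ j ∈ J, min (S.filter fun i' => r i' j).card (d + 1) ≤ ∑ j ∈ J, (d + 1) :=
      Finset.sum_le_sum fun j _ => min_le_right _ _
    rw [Finset.sum_const, smul_eq_mul] at this
    omega

/-- Incidence of the lines `x₁ = α i, x₀ = β i + γ i x₂` and `x₂ = α j, x₀ = β j + γ j x₁`. -/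
def Inc {ι : Type*} (β γ α : ι → F) (i j : ι) : Prop :=
  β i + γ i * α j = β j + γ j * α i

lemma vanishA_of_inc {ι : Type*} {P : MvPolynomial (Fin 3) F} {β γ α : ι → F}
    (hα : Function.Injective α) {i : ι} {T : Finset ι} (hT : P.totalDegree < T.card)
    (h : ∀ j ∈ T, Inc β γ α i j ∧ VanishB P (β j) (γ j) (α j)) :
    VanishA P (β i) (γ i) (α i) := by
  classical
  apply vanishA_of_card (T := T.image α)
  · rwa [Finset.card_image_of_injective _ hα]
  · intro t ht
    obtain ⟨j, hj, rfl⟩ := Finset.mem_image.1 ht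
    have h1 : β i + γ i * α j = β j + γ j * α i := (h j hj).1
    rw [h1]
    exact (h j hj).2 (α i)

lemma vanishB_of_inc {ι : Type*} {P : MvPolynomial (Fin 3) F} {β γ α : ι → F}
    (hα : Function.Injective α) {j : ι} {T : Finset ι} (hT : P.totalDegree < T.card)
    (h : ∀ i ∈ T, Inc β γ α i j ∧ VanishA P (β i) (γ i) (α i)) :
    VanishB P (β j) (γ j) (α j) := by
  classical
  apply vanishB_of_card (T := T.image α)
  · rwa [Finset.card_image_of_injective _ hα]
  · intro t ht
    obtain ⟨i, hi, rfl⟩ := Finset.mem_image.1 ht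
    have h1 : β i + γ i * α j = β j + γ j * α i := (h i hi).1
    rw [← h1]
    exact (h i hi).2 (α j)

open Classical in
lemma exists_vanish_all [Infinite F] {ι : Type*} {β γ α : ι → F} (hα : Function.Injective α)
    {I J : Finset ι} {D e s : ℕ}
    (hI : ∀ i ∈ I, 2 * D ≤ (J.filter (Inc β γ α i)).card)
    (hJ : ∀ j ∈ J, 2 * D ≤ (I.filter fun i => Inc β γ α i j).card)
    (hD : 3 * e < D) (hs : J.card * (3 * e + 1) < s * D) (hse : 3 * s ≤ (e + 1) ^ 2) :
    ∃ P : MvPolynomial (Fin 3) F, P ≠ 0 ∧ P.totalDegree ≤ 3 * e ∧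
      (∀ i ∈ I, VanishA P (β i) (γ i) (α i)) ∧ ∀ j ∈ J, VanishB P (β j) (γ j) (α j) := by
  obtain ⟨S, hSI, hSc, hsat⟩ := exists_saturating I J (Inc β γ α) D (3 * e) s hI hs
  obtain ⟨P, hP0, hPd, hPS⟩ := exists_vanishA S β γ α e (by omega)
  have h1 : ∀ i ∈ I, VanishA P (β i) (γ i) (α i) := by
    intro i hi
    by_cases hiS : i ∈ S
    · exact hPS i hiS
    · refine vanishA_of_inc hα (lt_of_le_of_lt hPd (hD.trans_le (hsat i (by simp [hi, hiS])))) ?_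
      intro j hj
      rw [Finset.mem_filter] at hj
      refine ⟨hj.2.1, vanishB_of_inc hα (T := S.filter fun i' => Inc β γ α i' j) (by omega) ?_⟩
      intro i' hi'
      rw [Finset.mem_filter] at hi'
      exact ⟨hi'.2, hPS i' hi'.1⟩
  refine ⟨P, hP0, hPd, h1, fun j hj => ?_⟩
  refine vanishB_of_inc hα (T := I.filter fun i => Inc β γ α i j) (by have := hJ j hj; omega) ?_
  intro i hi
  rw [Finset.mem_filter] at hi
  exact ⟨hi.2, h1 i hi.1⟩

end Interpolation

section Surface

open MvPolynomial

variable {F : Type*} [Field F]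

lemma totalDegree_pderiv_le {σ R : Type*} [CommSemiring R] (i : σ) (P : MvPolynomial σ R) :
    (pderiv i P).totalDegree ≤ P.totalDegree - 1 := by
  classical
  conv_lhs => rw [P.as_sum, map_sum]
  refine totalDegree_finsetSum_le fun s hs => ?_
  rw [pderiv_monomial]
  rcases Nat.eq_zero_or_pos (s i) with h | h
  · simp [h]
  · refine (totalDegree_monomial_le _ _).trans ?_
    have h1 : (s - Finsupp.single i 1).sum (fun _ => id) + 1 = s.sum fun _ => id := by
      have h2 : s - Finsupp.single i 1 + Finsupp.single i 1 = s :=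
        tsub_add_cancel_of_le (Finsupp.single_le_iff.2 h)
      conv_rhs => rw [← h2]
      rw [Finsupp.sum_add_index' (by simp) (by simp)]
      simp
    have h2 : (s.sum fun _ => id) ≤ P.totalDegree := le_totalDegree hs
    omega

lemma derivative_restr (u v : Fin 3 → F) (P : MvPolynomial (Fin 3) F) :
    Polynomial.derivative (restr u v P) = ∑ i, Polynomial.C (v i) * restr u v (pderiv i P) := by
  induction P using MvPolynomial.induction_on with
  | C a => simp [restr]
  | add P Q hP hQ => simp [hP, hQ, mul_add, Finset.sum_add_distrib]
  | mul_X P n hP =>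
    have hX : restr u v (X n) = Polynomial.C (u n) + Polynomial.C (v n) * Polynomial.X := by
      simp [restr]
    have hp : ∀ i, restr u v (pderiv i (X n)) = if i = n then 1 else 0 := by
      intro i
      rw [pderiv_X]
      rcases eq_or_ne i n with rfl | h
      · simp
      · simp [h, Ne.symm h]
    have hd : Polynomial.derivative (restr u v (X n)) = Polynomial.C (v n) := by
      rw [hX]; simp
    have hs : ∀ i, restr u v (pderiv i (P * X n)) =
        restr u v P * (if i = n then 1 else 0) + restr u v (X n) * restr u v (pderiv i P) := by
      intro i
      rw [Derivation.leibniz, smul_eq_mul, smul_eq_mul, map_add, map_mul, map_mul, hp]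
    have hm : restr u v (P * X n) = restr u v P * restr u v (X n) := map_mul _ _ _
    rw [hm, Polynomial.derivative_mul, hP, hd]
    simp only [hs]
    generalize restr u v P = a
    generalize restr u v (X n) = b
    simp only [mul_add, Finset.sum_add_distrib, Finset.sum_mul]
    rw [add_comm]
    congr 1
    · simp [mul_comm]
    · exact Finset.sum_congr rfl fun i _ => by ring

lemma restr_eq_zero [Infinite F] {u v : Fin 3 → F} {P : MvPolynomial (Fin 3) F}
    (h : ∀ t, eval (fun i => u i + v i * t) P = 0) : restr u v P = 0 :=
  Polynomial.funext fun t => by rw [eval_restr, h, Polynomial.eval_zero]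

lemma lineA_eq (b c a t : F) :
    (![b + c * t, a, t] : Fin 3 → F) = fun i => ![b, a, 0] i + ![c, 0, 1] i * t := by
  ext i; fin_cases i <;> simp

lemma lineB_eq (b c a t : F) :
    (![b + c * t, t, a] : Fin 3 → F) = fun i => ![b, 0, a] i + ![c, 1, 0] i * t := by
  ext i; fin_cases i <;> simp

lemma vanishA_iff [Infinite F] {P : MvPolynomial (Fin 3) F} {b c a : F} :
    VanishA P b c a ↔ restr ![b, a, 0] ![c, 0, 1] P = 0 := by
  constructor
  · intro h
    exact restr_eq_zero fun t => by rw [← lineA_eq]; exact h t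
  · intro h t
    rw [lineA_eq, ← eval_restr, h, Polynomial.eval_zero]

lemma vanishB_iff [Infinite F] {P : MvPolynomial (Fin 3) F} {b c a : F} :
    VanishB P b c a ↔ restr ![b, 0, a] ![c, 1, 0] P = 0 := by
  constructor
  · intro h
    exact restr_eq_zero fun t => by rw [← lineB_eq]; exact h t
  · intro h t
    rw [lineB_eq, ← eval_restr, h, Polynomial.eval_zero]

lemma vanishB_mul [Infinite F] {P Q : MvPolynomial (Fin 3) F} {b c a : F} :
    VanishB (P * Q) b c a ↔ VanishB P b c a ∨ VanishB Q b c a := by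
  simp only [vanishB_iff, map_mul, mul_eq_zero]

lemma vanishA_of_pow_mul [Infinite F] {P Q : MvPolynomial (Fin 3) F} {b c a : F} {m : ℕ}
    (h : VanishA (Q ^ m * P) b c a) : VanishA Q b c a ∨ VanishA P b c a := by
  simp only [vanishA_iff, map_mul, map_pow, mul_eq_zero] at h ⊢
  exact h.imp_left eq_zero_of_pow_eq_zero

open Classical in
lemma exists_irreducible_factor [Infinite F] {ι : Type*} {β γ α : ι → F} (J : Finset ι) (M : ℕ)
    (P : MvPolynomial (Fin 3) F) (hP : P ≠ 0)
    (hJ : M * P.totalDegree < (J.filter fun j => VanishB P (β j) (γ j) (α j)).card) :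
    ∃ Q, Irreducible Q ∧ Q ∣ P ∧
      M * Q.totalDegree < (J.filter fun j => VanishB Q (β j) (γ j) (α j)).card := by
  by_contra! hcon
  refine absurd hJ (not_lt.2 ?_)
  suffices H : ∀ R : MvPolynomial (Fin 3) F, R ≠ 0 → R ∣ P →
      (J.filter fun j => VanishB R (β j) (γ j) (α j)).card ≤ M * R.totalDegree from
    H P hP dvd_rfl
  intro R
  induction R using WfDvdMonoid.induction_on_irreducible with
  | zero => exact fun h => absurd rfl h
  | unit u hu =>
    intro _ _
    obtain ⟨w, hw⟩ := hu.exists_left_inv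
    have : (J.filter fun j => VanishB u (β j) (γ j) (α j)) = ∅ := by
      refine Finset.filter_eq_empty_iff.2 fun j _ hj => ?_
      have h1 := congrArg (eval ![β j + γ j * 0, 0, α j]) hw
      rw [map_mul, hj 0] at h1
      simp at h1
    simp [this]
  | mul a i ha hi ih =>
    intro _ hdvd
    have h1 := hcon i hi ((dvd_mul_right _ _).trans hdvd)
    have h2 := ih ha ((dvd_mul_left _ _).trans hdvd)
    rw [totalDegree_mul_of_isDomain hi.ne_zero ha, mul_add]
    simp only [vanishB_mul]
    rw [Finset.filter_or]
    exact (Finset.card_union_le _ _).trans (add_le_add h1 h2)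

open Classical in
lemma exists_irreducible_surface [Infinite F] {ι : Type*} {β γ α : ι → F}
    (hα : Function.Injective α) {r : ι → ι → Prop} (hr : ∀ i j, r i j → Inc β γ α i j)
    {I J : Finset ι} {D e s : ℕ}
    (hI : ∀ i ∈ I, 2 * D ≤ (J.filter (r i)).card)
    (hJ : ∀ j ∈ J, 2 * D ≤ (I.filter fun i => r i j).card)
    (hD : 3 * e < D) (hs : J.card * (3 * e + 1) < s * D) (hse : 3 * s ≤ (e + 1) ^ 2)
    (h8 : 8 * (3 * e) * (3 * e) < J.card) :
    ∃ Q : MvPolynomial (Fin 3) F, Irreducible Q ∧ Q.totalDegree ≤ 3 * e ∧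
      ∃ J' ⊆ J, 6 * Q.totalDegree * (3 * e) < J'.card ∧ ∀ j ∈ J', VanishB Q (β j) (γ j) (α j) ∧
        D ≤ (I.filter fun i => r i j ∧ VanishA Q (β i) (γ i) (α i)).card := by
  obtain ⟨P, hP0, hPd, hPA, hPB⟩ := exists_vanish_all hα (I := I) (J := J) (D := D) (e := e) (s := s)
    (fun i hi => (hI i hi).trans (Finset.card_le_card (Finset.monotone_filter_right _
      fun j _ h => hr i j h)))
    (fun j hj => (hJ j hj).trans (Finset.card_le_card (Finset.monotone_filter_right _
      fun i _ h => hr i j h))) hD hs hse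
  have hfil : (J.filter fun j => VanishB P (β j) (γ j) (α j)) = J :=
    Finset.filter_true_of_mem hPB
  obtain ⟨Q, hQ, hQP, hQJ⟩ := exists_irreducible_factor (β := β) (γ := γ) (α := α) J (8 * (3 * e)) P hP0
    (by rw [hfil]; exact (Nat.mul_le_mul_left _ hPd).trans_lt h8)
  have hfin : FiniteMultiplicity Q P := FiniteMultiplicity.of_not_isUnit hQ.not_isUnit hP0
  obtain ⟨P', hPP', hQP'⟩ := hfin.exists_eq_pow_mul_and_not_dvd
  have hP'0 : P' ≠ 0 := by rintro rfl; exact hQP' (dvd_zero _)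
  have hP'd : P'.totalDegree ≤ 3 * e := by
    refine le_trans ?_ hPd
    rw [hPP', totalDegree_mul_of_isDomain (pow_ne_zero _ hQ.ne_zero) hP'0]
    omega
  have hQd : Q.totalDegree ≤ 3 * e := by
    obtain ⟨W, hW⟩ := hQP
    refine le_trans ?_ hPd
    have hW0 : W ≠ 0 := by rintro rfl; exact hP0 (by simp [hW])
    rw [hW, totalDegree_mul_of_isDomain hQ.ne_zero hW0]
    omega
  refine ⟨Q, hQ, hQd, J.filter fun j => VanishB Q (β j) (γ j) (α j) ∧
    ¬ VanishB P' (β j) (γ j) (α j), Finset.filter_subset _ _, ?_, ?_⟩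
  · have h1 := Finset.card_filter_add_card_filter_not
      (s := J.filter fun j => VanishB Q (β j) (γ j) (α j)) (fun j => VanishB P' (β j) (γ j) (α j))
    rw [Finset.filter_filter, Finset.filter_filter] at h1
    have h2 := card_vanishB_le hQ hQP' (β := β) (γ := γ) (α := α)
      (J.filter fun j => VanishB Q (β j) (γ j) (α j) ∧ VanishB P' (β j) (γ j) (α j))
      hα.injOn (fun j hj => ((Finset.mem_filter.1 hj).2).1)
      (fun j hj => ((Finset.mem_filter.1 hj).2).2)
    have h3 : 2 * Q.totalDegree * P'.totalDegree ≤ 2 * Q.totalDegree * (3 * e) :=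
      Nat.mul_le_mul_left _ hP'd
    nlinarith
  · intro j hj
    rw [Finset.mem_filter] at hj
    refine ⟨hj.2.1, ?_⟩
    have h1 := Finset.card_filter_add_card_filter_not
      (s := I.filter fun i => r i j) (fun i => VanishA Q (β i) (γ i) (α i))
    rw [Finset.filter_filter, Finset.filter_filter] at h1
    have h2 : (I.filter fun i => r i j ∧ ¬ VanishA Q (β i) (γ i) (α i)).card ≤ 3 * e := by
      by_contra! hlt
      refine hj.2.2 (vanishB_of_inc hα (hP'd.trans_lt hlt) fun i hi => ?_)
      rw [Finset.mem_filter] at hi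
      refine ⟨hr i j hi.2.1, ?_⟩
      have := hPA i hi.1
      rw [hPP'] at this
      exact (vanishA_of_pow_mul this).resolve_left hi.2.2
    have := hJ j hj.1
    omega

lemma eq_zero_of_flat_ode {h g w w' : Polynomial F} (h0 : h.eval 0 = 0)
    (h1 : (Polynomial.derivative h).eval 0 = 0) (hg : g.eval 0 ≠ 0)
    (hchar : ∀ m : ℕ, 0 < m → m ≤ h.natDegree → (m : F) ≠ 0)
    (heq : h * w = g ^ 2 * Polynomial.derivative (Polynomial.derivative h) +
      Polynomial.derivative h * w') : h = 0 := by
  by_contra hne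
  obtain ⟨q, hq, hnd⟩ := Polynomial.exists_eq_pow_rootMultiplicity_mul_and_not_dvd h hne 0
  set s := Polynomial.rootMultiplicity 0 h
  rw [map_zero, sub_zero] at hq hnd
  have hq0 : q.eval 0 ≠ 0 := by
    intro hz
    exact hnd (Polynomial.X_dvd_iff.2 (by rwa [Polynomial.coeff_zero_eq_eval_zero]))
  have hqne : q ≠ 0 := by rintro rfl; simp at hq0
  have hdeg : s ≤ h.natDegree := by
    rw [hq, Polynomial.natDegree_mul (pow_ne_zero _ Polynomial.X_ne_zero) hqne]
    simp
  match hs : s with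
  | 0 => rw [hq] at h0; simp [hq0] at h0
  | 1 => rw [hq] at h1; simp [hq0] at h1
  | m + 2 =>
    have hX : (Polynomial.X : Polynomial F) ^ m ≠ 0 := pow_ne_zero _ Polynomial.X_ne_zero
    have hd1 : Polynomial.derivative h = Polynomial.X ^ m * (Polynomial.X *
        (((m + 2 : ℕ) : Polynomial F) * q + Polynomial.X * Polynomial.derivative q)) := by
      rw [hq, Polynomial.derivative_mul, Polynomial.derivative_X_pow]
      simp only [map_natCast, show m + 2 - 1 = m + 1 by omega]
      ring
    have hd2 : Polynomial.derivative (Polynomial.derivative h) = Polynomial.X ^ m *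
        (((m + 2 : ℕ) : Polynomial F) * ((m + 1 : ℕ) : Polynomial F) * q + Polynomial.X *
        (2 * ((m + 2 : ℕ) : Polynomial F) * Polynomial.derivative q +
          Polynomial.X * Polynomial.derivative (Polynomial.derivative q))) := by
      rw [hq, Polynomial.derivative_mul, Polynomial.derivative_X_pow]
      simp only [map_add, Polynomial.derivative_mul, Polynomial.derivative_X_pow, map_natCast,
        Polynomial.derivative_natCast, show m + 2 - 1 = m + 1 by omega, Nat.add_sub_cancel]
      push_cast
      ring
    rw [hd2, hd1, hq] at heq
    have h2 : Polynomial.X ^ 2 * q * w = g ^ 2 *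
        (((m + 2 : ℕ) : Polynomial F) * ((m + 1 : ℕ) : Polynomial F) * q + Polynomial.X *
        (2 * ((m + 2 : ℕ) : Polynomial F) * Polynomial.derivative q +
          Polynomial.X * Polynomial.derivative (Polynomial.derivative q))) + (Polynomial.X *
        (((m + 2 : ℕ) : Polynomial F) * q + Polynomial.X * Polynomial.derivative q)) * w' := by
      apply mul_left_cancel₀ hX
      linear_combination heq
    have h3 := congrArg (Polynomial.eval 0) h2
    simp only [Polynomial.eval_mul, Polynomial.eval_add, Polynomial.eval_pow, Polynomial.eval_X,
      Polynomial.eval_natCast, zero_mul, add_zero] at h3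
    have e1 := hchar (m + 2) (by omega) hdeg
    have e2 := hchar (m + 1) (by omega) (by omega)
    have : g.eval 0 ^ 2 * (((m + 2 : ℕ) : F) * ((m + 1 : ℕ) : F) * q.eval 0) ≠ 0 :=
      mul_ne_zero (pow_ne_zero _ hg) (mul_ne_zero (mul_ne_zero e1 e2) hq0)
    apply this
    rw [← h3]; ring

end Surface

section Flat

open MvPolynomial

variable {F : Type*} [Field F]

/-- The polynomial detecting second-order contact with lines in the planes `x₂ = const`. -/
noncomputable def flat (Q : MvPolynomial (Fin 3) F) : MvPolynomial (Fin 3) F :=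
  pderiv 1 (pderiv 1 Q) * pderiv 0 Q ^ 2 -
    pderiv 1 Q * pderiv 0 Q * (pderiv 0 (pderiv 1 Q) + pderiv 1 (pderiv 0 Q)) +
    pderiv 1 Q ^ 2 * pderiv 0 (pderiv 0 Q)

lemma totalDegree_flat_le (Q : MvPolynomial (Fin 3) F) :
    (flat Q).totalDegree ≤ 3 * Q.totalDegree := by
  have h1 : ∀ i, (pderiv i Q).totalDegree ≤ Q.totalDegree :=
    fun i => (totalDegree_pderiv_le i Q).trans (Nat.sub_le _ _)
  have h2 : ∀ i j, (pderiv i (pderiv j Q)).totalDegree ≤ Q.totalDegree :=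
    fun i j => ((totalDegree_pderiv_le i _).trans (Nat.sub_le _ _)).trans (h1 j)
  have hsq : ∀ i, (pderiv i Q ^ 2).totalDegree ≤ 2 * Q.totalDegree :=
    fun i => (totalDegree_pow _ _).trans (Nat.mul_le_mul_left _ (h1 i))
  refine (totalDegree_add _ _).trans (max_le ((totalDegree_sub _ _).trans (max_le ?_ ?_)) ?_)
  · refine (totalDegree_mul _ _).trans ?_
    have := h2 1 1; have := hsq 0; omega
  · refine (totalDegree_mul _ _).trans ?_
    have h3 := totalDegree_mul (pderiv 1 Q) (pderiv 0 Q)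
    have h4 := totalDegree_add (pderiv 0 (pderiv 1 Q)) (pderiv 1 (pderiv 0 Q))
    have h5 := max_le (h2 0 1) (h2 1 0)
    have := h1 0; have := h1 1; omega
  · refine (totalDegree_mul _ _).trans ?_
    have := h2 0 0; have := hsq 1; omega

lemma derivative_restr_line (u : Fin 3 → F) (c : F) (P : MvPolynomial (Fin 3) F) :
    Polynomial.derivative (restr u ![c, 1, 0] P) =
      Polynomial.C c * restr u ![c, 1, 0] (pderiv 0 P) + restr u ![c, 1, 0] (pderiv 1 P) := by
  rw [derivative_restr, Fin.sum_univ_three]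
  simp

lemma restr_flat (u : Fin 3 → F) (c : F) (Q : MvPolynomial (Fin 3) F) :
    ∃ w, restr u ![c, 1, 0] (flat Q) = restr u ![c, 1, 0] (pderiv 0 Q) ^ 2 *
        Polynomial.derivative (Polynomial.derivative (restr u ![c, 1, 0] Q)) +
      Polynomial.derivative (restr u ![c, 1, 0] Q) * w := by
  set φ := restr u ![c, 1, 0] with hφ
  refine ⟨-φ (pderiv 0 Q) * (φ (pderiv 0 (pderiv 1 Q)) + φ (pderiv 1 (pderiv 0 Q))) +
    (Polynomial.C c * φ (pderiv 0 Q) + φ (pderiv 1 Q)) * φ (pderiv 0 (pderiv 0 Q)) -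
    2 * Polynomial.C c * φ (pderiv 0 Q) * φ (pderiv 0 (pderiv 0 Q)), ?_⟩
  rw [hφ, derivative_restr_line, ← hφ, map_add, Polynomial.derivative_mul, Polynomial.derivative_C,
    hφ, derivative_restr_line, derivative_restr_line, ← hφ, flat, map_add, map_sub]
  simp only [map_mul, map_pow, map_add]
  ring

lemma eval_restr_zero (u v : Fin 3 → F) (P : MvPolynomial (Fin 3) F) :
    (restr u v P).eval 0 = eval u P := by
  rw [eval_restr]; simp

lemma vanishB_flat [Infinite F] {Q : MvPolynomial (Fin 3) F} {b c a : F} (h : VanishB Q b c a) :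
    VanishB (flat Q) b c a := by
  rw [vanishB_iff] at h ⊢
  obtain ⟨w, hw⟩ := restr_flat ![b, 0, a] c Q
  rw [hw, h]; simp

/-- A surface on which `flat` vanishes contains the tangent lines in the planes `x₂ = const`. -/
lemma vanishB_of_dvd_flat {Q : MvPolynomial (Fin 3) F} (hQ : Q ∣ flat Q)
    (hchar : ∀ m : ℕ, 0 < m → m ≤ Q.totalDegree → (m : F) ≠ 0) {z x y c : F}
    (h0 : eval ![z, x, y] Q = 0) (hz : eval ![z, x, y] (pderiv 0 Q) ≠ 0)
    (hc : c * eval ![z, x, y] (pderiv 0 Q) + eval ![z, x, y] (pderiv 1 Q) = 0) :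
    VanishB Q (z - c * x) c y := by
  obtain ⟨W, hW⟩ := hQ
  obtain ⟨w, hw⟩ := restr_flat ![z, x, y] c Q
  have hr : restr ![z, x, y] ![c, 1, 0] Q = 0 := by
    refine eq_zero_of_flat_ode (g := restr ![z, x, y] ![c, 1, 0] (pderiv 0 Q))
      (w := restr ![z, x, y] ![c, 1, 0] W) (w' := w) ?_ ?_ ?_ ?_ ?_
    · rwa [eval_restr_zero]
    · rw [derivative_restr_line, Polynomial.eval_add, Polynomial.eval_mul, eval_restr_zero,
        eval_restr_zero, Polynomial.eval_C, hc]
    · rwa [eval_restr_zero]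
    · exact fun m hm hm' => hchar m hm (hm'.trans (natDegree_restr_le _ _ _))
    · rw [← hw, hW, map_mul]
  intro t
  have h1 := eval_restr ![z, x, y] ![c, 1, 0] Q (t - x)
  rw [hr, Polynomial.eval_zero] at h1
  rw [h1]
  congr 2
  ext i; fin_cases i <;> simp
  ring

open Classical in
/-- An irreducible surface with many lines of one ruling is one of the surfaces
`z = A + B x + C y + D x y`, as soon as its `z`-derivative is nonzero on a line of the other
ruling. -/
lemma ruled_of_dvd_flat [Infinite F] {Q : MvPolynomial (Fin 3) F} (hQi : Irreducible Q)
    (hQ : Q ∣ flat Q) (hchar : ∀ m : ℕ, 0 < m → m ≤ Q.totalDegree → (m : F) ≠ 0)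
    {b c a b' c' a' : F} (h : VanishA Q b c a) (h' : VanishA Q b' c' a') (haa : a ≠ a')
    (hz : ¬ VanishA (pderiv 0 Q) b c a) :
    ∃ A B C D : F, ∀ b₁ c₁ a₁, VanishA Q b₁ c₁ a₁ → b₁ = A + B * a₁ ∧ c₁ = C + D * a₁ := by
  set g := restr ![b, a, 0] ![c, 0, 1] (pderiv 0 Q) with hg
  set k := restr ![b, a, 0] ![c, 0, 1] (pderiv 1 Q) with hk
  have hg0 : g ≠ 0 := fun h0 => hz (vanishA_iff.2 h0)
  have hge : ∀ t, g.eval t = eval ![b + c * t, a, t] (pderiv 0 Q) := by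
    intro t; rw [hg, eval_restr, ← lineA_eq]
  have hke : ∀ t, k.eval t = eval ![b + c * t, a, t] (pderiv 1 Q) := by
    intro t; rw [hk, eval_restr, ← lineA_eq]
  let G : MvPolynomial (Fin 3) F := Polynomial.aeval (X 2) g
  let H : MvPolynomial (Fin 3) F := Polynomial.aeval (X 2) k
  have hG : ∀ x : Fin 3 → F, eval x G = g.eval (x 2) := by
    intro x
    change eval x (Polynomial.aeval (X 2) g) = _
    rw [← MvPolynomial.coe_aeval_eq_eval, RingHom.coe_coe, ← Polynomial.aeval_algHom_apply]
    simp [Polynomial.aeval_def, Polynomial.eval₂_eq_eval_map]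
  have hH : ∀ x : Fin 3 → F, eval x H = k.eval (x 2) := by
    intro x
    change eval x (Polynomial.aeval (X 2) k) = _
    rw [← MvPolynomial.coe_aeval_eq_eval, RingHom.coe_coe, ← Polynomial.aeval_algHom_apply]
    simp [Polynomial.aeval_def, Polynomial.eval₂_eq_eval_map]
  let R : MvPolynomial (Fin 3) F := G * (X 0 - C b - C c * X 2) + H * (X 1 - C a)
  have hR : ∀ x : Fin 3 → F, eval x R =
      g.eval (x 2) * (x 0 - b - c * x 2) + k.eval (x 2) * (x 1 - a) := by
    intro x
    simp only [R, map_add, map_mul, map_sub, hG, hH, eval_X, eval_C]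
  have hQR : Q ∣ R := by
    by_contra hnd
    obtain ⟨J, hJs, hJc⟩ := Set.Infinite.exists_subset_card_eq
      (s := {t : F | g.eval t ≠ 0}) (by
        have : {t : F | g.eval t ≠ 0} = {t : F | g.IsRoot t}ᶜ := rfl
        rw [this]
        exact (Polynomial.finite_setOfPred_isRoot hg0).infinite_compl)
      (2 * Q.totalDegree * R.totalDegree + 1)
    have := card_vanishB_le hQi hnd (ι := F) (α := id)
      (γ := fun t => -(k.eval t / g.eval t)) (β := fun t => b + c * t - -(k.eval t / g.eval t) * a)
      J (fun _ _ _ _ h => h) ?_ ?_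
    · omega
    · intro t ht
      have ht' : g.eval t ≠ 0 := hJs ht
      refine vanishB_of_dvd_flat hQ hchar (h t) (by rwa [id, ← hge]) ?_
      rw [id]
      rw [← hge, ← hke]; field_simp; ring
    · intro t ht x
      have ht' : g.eval t ≠ 0 := hJs ht
      rw [hR]
      simp only [id, Matrix.cons_val_zero, Matrix.cons_val_one, Matrix.cons_val]
      field_simp; ring
  have hlin : ∀ y, g.eval y * (b' + c' * y - b - c * y) + k.eval y * (a' - a) = 0 := by
    intro y
    obtain ⟨W, hW⟩ := hQR
    have := hR ![b' + c' * y, a', y]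
    rw [hW, map_mul, h' y, zero_mul] at this
    simpa using this.symm
  have ha' : a' - a ≠ 0 := sub_ne_zero.2 haa.symm
  let B := (b' - b) / (a' - a)
  let D := (c' - c) / (a' - a)
  let T : MvPolynomial (Fin 3) F := X 0 - C b - C c * X 2 - (X 1 - C a) * (C B + C D * X 2)
  have hRT : R = G * T := by
    apply MvPolynomial.funext
    intro x
    rw [hR, map_mul, hG]
    simp only [T, map_sub, map_mul, map_add, eval_X, eval_C]
    have h1 : k.eval (x 2) = - g.eval (x 2) * (B + D * x 2) := by
      have := hlin (x 2)
      simp only [B, D]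
      field_simp
      linear_combination this
    rw [h1]; ring
  have hQG : ¬ Q ∣ G := by
    rintro ⟨W, hW⟩
    apply hg0
    apply Polynomial.funext
    intro t
    have := hG ![b + c * t, a, t]
    rw [hW, map_mul, h t, zero_mul] at this
    simpa using this.symm
  have hQT : Q ∣ T := (hQi.prime.dvd_or_dvd (hRT ▸ hQR)).resolve_left hQG
  refine ⟨b - a * B, B, c - a * D, D, fun b₁ c₁ a₁ h₁ => ?_⟩
  obtain ⟨W, hW⟩ := hQT
  have hT : ∀ t, b₁ + c₁ * t - b - c * t - (a₁ - a) * (B + D * t) = 0 := by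
    intro t
    have : eval ![b₁ + c₁ * t, a₁, t] T = 0 := by rw [hW, map_mul, h₁ t, zero_mul]
    simpa [T] using this
  have t0 := hT 0
  have t1 := hT 1
  constructor
  · linear_combination t0
  · linear_combination t1 - t0

end Flat

section Core

open MvPolynomial

variable {F : Type*} [Field F]

open Classical in
lemma exists_ruled [Infinite F] {ι : Type*} {β γ α : ι → F}
    (hα : Function.Injective α) {r : ι → ι → Prop} (hr : ∀ i j, r i j → Inc β γ α i j)
    {I J : Finset ι} {D e s : ℕ}
    (hI : ∀ i ∈ I, 2 * D ≤ (J.filter (r i)).card)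
    (hJ : ∀ j ∈ J, 2 * D ≤ (I.filter fun i => r i j).card)
    (hD : 3 * e < D) (hD2 : 2 ≤ D) (hs : J.card * (3 * e + 1) < s * D) (hse : 3 * s ≤ (e + 1) ^ 2)
    (h8 : 8 * (3 * e) * (3 * e) < J.card)
    (hchar : ∀ m : ℕ, 0 < m → m ≤ 3 * e → (m : F) ≠ 0) :
    ∃ i₀ ∈ I, ∃ j ∈ J, r i₀ j ∧ ∃ A B C E : F, β i₀ = A + B * α i₀ ∧ γ i₀ = C + E * α i₀ ∧
      D ≤ (I.filter fun i => r i j ∧ β i = A + B * α i ∧ γ i = C + E * α i).card := by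
  obtain ⟨Q, hQi, hQd, J', hJ'J, hJ'c, hJ'⟩ :=
    exists_irreducible_surface hα hr hI hJ hD hs hse h8
  have hflat : Q ∣ flat Q := by
    by_contra hnd
    have h1 := card_vanishB_le hQi hnd J' hα.injOn (fun j hj => (hJ' j hj).1)
      (fun j hj => vanishB_flat (hJ' j hj).1)
    have h2 : 2 * Q.totalDegree * (flat Q).totalDegree ≤ 2 * Q.totalDegree * (3 * Q.totalDegree) :=
      Nat.mul_le_mul_left _ (totalDegree_flat_le Q)
    have h3 : 6 * Q.totalDegree * Q.totalDegree ≤ 6 * Q.totalDegree * (3 * e) :=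
      Nat.mul_le_mul_left _ hQd
    nlinarith
  have hne : J'.Nonempty := Finset.card_pos.1 (by omega)
  have hchar' : ∀ m : ℕ, 0 < m → m ≤ Q.totalDegree → (m : F) ≠ 0 :=
    fun m h1 h2 => hchar m h1 (h2.trans hQd)
  have hz0 : pderiv 0 Q ≠ 0 := by
    intro hz
    obtain ⟨j, hj⟩ := hne
    have hcard := (hJ' j hj).2
    have hconst : ∀ u : Fin 3 → F, ∀ t, eval (fun i => u i + ![1, 0, 0] i * t) Q = eval u Q := by
      intro u t
      have hd : Polynomial.derivative (restr u ![1, 0, 0] Q) = 0 := by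
        rw [derivative_restr, Fin.sum_univ_three, hz]; simp
      have hnd : (restr u ![1, 0, 0] Q).natDegree = 0 := by
        by_contra hpos
        have hc := congrArg (fun f => Polynomial.coeff f ((restr u ![1, 0, 0] Q).natDegree - 1)) hd
        simp only [Polynomial.coeff_derivative, Polynomial.coeff_zero] at hc
        have e1 : (restr u ![1, 0, 0] Q).natDegree - 1 + 1 = (restr u ![1, 0, 0] Q).natDegree := by
          omega
        have e2 := hchar' (restr u ![1, 0, 0] Q).natDegree (by omega) (natDegree_restr_le _ _ _)
        rw [← Nat.cast_succ, Nat.succ_eq_add_one, e1] at hc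
        refine (mul_ne_zero ?_ e2) hc
        rw [Polynomial.coeff_natDegree, Polynomial.leadingCoeff_ne_zero]
        rintro h0
        rw [h0] at hpos; simp at hpos
      rw [← eval_restr, Polynomial.eq_C_of_natDegree_eq_zero hnd, Polynomial.eval_C,
        Polynomial.coeff_zero_eq_eval_zero, eval_restr_zero]
    apply hQi.ne_zero
    apply MvPolynomial.funext
    intro x
    rw [map_zero]
    have key : ∀ t, eval (fun i => ![x 0, 0, x 2] i + ![0, 1, 0] i * t) Q = 0 := by
      refine eval_line_eq_zero (T := ((I.filter fun i => r i j ∧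
        VanishA Q (β i) (γ i) (α i)).image α)) ?_ ?_
      · rw [Finset.card_image_of_injective _ hα]; omega
      · intro t ht
        obtain ⟨i, hi, rfl⟩ := Finset.mem_image.1 ht
        have h1 := (Finset.mem_filter.1 hi).2.2 (x 2)
        rw [← hconst _ (x 0 - (β i + γ i * x 2))] at h1
        refine Eq.trans ?_ h1
        congr 2
        ext m; fin_cases m <;> simp
    refine Eq.trans ?_ (key (x 1))
    congr 2
    ext m; fin_cases m <;> simp
  have hexi : ∃ j ∈ J', ∃ i ∈ I, r i j ∧ VanishA Q (β i) (γ i) (α i) ∧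
      ¬ VanishA (pderiv 0 Q) (β i) (γ i) (α i) := by
    by_contra! hcon
    have hdl := totalDegree_pderiv_le 0 Q
    have hvan : ∀ j ∈ J', VanishB (pderiv 0 Q) (β j) (γ j) (α j) := by
      intro j hj
      refine vanishB_of_inc hα (T := I.filter fun i => r i j ∧ VanishA Q (β i) (γ i) (α i))
        (lt_of_lt_of_le (by omega) (hJ' j hj).2) fun i hi => ?_
      rw [Finset.mem_filter] at hi
      exact ⟨hr i j hi.2.1, hcon j hj i hi.1 hi.2.1 hi.2.2⟩
    have hdvd : Q ∣ pderiv 0 Q := by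
      by_contra hnd
      have h1 := card_vanishB_le hQi hnd J' hα.injOn (fun j hj => (hJ' j hj).1) hvan
      have h2 : 2 * Q.totalDegree * (pderiv 0 Q).totalDegree ≤ 2 * Q.totalDegree * (3 * e) :=
        Nat.mul_le_mul_left _ (by omega)
      nlinarith
    obtain ⟨W, hW⟩ := hdvd
    have hW0 : W ≠ 0 := by rintro rfl; exact hz0 (by simp [hW])
    have hdeg := totalDegree_mul_of_isDomain hQi.ne_zero hW0
    rw [← hW] at hdeg
    have hQ0 : Q.totalDegree = 0 := by omega
    rw [totalDegree_eq_zero_iff_eq_C.1 hQ0] at hz0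
    simp at hz0
  obtain ⟨j, hj, i₀, hi₀, hrij, hv, hnz⟩ := hexi
  have hcard := (hJ' j hj).2
  obtain ⟨i₁, hi₁, hne₁⟩ := Finset.exists_mem_ne
    (s := I.filter fun i => r i j ∧ VanishA Q (β i) (γ i) (α i)) (by omega) i₀
  rw [Finset.mem_filter] at hi₁
  obtain ⟨A, B, C, E, hABCE⟩ := ruled_of_dvd_flat hQi hflat hchar' hv hi₁.2.2
    (fun h => hne₁ (hα h).symm) hnz
  refine ⟨i₀, hi₀, j, hJ'J hj, hrij, A, B, C, E, (hABCE _ _ _ hv).1, (hABCE _ _ _ hv).2, ?_⟩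
  refine hcard.trans (Finset.card_le_card (Finset.monotone_filter_right _ fun i _ h => ?_))
  exact ⟨h.1, hABCE _ _ _ h.2⟩

end Core

section Incidence

variable {F : Type*} [Field F]

open Classical in
lemma exists_dense_subgraph {ι : Type*} [Fintype ι] (E : Finset (ι × ι)) (M : ℕ)
    (hE : M * (2 * Fintype.card ι) < E.card) :
    ∃ I J : Finset ι, I.Nonempty ∧ (∀ i ∈ I, M ≤ (J.filter fun j => (i, j) ∈ E).card) ∧
      ∀ j ∈ J, M ≤ (I.filter fun i => (i, j) ∈ E).card := by
  have key : ∀ N : ℕ, ∀ I J : Finset ι, I.card + J.card = N →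
      M * N < (E.filter fun x => x.1 ∈ I ∧ x.2 ∈ J).card →
      ∃ I J : Finset ι, I.Nonempty ∧ (∀ i ∈ I, M ≤ (J.filter fun j => (i, j) ∈ E).card) ∧
      ∀ j ∈ J, M ≤ (I.filter fun i => (i, j) ∈ E).card := by
    intro N
    induction N with
    | zero =>
      intro I J hN hlt
      have : I = ∅ := Finset.card_eq_zero.1 (by omega)
      simp [this] at hlt
    | succ N ih =>
      intro I J hN hlt
      by_cases h1 : ∀ i ∈ I, M ≤ (J.filter fun j => (i, j) ∈ E).card
      · by_cases h2 : ∀ j ∈ J, M ≤ (I.filter fun i => (i, j) ∈ E).card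
        · refine ⟨I, J, ?_, h1, h2⟩
          obtain ⟨x, hx⟩ := Finset.card_pos.1 (Nat.zero_lt_of_lt hlt)
          exact ⟨x.1, (Finset.mem_filter.1 hx).2.1⟩
        · push Not at h2
          obtain ⟨j, hj, hjM⟩ := h2
          apply ih I (J.erase j) (by rw [Finset.card_erase_of_mem hj]; have := Finset.card_pos.2 ⟨j, hj⟩; omega)
          have hsub : (E.filter fun x => x.1 ∈ I ∧ x.2 ∈ J) ⊆
              (E.filter fun x => x.1 ∈ I ∧ x.2 ∈ J.erase j) ∪
                (I.filter fun i => (i, j) ∈ E).image fun i => (i, j) := by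
            rintro ⟨a, b⟩ hx
            simp only [Finset.mem_filter, Finset.mem_union, Finset.mem_image, Finset.mem_erase,
              Prod.mk.injEq] at hx ⊢
            by_cases hb : b = j
            · subst hb; exact Or.inr ⟨a, ⟨hx.2.1, hx.1⟩, rfl, rfl⟩
            · exact Or.inl ⟨hx.1, hx.2.1, hb, hx.2.2⟩
          have h3 := (Finset.card_le_card hsub).trans (Finset.card_union_le _ _)
          have h4 := Finset.card_image_le (s := I.filter fun i => (i, j) ∈ E) (f := fun i => (i, j))
          rw [Nat.mul_succ] at hlt
          omega
      · push Not at h1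
        obtain ⟨i, hi, hiM⟩ := h1
        apply ih (I.erase i) J (by rw [Finset.card_erase_of_mem hi]; have := Finset.card_pos.2 ⟨i, hi⟩; omega)
        have hsub : (E.filter fun x => x.1 ∈ I ∧ x.2 ∈ J) ⊆
            (E.filter fun x => x.1 ∈ I.erase i ∧ x.2 ∈ J) ∪
              (J.filter fun j => (i, j) ∈ E).image fun j => (i, j) := by
          rintro ⟨a, b⟩ hx
          simp only [Finset.mem_filter, Finset.mem_union, Finset.mem_image, Finset.mem_erase,
            Prod.mk.injEq] at hx ⊢
          by_cases ha : a = i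
          · subst ha; exact Or.inr ⟨b, ⟨hx.2.2, hx.1⟩, rfl, rfl⟩
          · exact Or.inl ⟨hx.1, ⟨ha, hx.2.1⟩, hx.2.2⟩
        have h3 := (Finset.card_le_card hsub).trans (Finset.card_union_le _ _)
        have h4 := Finset.card_image_le (s := J.filter fun j => (i, j) ∈ E) (f := fun j => (i, j))
        rw [Nat.mul_succ] at hlt
        omega
  refine key (2 * Fintype.card ι) Finset.univ Finset.univ (by simp [two_mul]) (by simpa using hE)

open Classical in
lemma exists_ruled_of_card [Infinite F] {ι : Type*} [Fintype ι] {β γ α : ι → F}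
    (hα : Function.Injective α) (E : Finset (ι × ι)) (hE : ∀ x ∈ E, Inc β γ α x.1 x.2)
    {D p : ℕ} (hchar : ∀ m : ℕ, 0 < m → m < p → (m : F) ≠ 0)
    (hD : 12168 * Fintype.card ι < D ^ 2) (hDp : 39 * Fintype.card ι < D * p)
    (hEc : 4 * D * Fintype.card ι < E.card) :
    ∃ i₀ j, (i₀, j) ∈ E ∧ ∃ A B C G : F, β i₀ = A + B * α i₀ ∧ γ i₀ = C + G * α i₀ ∧
      D ≤ (Finset.univ.filter fun i =>
        Inc β γ α i j ∧ β i = A + B * α i ∧ γ i = C + G * α i).card := by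
  obtain ⟨I, J, ⟨i, hi⟩, hI, hJ⟩ := exists_dense_subgraph E (2 * D) (by linarith)
  have hD0 : 0 < D := by
    rcases Nat.eq_zero_or_pos D with h | h
    · simp [h] at hD
    · exact h
  have hJn : J.card ≤ Fintype.card ι := Finset.card_le_univ J
  have hJ2 : 2 * D ≤ J.card := (hI i hi).trans (Finset.card_filter_le _ _)
  set m := J.card
  set q := m / D with hq
  have hq2 : 2 ≤ q := (Nat.le_div_iff_mul_le hD0).2 hJ2
  have hqm : q * D ≤ m := Nat.div_mul_le_self _ _
  have hmq : m < (q + 1) * D := by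
    have h1 := Nat.div_add_mod m D
    have h2 := Nat.mod_lt m hD0
    rw [← hq] at h1
    linarith
  have hqD : 39 * q < D := by
    by_contra! h
    have := Nat.mul_le_mul_right D h
    nlinarith
  have hqp : 39 * q < p := by
    by_contra! h
    have := Nat.mul_le_mul_right D h
    nlinarith
  have hq8 : 12168 * q ^ 2 < m := by
    by_contra! h
    have h1 : 12168 * m < D ^ 2 := by linarith
    have h2 := Nat.mul_le_mul_right (D ^ 2) h
    have h3 : (q * D) ^ 2 ≤ m ^ 2 := Nat.pow_le_pow_left hqm 2
    have h4 : 0 < m := by omega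
    nlinarith
  obtain ⟨r, hr'⟩ : ∃ r : ι → ι → Prop, ∀ i j, r i j ↔ (i, j) ∈ E :=
    ⟨fun i j => (i, j) ∈ E, fun _ _ => Iff.rfl⟩
  simp only [← hr'] at hI hJ ⊢
  obtain ⟨i₀, -, j, -, hr, A, B, C, G, h1, h2, h3⟩ := exists_ruled (F := F) (β := β) (γ := γ) hα
    (r := r) (fun i j h => hE _ ((hr' i j).1 h)) (I := I) (J := J) (D := D) (e := 9 * q + 8)
    (s := (q + 1) * (3 * (9 * q + 8) + 1)) hI hJ (by omega) (by omega) (by nlinarith)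
    (by nlinarith) (by nlinarith) (fun m h1 h2 => hchar m h1 (by omega))
  refine ⟨i₀, j, hr, A, B, C, G, h1, h2, h3.trans (Finset.card_le_card ?_)⟩
  intro i hi
  rw [Finset.mem_filter] at hi ⊢
  exact ⟨Finset.mem_univ _, hE _ ((hr' _ _).1 hi.2.1), hi.2.2⟩

open Polynomial in
lemma exists_generic [Infinite F] {ι : Type*} [Fintype ι] (q γ α : ι → F)
    (hinj : Function.Injective fun i => (q i, γ i, α i)) :
    ∃ t : F, (∀ i, 1 + t * γ i ≠ 0) ∧
      Function.Injective fun i => (α i + t * q i + t ^ 3 * γ i) / (1 + t * γ i) := by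
  classical
  let f : ι × ι → F[X] := fun x => C (α x.1 - α x.2) +
    C (α x.1 * γ x.2 - α x.2 * γ x.1 + q x.1 - q x.2) * X +
    C (q x.1 * γ x.2 - q x.2 * γ x.1) * X ^ 2 + C (γ x.1 - γ x.2) * X ^ 3
  have hf : ∀ x, x.1 ≠ x.2 → f x ≠ 0 := by
    intro x hx h0
    have c0 := congrArg (fun g => coeff g 0) h0
    have c1 := congrArg (fun g => coeff g 1) h0
    have c3 := congrArg (fun g => coeff g 3) h0
    simp only [f, coeff_add, coeff_C_mul, coeff_X_pow, coeff_X, coeff_C, coeff_zero] at c0 c1 c3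
    norm_num at c0 c1 c3
    have e0 : α x.1 = α x.2 := sub_eq_zero.1 c0
    have e3 : γ x.1 = γ x.2 := sub_eq_zero.1 c3
    refine hx (hinj ?_)
    simp only [Prod.mk.injEq]
    refine ⟨?_, e3, e0⟩
    rw [e0, e3] at c1
    linear_combination c1
  let P : F[X] := (∏ i, (1 + X * C (γ i))) * ∏ x ∈ Finset.univ.filter (fun x : ι × ι => x.1 ≠ x.2), f x
  have hP : P ≠ 0 := by
    refine mul_ne_zero (Finset.prod_ne_zero_iff.2 fun i _ h => ?_)
      (Finset.prod_ne_zero_iff.2 fun x hx => hf x (Finset.mem_filter.1 hx).2)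
    have := congrArg (fun g => eval 0 g) h
    simp at this
  obtain ⟨t, ht⟩ : ∃ t, P.eval t ≠ 0 := by
    by_contra! h
    exact hP (Polynomial.funext (by simpa using h))
  simp only [P, eval_mul, eval_prod] at ht
  have h1 : ∀ i, 1 + t * γ i ≠ 0 := by
    intro i
    have := Finset.prod_ne_zero_iff.1 (left_ne_zero_of_mul ht) i (Finset.mem_univ _)
    simp only [eval_add, eval_one, eval_mul, eval_X, eval_C] at this
    exact this
  refine ⟨t, h1, fun i j hij => ?_⟩
  by_contra hne
  have h2 := Finset.prod_ne_zero_iff.1 (right_ne_zero_of_mul ht) (i, j)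
    (by simpa using hne)
  apply h2
  simp only at hij
  rw [div_eq_div_iff (h1 i) (h1 j)] at hij
  simp only [f, eval_add, eval_mul, eval_pow, eval_C, eval_X]
  linear_combination hij

open Classical in
/-- If the symplectic graph `q i - q j + γ i α j - α i γ j = 0` has many edges then many of the
points `(q i, γ i, α i)` lie on one line through an endpoint `i₀` of an edge `(i₀, j)`, inside the
plane dual to `j`. -/
theorem exists_collinear_of_card [Infinite F] {ι : Type*} [Fintype ι] {q γ α : ι → F}
    (hinj : Function.Injective fun i => (q i, γ i, α i)) (E : Finset (ι × ι))
    (hE : ∀ x ∈ E, q x.1 - q x.2 + γ x.1 * α x.2 - α x.1 * γ x.2 = 0)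
    {D p : ℕ} (hchar : ∀ m : ℕ, 0 < m → m < p → (m : F) ≠ 0)
    (hD : 12168 * Fintype.card ι < D ^ 2) (hDp : 39 * Fintype.card ι < D * p) (hD2 : 2 ≤ D)
    (hEc : 4 * D * Fintype.card ι < E.card) :
    ∃ i₀ j, (i₀, j) ∈ E ∧ ∃ i₁, i₁ ≠ i₀ ∧ q i₁ - q j + γ i₁ * α j - α i₁ * γ j = 0 ∧
      D ≤ (Finset.univ.filter fun i => ∃ s : F, q i = q i₀ + s * (q i₁ - q i₀) ∧
        γ i = γ i₀ + s * (γ i₁ - γ i₀) ∧ α i = α i₀ + s * (α i₁ - α i₀)).card := by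
  obtain ⟨t, h1, hα⟩ := exists_generic q γ α hinj
  set x : ι → F := fun i => (α i + t * q i + t ^ 3 * γ i) / (1 + t * γ i) with hx
  have hxe : ∀ i, α i + t * q i + t ^ 3 * γ i = (1 + t * γ i) * x i := by
    intro i; rw [hx]; have := h1 i; field_simp
  have hInc : ∀ i j, Inc (fun i => q i / (1 + t * γ i)) (fun i => γ i / (1 + t * γ i)) x i j ↔
      q i - q j + γ i * α j - α i * γ j = 0 := by
    intro i j
    have hi := h1 i
    have hj := h1 j
    rw [Inc, hx]
    field_simp
    rw [← sub_eq_zero]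
    apply Iff.of_eq
    congr 1
    ring
  obtain ⟨i₀, j, hij, A, B, C, G, h2, h3, h4⟩ := exists_ruled_of_card hα E
    (fun y hy => (hInc _ _).2 (hE y hy)) hchar hD hDp hEc
  obtain ⟨i₁, hi₁, hne⟩ := Finset.exists_mem_ne (lt_of_lt_of_le hD2 h4) i₀
  rw [Finset.mem_filter] at hi₁
  refine ⟨i₀, j, hij, i₁, hne, (hInc _ _).1 hi₁.2.1, h4.trans (Finset.card_le_card ?_)⟩
  intro i hi
  rw [Finset.mem_filter] at hi ⊢
  refine ⟨Finset.mem_univ _, ?_⟩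
  have hq : ∀ i, q i / (1 + t * γ i) = A + B * x i → q i = (1 + t * γ i) * (A + B * x i) := by
    intro i h; rw [← h, mul_div_cancel₀ _ (h1 i)]
  have hg : ∀ i, γ i / (1 + t * γ i) = C + G * x i → γ i = (1 + t * γ i) * (C + G * x i) := by
    intro i h; rw [← h, mul_div_cancel₀ _ (h1 i)]
  have q0 := hq i₀ h2
  have g0 := hg i₀ h3
  have q1 := hq i₁ hi₁.2.2.1
  have g1 := hg i₁ hi₁.2.2.2
  have qi := hq i hi.2.2.1
  have gi := hg i hi.2.2.2
  have hd : x i₁ - x i₀ ≠ 0 := sub_ne_zero.2 fun h => hne (hα h)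
  obtain ⟨l, m, hl1, hl2⟩ : ∃ l m : F,
      l * (1 + t * γ i₀) + m * (1 + t * γ i₁) = 1 + t * γ i ∧
      l * (1 + t * γ i₀) * x i₀ + m * (1 + t * γ i₁) * x i₁ = (1 + t * γ i) * x i := by
    have e0 := h1 i₀
    have e1 := h1 i₁
    refine ⟨(1 + t * γ i) * (x i₁ - x i) / (x i₁ - x i₀) / (1 + t * γ i₀),
      (1 + t * γ i) * (x i - x i₀) / (x i₁ - x i₀) / (1 + t * γ i₁), ?_, ?_⟩
    all_goals
      rw [div_mul_cancel₀ _ e0, div_mul_cancel₀ _ e1]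
      field_simp
      ring
  have hγ : γ i = l * γ i₀ + m * γ i₁ := by
    linear_combination gi - l * g0 - m * g1 - C * hl1 - G * hl2
  have hqq : q i = l * q i₀ + m * q i₁ := by
    linear_combination qi - l * q0 - m * q1 - A * hl1 - B * hl2
  have hlm : l + m = 1 := by linear_combination hl1 + t * hγ
  have hαα : α i = l * α i₀ + m * α i₁ := by
    linear_combination hxe i - l * hxe i₀ - m * hxe i₁ - t * hqq - t ^ 3 * hγ - hl2
  obtain rfl : l = 1 - m := by linear_combination hlm
  exact ⟨m, by rw [hqq]; ring, by rw [hγ]; ring, by rw [hαα]; ring⟩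

end Incidence

section IsotropicCoordinates

variable {k F : Type*} [Field k] [Field F] [Algebra k F]

/-- The isotropic coordinate `x₁ + θ x₂`, where `θ² = -1`. -/
def iso (θ : F) (x : k × k) : F := algebraMap k F x.1 + θ * algebraMap k F x.2

lemma iso_add (θ : F) (x y : k × k) : iso θ (x + y) = iso θ x + iso θ y := by
  simp only [iso, Prod.fst_add, Prod.snd_add, map_add]; ring

lemma iso_sub (θ : F) (x y : k × k) : iso θ (x - y) = iso θ x - iso θ y := by
  simp only [iso, Prod.fst_sub, Prod.snd_sub, map_sub]; ring

lemma dist2_iso {θ : F} (hθ : θ ^ 2 = -1) (x y : k × k) :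
    algebraMap k F (dist2 x y) = (iso θ x - iso θ y) * (iso (-θ) x - iso (-θ) y) := by
  simp only [dist2, iso, map_add, map_pow, map_sub]
  linear_combination (algebraMap k F x.2 - algebraMap k F y.2) ^ 2 * hθ

lemma dot_self_iso {θ : F} (hθ : θ ^ 2 = -1) (x : k × k) :
    algebraMap k F (dot x x) = iso θ x * iso (-θ) x := by
  simp only [dot, iso, map_add, map_mul]
  linear_combination (algebraMap k F x.2) ^ 2 * hθ

lemma two_dot_iso {θ : F} (hθ : θ ^ 2 = -1) (x y : k × k) :
    2 * algebraMap k F (dot x y) = iso θ x * iso (-θ) y + iso (-θ) x * iso θ y := by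
  simp only [dot, iso, map_add, map_mul]
  linear_combination (2 * algebraMap k F x.2 * algebraMap k F y.2) * hθ

lemma cross_iso (θ : F) (x y : k × k) :
    2 * θ * algebraMap k F (x.2 * y.1 - x.1 * y.2) = iso θ x * iso (-θ) y - iso (-θ) x * iso θ y := by
  simp only [iso, map_sub, map_mul]
  ring

lemma two_ne_zero_of (h2 : (2 : k) ≠ 0) : (2 : F) ≠ 0 := by
  rw [← map_ofNat (algebraMap k F) 2]
  exact (map_ne_zero _).2 h2

lemma theta_ne_zero {θ : F} (hθ : θ ^ 2 = -1) : θ ≠ 0 := by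
  rintro rfl
  simp at hθ

lemma cross_eq_zero_of_iso (h2 : (2 : k) ≠ 0) {θ : F} (hθ : θ ^ 2 = -1) {x y : k × k}
    (h : iso θ x * iso (-θ) y = iso (-θ) x * iso θ y) : x.2 * y.1 = x.1 * y.2 := by
  have h1 := cross_iso θ x y
  rw [h, sub_self, mul_eq_zero, map_eq_zero] at h1
  rcases h1 with h1 | h1
  · exact absurd h1 (mul_ne_zero (two_ne_zero_of h2) (theta_ne_zero hθ))
  · exact sub_eq_zero.1 h1

lemma eq_of_iso (h2 : (2 : k) ≠ 0) {θ : F} (hθ : θ ^ 2 = -1) {x y : k × k}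
    (h : iso θ x = iso θ y) (h' : iso (-θ) x = iso (-θ) y) : x = y := by
  have h0 := two_ne_zero_of (F := F) h2
  simp only [iso] at h h'
  have e1 : algebraMap k F x.1 = algebraMap k F y.1 :=
    mul_left_cancel₀ h0 (by linear_combination h + h')
  have e2 : algebraMap k F x.2 = algebraMap k F y.2 :=
    mul_left_cancel₀ (mul_ne_zero h0 (theta_ne_zero hθ)) (by linear_combination h - h')
  exact Prod.ext ((algebraMap k F).injective e1) ((algebraMap k F).injective e2)

end IsotropicCoordinates

section Bisectors

variable {k : Type*} [Field k]

lemma mem_bisector {a b x : k × k} :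
    x ∈ bisector a b ↔ 2 * dot (b - a) x = dot b b - dot a a := by
  simp only [bisector, Set.mem_ofPred_eq, dist2, dot, Prod.fst_sub, Prod.snd_sub]
  constructor <;> intro h <;> linear_combination h

lemma midpoint_mem_bisector (h2 : (2 : k) ≠ 0) (a b : k × k) :
    ((a.1 + b.1) / 2, (a.2 + b.2) / 2) ∈ bisector a b := by
  rw [mem_bisector]
  simp only [dot, Prod.fst_sub, Prod.snd_sub]
  field_simp
  ring

lemma parallel_of_bisector_eq (h2 : (2 : k) ≠ 0) {a b c d : k × k}
    (h : bisector a b = bisector c d) :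
    (d - c).1 * (b - a).2 = (d - c).2 * (b - a).1 ∧ dot (d - c) (c + d - a - b) = 0 := by
  have h0 := midpoint_mem_bisector h2 a b
  have h1 : ((a.1 + b.1) / 2 - (b - a).2, (a.2 + b.2) / 2 + (b - a).1) ∈ bisector a b := by
    rw [mem_bisector] at h0 ⊢
    simp only [dot] at h0 ⊢
    linear_combination h0
  rw [h, mem_bisector] at h0 h1
  simp only [dot] at h0 h1 ⊢
  have e : ∀ x y : k, 2 * ((x + y) / 2) = x + y := fun x y => by field_simp
  have e1 := e a.1 b.1
  have e2 := e a.2 b.2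
  refine ⟨mul_left_cancel₀ h2 (by linear_combination h0 - h1), ?_⟩
  simp only [Prod.fst_sub, Prod.snd_sub, Prod.fst_add, Prod.snd_add] at h0 ⊢
  linear_combination -h0 + (d.1 - c.1) * e1 + (d.2 - c.2) * e2

lemma iso_of_bisector_eq {F : Type*} [Field F] [Algebra k F] (h2 : (2 : k) ≠ 0) {θ : F}
    (hθ : θ ^ 2 = -1) {a b c d : k × k} (h : bisector a b = bisector c d)
    (hcd : dot (d - c) (d - c) ≠ 0) :
    iso θ (d - b) * iso (-θ) (b - a) + iso (-θ) (c - a) * iso θ (b - a) = 0 ∧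
    iso (-θ) (d - b) * iso θ (b - a) + iso θ (c - a) * iso (-θ) (b - a) = 0 := by
  obtain ⟨h3, h4⟩ := parallel_of_bisector_eq h2 h
  have h5 := cross_iso θ (d - c) (b - a)
  rw [h3, sub_self, map_zero, mul_zero] at h5
  have h6 := two_dot_iso hθ (d - c) (c + d - a - b)
  rw [h4, map_zero, mul_zero] at h6
  have h7 := dot_self_iso hθ (d - c)
  have h8 : iso θ (d - c) * iso (-θ) (d - c) ≠ 0 := by
    rw [← h7]; exact (map_ne_zero _).2 hcd
  have h9 := right_ne_zero_of_mul h8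
  have e := two_ne_zero_of (F := F) h2
  simp only [iso_sub, iso_add] at *
  constructor <;> refine mul_left_cancel₀ (mul_ne_zero e h9) ?_
  · linear_combination -(iso (-θ) b - iso (-θ) a) * h6 - (iso (-θ) d - iso (-θ) c) * h5 + (iso (-θ) c + iso (-θ) d - iso (-θ) a - iso (-θ) b) * h5
  · linear_combination -(iso (-θ) b - iso (-θ) a) * h6 + (iso (-θ) d - iso (-θ) c) * h5 + (iso (-θ) c + iso (-θ) d - iso (-θ) a - iso (-θ) b) * h5

lemma exists_similarity {F : Type*} [Field F] [Algebra k F] (x₀ x₁ u₀ u₁ : k × k)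
    (h : dot (u₀ - u₁) (u₀ - u₁) ≠ 0) :
    ∃ m y : k × k, ∀ θ : F, θ ^ 2 = -1 →
      iso θ x₀ = iso θ y + iso θ m * iso θ u₀ ∧ iso θ x₁ = iso θ y + iso θ m * iso θ u₁ := by
  set w := u₀ - u₁ with hw
  set e := x₀ - x₁ with he
  set m : k × k := (dot e w / dot w w, (e.2 * w.1 - e.1 * w.2) / dot w w) with hm
  have hmul : ∀ (θ : F) (u : k × k), θ ^ 2 = -1 →
      iso θ (m.1 * u.1 - m.2 * u.2, m.1 * u.2 + m.2 * u.1) = iso θ m * iso θ u := by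
    intro θ u hθ
    simp only [iso, map_sub, map_add, map_mul]
    linear_combination (-(algebraMap k F m.2 * algebraMap k F u.2)) * hθ
  have hme : (m.1 * w.1 - m.2 * w.2, m.1 * w.2 + m.2 * w.1) = e := by
    simp only [hm]
    simp only [dot] at h ⊢
    refine Prod.ext ?_ ?_
    all_goals
      simp only [div_mul_eq_mul_div, ← sub_div, ← add_div]
      rw [div_eq_iff h]
      ring
  refine ⟨m, x₀ - (m.1 * u₀.1 - m.2 * u₀.2, m.1 * u₀.2 + m.2 * u₀.1), fun θ hθ => ?_⟩
  have h1 := hmul θ u₀ hθ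
  have h2 := hmul θ w hθ
  rw [hme, he, hw, iso_sub, iso_sub] at h2
  rw [iso_sub]
  constructor
  · linear_combination h1
  · linear_combination h1 - h2

end Bisectors

section Directions

variable {k : Type*} [Field k]

/-- A linear form whose level sets are the lines with direction class `o`; `none` is vertical. -/
def dirForm : Option k → k × k → k
  | none, x => x.1
  | some s, x => x.2 - s * x.1

lemma dirForm_sub (o : Option k) (x y : k × k) : dirForm o (x - y) = dirForm o x - dirForm o y := by
  cases o <;> simp [dirForm]; ring

lemma ne_zero_of_dot {n : k × k} (h : dot n n ≠ 0) : n ≠ 0 := by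
  rintro rfl
  simp [dot] at h

lemma exists_smul_of_parallel {n m : k × k} (hn : n ≠ 0) (h : n.1 * m.2 = n.2 * m.1) :
    ∃ t : k, m = t • n := by
  by_cases h0 : n.1 = 0
  · have h3 : n.2 ≠ 0 := fun h' => hn (Prod.ext h0 h')
    rw [h0, zero_mul] at h
    have h4 := (mul_eq_zero.1 h.symm).resolve_left h3
    refine ⟨m.2 / n.2, Prod.ext ?_ ?_⟩
    · rw [h4, Prod.smul_fst, h0, smul_zero]
    · rw [Prod.smul_snd, smul_eq_mul, div_mul_cancel₀ _ h3]
  · refine ⟨m.1 / n.1, Prod.ext ?_ ?_⟩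
    · rw [Prod.smul_fst, smul_eq_mul, div_mul_cancel₀ _ h0]
    · rw [Prod.smul_snd, smul_eq_mul]
      field_simp
      linear_combination h

variable [DecidableEq k]

/-- The direction class of a vector. -/
def dirClass (n : k × k) : Option k := if n.1 = 0 then none else some (n.2 / n.1)

/-- The coordinate of a vector along its direction class. -/
def dirCoord (n : k × k) : k := if n.1 = 0 then n.2 else n.1

lemma dirForm_dirClass_eq_zero {n x : k × k} (hn : n ≠ 0) :
    dirForm (dirClass n) x = 0 ↔ x.2 * n.1 = x.1 * n.2 := by
  unfold dirClass
  split_ifs with h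
  · have : n.2 ≠ 0 := fun h' => hn (Prod.ext h h')
    simp [dirForm, h, this]
  · simp only [dirForm]
    rw [sub_eq_zero]
    field_simp

lemma dirForm_dirClass_eq {n x y : k × k} (hn : n ≠ 0) :
    dirForm (dirClass n) x = dirForm (dirClass n) y ↔ (x - y).2 * n.1 = (x - y).1 * n.2 := by
  rw [← dirForm_dirClass_eq_zero hn, dirForm_sub, sub_eq_zero]

lemma eq_of_dirClass_eq {n m : k × k} (h : dirClass n = dirClass m) (h' : dirCoord n = dirCoord m) :
    n = m := by
  unfold dirClass at h
  unfold dirCoord at h'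
  split_ifs at h h' with h1 h2 h2
  · exact Prod.ext (h1.trans h2.symm) h'
  · simp only [Option.some.injEq] at h
    rw [h'] at h
    exact Prod.ext h' (by field_simp at h; exact h)

lemma dirClass_eq_of_parallel {n m : k × k} (hn : n ≠ 0) (hm : m ≠ 0) (h : n.1 * m.2 = n.2 * m.1) :
    dirClass n = dirClass m := by
  have hn' : n.1 = 0 → n.2 ≠ 0 := fun h h' => hn (Prod.ext h h')
  have hm' : m.1 = 0 → m.2 ≠ 0 := fun h h' => hm (Prod.ext h h')
  unfold dirClass
  split_ifs with h1 h2 h2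
  · rfl
  · rw [h1] at h; simp [h2, hn' h1] at h
  · rw [h2] at h; simp [h1, hm' h2] at h
  · refine congrArg some ((div_eq_div_iff h1 h2).2 ?_)
    linear_combination -h

lemma parallel_of_dirClass_eq {n m : k × k} (h : dirClass n = dirClass m) :
    n.1 * m.2 = n.2 * m.1 := by
  unfold dirClass at h
  split_ifs at h with h1 h2 h2
  · simp [h1, h2]
  · simp only [Option.some.injEq] at h
    rw [div_eq_div_iff h1 h2] at h
    linear_combination -h

/-- A point is determined by another one, the direction of their difference and a point of their
bisector. -/
lemma eq_of_mem_bisector {a b b' x : k × k} (hb : dot (b - a) (b - a) ≠ 0) (hb' : b' ≠ a)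
    (h : dirClass (b - a) = dirClass (b' - a)) (hx : x ∈ bisector a b) (hx' : x ∈ bisector a b') :
    b = b' := by
  have h1 := parallel_of_dirClass_eq h
  rw [mem_bisector] at hx hx'
  obtain ⟨t, ht⟩ := exists_smul_of_parallel (ne_zero_of_dot hb) h1
  have ht0 : t ≠ 0 := by
    rintro rfl
    rw [zero_smul, sub_eq_zero] at ht
    exact hb' ht
  have hb1 : b'.1 = a.1 + t * (b.1 - a.1) := by
    have := congrArg Prod.fst ht
    simp only [Prod.fst_sub, Prod.smul_fst, smul_eq_mul] at this
    linear_combination this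
  have hb2 : b'.2 = a.2 + t * (b.2 - a.2) := by
    have := congrArg Prod.snd ht
    simp only [Prod.snd_sub, Prod.smul_snd, smul_eq_mul] at this
    linear_combination this
  simp only [dot, Prod.fst_sub, Prod.snd_sub] at hx hx' hb
  rw [hb1, hb2] at hx'
  have h5 : t * (t - 1) * ((b.1 - a.1) * (b.1 - a.1) + (b.2 - a.2) * (b.2 - a.2)) = 0 := by
    linear_combination t * hx - hx'
  have h6 := (mul_eq_zero.1 ((mul_eq_zero.1 h5).resolve_right hb)).resolve_left ht0
  rw [sub_eq_zero] at h6
  subst h6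
  exact Prod.ext (by rw [hb1]; ring) (by rw [hb2]; ring)

end Directions

section RichSets

variable {k : Type*} [Field k] [DecidableEq k]

/-- The points of `A` on rich circles centred at `y`. -/
def richCirc (A : Finset (k × k)) (y : k × k) : Finset (k × k) :=
  A.filter fun a => dist2 a y ≠ 0 ∧ 8 * A.card ≤ (A.filter fun x => dist2 x y = dist2 a y).card ^ 2

/-- The points of `A` on rich lines with direction class `o`. -/
def richDir (A : Finset (k × k)) (o : Option k) : Finset (k × k) :=
  A.filter fun a => 8 * A.card ≤ (A.filter fun x => dirForm o x = dirForm o a).card ^ 2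

lemma mem_richCirc_of_card {A : Finset (k × k)} {y a : k × k} (ha : a ∈ A) (h0 : dist2 a y ≠ 0)
    {ι : Type*} (S : Finset ι) (P : ι → k × k) (hP : ∀ i ∈ S, P i ∈ A)
    (hinj : Set.InjOn P S) (hd : ∀ i ∈ S, dist2 (P i) y = dist2 a y) (hS : 8 * A.card ≤ S.card ^ 2) :
    a ∈ richCirc A y := by
  rw [richCirc, Finset.mem_filter]
  refine ⟨ha, h0, hS.trans (Nat.pow_le_pow_left ?_ 2)⟩
  exact Finset.card_le_card_of_injOn P
    (fun i hi => Finset.mem_coe.2 (Finset.mem_filter.2 ⟨hP i hi, hd i hi⟩)) hinj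

lemma mem_richDir_of_card {A : Finset (k × k)} {a : k × k} {o : Option k} (ha : a ∈ A)
    {ι : Type*} (S : Finset ι) (P : ι → k × k) (hP : ∀ i ∈ S, P i ∈ A)
    (hinj : Set.InjOn P S) (hd : ∀ i ∈ S, dirForm o (P i) = dirForm o a)
    (hS : 8 * A.card ≤ S.card ^ 2) :
    a ∈ richDir A o := by
  rw [richDir, Finset.mem_filter]
  refine ⟨ha, hS.trans (Nat.pow_le_pow_left ?_ 2)⟩
  exact Finset.card_le_card_of_injOn P
    (fun i hi => Finset.mem_coe.2 (Finset.mem_filter.2 ⟨hP i hi, hd i hi⟩)) hinj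

/-- The configurations `(a, b, c, d)` which come from rich lines or circles. -/
def RichQuad (A : Finset (k × k)) (a b c : k × k) : Prop :=
  (a ∈ richDir A (dirClass (b - a)) ∧ c ∈ richDir A (dirClass (b - a))) ∨
  ∃ y ∈ bisector a b, (a ∈ richCirc A y ∧ c ∈ richCirc A y) ∨
    (c ∈ richCirc A y ∧ dist2 a y = 0) ∨ (a ∈ richCirc A y ∧ dist2 c y = 0)

variable {F : Type*} [Field F] [Algebra k F]

lemma richQuad_of_collinear (h2 : (2 : k) ≠ 0) {θ : F} (hθ : θ ^ 2 = -1) {A A' : Finset (k × k)}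
    (hA : A' ⊆ A) {m : ℕ} (hm : ∀ z : F, ∀ S ⊆ A', (∀ x ∈ S, iso θ x = z) → S.card ≤ m)
    {ι : Type*} {P Q : ι → k × k} (hP : ∀ i, P i ∈ A') (hQ : ∀ i, Q i ∈ A')
    (hPQ : ∀ i j, P i = P j → Q i = Q j → i = j) {r : k} (hr : r ≠ 0)
    (hd : ∀ i, dist2 (Q i) (P i) = r) {q γ α : ι → F} (hq : ∀ i, q i = iso θ (P i))
    (hα : ∀ i, α i = iso θ (Q i) - iso θ (P i))
    (hγ : ∀ i, γ i * algebraMap k F r = iso (-θ) (P i) * α i)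
    {i₀ i₁ j : ι} (h0 : q i₀ - q j + γ i₀ * α j - α i₀ * γ j = 0)
    (h1 : q i₁ - q j + γ i₁ * α j - α i₁ * γ j = 0) (hj : P j ≠ P i₀) (S : Finset ι)
    (hmS : m < S.card) (hS : ∀ i ∈ S, ∃ s : F, q i = q i₀ + s * (q i₁ - q i₀) ∧
        γ i = γ i₀ + s * (γ i₁ - γ i₀) ∧ α i = α i₀ + s * (α i₁ - α i₀))
    (hrich : 8 * A.card ≤ S.card ^ 2) : RichQuad A (P i₀) (P j) (Q i₀) := by
  have hθ' : (-θ) ^ 2 = -1 := by rw [neg_sq, hθ]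
  have hR : algebraMap k F r ≠ 0 := (map_ne_zero _).2 hr
  obtain ⟨β, hβ⟩ : ∃ β : ι → F, ∀ i, β i = iso (-θ) (Q i) - iso (-θ) (P i) :=
    ⟨_, fun i => rfl⟩
  have hαβ : ∀ i, α i * β i = algebraMap k F r := by
    intro i
    rw [hα, hβ, ← hd i, dist2_iso hθ]
  have hα0 : ∀ i, α i ≠ 0 := fun i h => hR (by rw [← hαβ i, h, zero_mul])
  have hβ0 : ∀ i, β i ≠ 0 := fun i h => hR (by rw [← hαβ i, h, mul_zero])
  have hγβ : ∀ i, γ i * β i = iso (-θ) (P i) := fun i =>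
    mul_left_cancel₀ (hα0 i) (by linear_combination (γ i) * hαβ i + hγ i)
  by_cases hα1 : α i₁ = α i₀
  · left
    have hSα : ∀ i ∈ S, α i = α i₀ := by
      intro i hi
      obtain ⟨s, -, -, h⟩ := hS i hi
      rw [h, hα1]; ring
    have hSQ : ∀ i ∈ S, Q i = P i + (Q i₀ - P i₀) := by
      intro i hi
      have e := hSα i hi
      have e' : β i = β i₀ := mul_left_cancel₀ (hα0 i) (by rw [hαβ, e, hαβ])
      rw [hα, hα] at e
      rw [hβ, hβ] at e'
      apply eq_of_iso h2 hθ
      · rw [iso_add, iso_sub]; linear_combination e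
      · rw [iso_add, iso_sub]; linear_combination e'
    have hpar : ∀ i ∈ S, dirForm (dirClass (P j - P i₀)) (P i) =
        dirForm (dirClass (P j - P i₀)) (P i₀) := by
      intro i hi
      rw [dirForm_dirClass_eq (sub_ne_zero.2 hj)]
      apply cross_eq_zero_of_iso h2 hθ
      obtain ⟨s, hs1, hs2, -⟩ := hS i hi
      have e1 : iso (-θ) (P i) - iso (-θ) (P i₀) = s * (iso (-θ) (P i₁) - iso (-θ) (P i₀)) := by
        apply mul_left_cancel₀ (hα0 i₀)
        have g := hγ i
        have g1 := hγ i₁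
        rw [hSα i hi] at g
        rw [hα1] at g1
        linear_combination -g + hγ i₀ + (algebraMap k F r) * hs2 + s * g1 - s * hγ i₀
      have e2 : (q i₁ - q i₀) * algebraMap k F r +
          (iso (-θ) (P i₁) - iso (-θ) (P i₀)) * α i₀ * α j = 0 := by
        have g1 := hγ i₁
        rw [hα1] at g1 h1
        linear_combination (algebraMap k F r) * (h1 - h0) - α j * (g1 - hγ i₀)
      have e3 : (iso θ (P j) - iso θ (P i₀)) * algebraMap k F r +
          α i₀ * α j * (iso (-θ) (P j) - iso (-θ) (P i₀)) = 0 := by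
        rw [← hq, ← hq]
        linear_combination -(algebraMap k F r) * h0 + α j * hγ i₀ - α i₀ * hγ j
      rw [iso_sub, iso_sub, iso_sub, iso_sub, ← hq i, hs1, e1, hq i₁, hq i₀]
      apply mul_left_cancel₀ hR
      rw [hq, hq] at e2
      linear_combination s * (iso (-θ) (P j) - iso (-θ) (P i₀)) * e2 -
        s * (iso (-θ) (P i₁) - iso (-θ) (P i₀)) * e3
    constructor
    · refine mem_richDir_of_card (hA (hP _)) S P (fun i _ => hA (hP i)) ?_ hpar hrich
      intro i hi i' hi' h
      exact hPQ i i' h (by rw [hSQ i hi, hSQ i' hi', h])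
    · refine mem_richDir_of_card (hA (hQ _)) S Q (fun i _ => hA (hQ i)) ?_ ?_ hrich
      · intro i hi i' hi' h
        refine hPQ i i' ?_ h
        rw [hSQ i hi, hSQ i' hi'] at h
        exact add_right_cancel h
      · intro i hi
        have h := hpar i hi
        rw [← sub_eq_zero, ← dirForm_sub] at h ⊢
        rwa [hSQ i hi, add_sub_assoc, sub_sub_cancel_left, ← sub_eq_add_neg]
  · right
    have hw : dot ((Q i₀ - P i₀) - (Q i₁ - P i₁)) ((Q i₀ - P i₀) - (Q i₁ - P i₁)) ≠ 0 := by
      intro h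
      have := dot_self_iso hθ ((Q i₀ - P i₀) - (Q i₁ - P i₁))
      rw [h, map_zero, iso_sub, iso_sub, iso_sub, iso_sub, iso_sub, iso_sub, ← hα, ← hα, ← hβ,
        ← hβ, zero_eq_mul, sub_eq_zero, sub_eq_zero] at this
      rcases this with h | h
      · exact hα1 h.symm
      · apply hα1
        apply mul_right_cancel₀ (hβ0 i₀)
        rw [hαβ, h, hαβ]
    obtain ⟨μ, y, hy⟩ := exists_similarity (F := F) (P i₀) (P i₁) _ _ hw
    obtain ⟨y0, y1⟩ := hy θ hθ
    obtain ⟨y0', y1'⟩ := hy (-θ) hθ'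
    rw [iso_sub, ← hα] at y0 y1
    rw [iso_sub, ← hβ] at y0' y1'
    have g0 : γ i₀ * algebraMap k F r = iso (-θ) μ * algebraMap k F r + iso (-θ) y * α i₀ := by
      rw [hγ, y0', ← hαβ i₀]; ring
    have g1 : γ i₁ * algebraMap k F r = iso (-θ) μ * algebraMap k F r + iso (-θ) y * α i₁ := by
      rw [hγ, y1', ← hαβ i₁]; ring
    have hSP : ∀ i ∈ S, iso θ (P i) = iso θ y + iso θ μ * α i := by
      intro i hi
      obtain ⟨s, hs1, -, hs3⟩ := hS i hi
      rw [hq, hq, hq] at hs1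
      linear_combination hs1 - iso θ μ * hs3 + (1 - s) * y0 + s * y1
    have hSP' : ∀ i ∈ S, iso (-θ) (P i) = iso (-θ) y + iso (-θ) μ * β i := by
      intro i hi
      obtain ⟨s, -, hs2, hs3⟩ := hS i hi
      apply mul_left_cancel₀ (hα0 i)
      linear_combination -hγ i + (algebraMap k F r) * hs2 + (1 - s) * g0 + s * g1 -
        iso (-θ) y * hs3 - iso (-θ) μ * hαβ i
    have hb : iso θ (P j) = iso θ y + iso (-θ) μ * α j ∧
        iso (-θ) (P j) = iso (-θ) y + iso θ μ * β j := by
      have k1 : (iso θ y - q j + iso (-θ) μ * α j) * algebraMap k F r +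
          α i₀ * ((iso θ μ - γ j) * algebraMap k F r + iso (-θ) y * α j) = 0 := by
        rw [hq] at h0
        linear_combination (algebraMap k F r) * h0 - α j * g0 - (algebraMap k F r) * y0
      have k2 : (iso θ y - q j + iso (-θ) μ * α j) * algebraMap k F r +
          α i₁ * ((iso θ μ - γ j) * algebraMap k F r + iso (-θ) y * α j) = 0 := by
        rw [hq] at h1
        linear_combination (algebraMap k F r) * h1 - α j * g1 - (algebraMap k F r) * y1
      have k3 : (iso θ μ - γ j) * algebraMap k F r + iso (-θ) y * α j = 0 := by
        apply mul_left_cancel₀ (sub_ne_zero.2 hα1)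
        linear_combination k2 - k1
      rw [k3, mul_zero, add_zero] at k1
      have k4 := (mul_eq_zero.1 k1).resolve_right hR
      rw [hq] at k4
      refine ⟨by linear_combination -k4, ?_⟩
      apply mul_left_cancel₀ (hα0 j)
      linear_combination -k3 - hγ j - iso θ μ * hαβ j
    have hQ1 : ∀ i, iso θ (Q i) = iso θ (P i) + α i := fun i => by rw [hα]; ring
    have hQ2 : ∀ i, iso (-θ) (Q i) = iso (-θ) (P i) + β i := fun i => by rw [hβ]; ring
    have dP : ∀ i ∈ S, algebraMap k F (dist2 (P i) y) =
        iso θ μ * iso (-θ) μ * algebraMap k F r := by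
      intro i hi
      rw [dist2_iso hθ, hSP i hi, hSP' i hi, ← hαβ i]; ring
    have dQ : ∀ i ∈ S, algebraMap k F (dist2 (Q i) y) =
        (iso θ μ + 1) * (iso (-θ) μ + 1) * algebraMap k F r := by
      intro i hi
      rw [dist2_iso hθ, hQ1, hQ2, hSP i hi, hSP' i hi, ← hαβ i]; ring
    have dP0 : algebraMap k F (dist2 (P i₀) y) = iso θ μ * iso (-θ) μ * algebraMap k F r := by
      rw [dist2_iso hθ, y0, y0', ← hαβ i₀]; ring
    have dQ0 : algebraMap k F (dist2 (Q i₀) y) =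
        (iso θ μ + 1) * (iso (-θ) μ + 1) * algebraMap k F r := by
      rw [dist2_iso hθ, hQ1, hQ2, y0, y0', ← hαβ i₀]; ring
    have hyB : y ∈ bisector (P i₀) (P j) := by
      apply (algebraMap k F).injective
      rw [dP0, dist2_iso hθ, hb.1, hb.2, ← hαβ j]; ring
    have ext_of_α : ∀ i ∈ S, ∀ i' ∈ S, α i = α i' → i = i' := by
      intro i hi i' hi' h
      have h' : β i = β i' := mul_left_cancel₀ (hα0 i) (by rw [hαβ, h, hαβ])
      refine hPQ i i' ?_ ?_
      · apply eq_of_iso h2 hθ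
        · rw [hSP i hi, hSP i' hi', h]
        · rw [hSP' i hi, hSP' i' hi', h']
      · apply eq_of_iso h2 hθ
        · rw [hQ1, hQ1, hSP i hi, hSP i' hi', h]
        · rw [hQ2, hQ2, hSP' i hi, hSP' i' hi', h']
    have ext_of_β : ∀ i ∈ S, ∀ i' ∈ S, β i = β i' → i = i' := by
      intro i hi i' hi' h
      exact ext_of_α i hi i' hi' (mul_right_cancel₀ (hβ0 i) (by rw [hαβ, h, hαβ]))
    have injP : iso (-θ) μ ≠ 0 → Set.InjOn P S := by
      intro h i hi i' hi' he
      apply ext_of_β i hi i' hi'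
      apply mul_left_cancel₀ h
      have e1 := hSP' i hi
      rw [he, hSP' i' hi'] at e1
      linear_combination -e1
    have injQ : iso (-θ) μ + 1 ≠ 0 → Set.InjOn Q S := by
      intro h i hi i' hi' he
      apply ext_of_β i hi i' hi'
      apply mul_left_cancel₀ h
      have e1 := hQ2 i
      rw [he, hQ2 i', hSP' i hi, hSP' i' hi'] at e1
      linear_combination -e1
    have hP0 : dist2 (P i₀) y ≠ 0 → P i₀ ∈ richCirc A y := by
      intro h
      refine mem_richCirc_of_card (hA (hP _)) h S P (fun i _ => hA (hP i)) (injP ?_) ?_ hrich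
      · intro h'
        rw [h', mul_zero, zero_mul, map_eq_zero] at dP0
        exact h dP0
      · intro i hi
        apply (algebraMap k F).injective
        rw [dP i hi, dP0]
    have hQ0 : dist2 (Q i₀) y ≠ 0 → Q i₀ ∈ richCirc A y := by
      intro h
      refine mem_richCirc_of_card (hA (hQ _)) h S Q (fun i _ => hA (hQ i)) (injQ ?_) ?_ hrich
      · intro h'
        rw [h', mul_zero, zero_mul, map_eq_zero] at dQ0
        exact h dQ0
      · intro i hi
        apply (algebraMap k F).injective
        rw [dQ i hi, dQ0]
    refine ⟨y, hyB, ?_⟩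
    by_cases z1 : dist2 (P i₀) y = 0
    · by_cases z2 : dist2 (Q i₀) y = 0
      · exfalso
        have w1 := dP0
        rw [z1, map_zero, zero_eq_mul, or_iff_left hR, mul_eq_zero] at w1
        have w2 := dQ0
        rw [z2, map_zero, zero_eq_mul, or_iff_left hR, mul_eq_zero] at w2
        rcases w1 with w1 | w1
        · rcases w2 with w2 | w2
          · rw [w1, zero_add] at w2; exact one_ne_zero w2
          · have hne' : iso (-θ) μ ≠ 0 := by
              intro h; rw [h, zero_add] at w2; exact one_ne_zero w2
            have := hm (iso θ y) (S.image P) (by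
              intro x hx; obtain ⟨i, -, rfl⟩ := Finset.mem_image.1 hx; exact hP i) (by
              intro x hx; obtain ⟨i, hi, rfl⟩ := Finset.mem_image.1 hx
              rw [hSP i hi, w1, zero_mul, add_zero])
            rw [Finset.card_image_of_injOn (injP hne')] at this
            omega
        · rcases w2 with w2 | w2
          · have hne' : iso (-θ) μ + 1 ≠ 0 := by
              rw [w1, zero_add]; exact one_ne_zero
            have := hm (iso θ y) (S.image Q) (by
              intro x hx; obtain ⟨i, -, rfl⟩ := Finset.mem_image.1 hx; exact hQ i) (by
              intro x hx; obtain ⟨i, hi, rfl⟩ := Finset.mem_image.1 hx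
              rw [hQ1, hSP i hi]
              linear_combination (α i) * w2)
            rw [Finset.card_image_of_injOn (injQ hne')] at this
            omega
          · rw [w1, zero_add] at w2; exact one_ne_zero w2
      · exact Or.inr (Or.inl ⟨hQ0 z2, z1⟩)
    · by_cases z2 : dist2 (Q i₀) y = 0
      · exact Or.inr (Or.inr ⟨hP0 z1, z2⟩)
      · exact Or.inl ⟨hP0 z1, hQ0 z2⟩

end RichSets

lemma sum_card_of_rich {α I : Type*} [DecidableEq α] {A : Finset α} (s : Finset I)
    (S : I → Finset α) (hS : ∀ i ∈ s, S i ⊆ A) (hrich : ∀ i ∈ s, 8 * A.card ≤ (S i).card ^ 2)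
    (hint : ∀ i ∈ s, ∀ j ∈ s, i ≠ j → (S i ∩ S j).card ≤ 2) :
    3 * ∑ i ∈ s, (S i).card ≤ 4 * A.card := by
  classical
  set σ := ∑ i ∈ s, (S i).card
  set n := A.card
  have h1 : ∑ a ∈ A, (s.filter fun i => a ∈ S i).card = σ := by
    simp_rw [Finset.card_filter]
    rw [Finset.sum_comm]
    refine Finset.sum_congr rfl fun i hi => ?_
    rw [← Finset.card_filter, Finset.filter_mem_eq_inter, Finset.inter_eq_right.2 (hS i hi)]
  have h2 : ∑ a ∈ A, (s.filter fun i => a ∈ S i).card ^ 2 = ∑ i ∈ s, ∑ j ∈ s, (S i ∩ S j).card := by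
    have : ∀ a, (s.filter fun i => a ∈ S i).card ^ 2 =
        ∑ i ∈ s, ∑ j ∈ s, if a ∈ S i ∩ S j then 1 else 0 := by
      intro a
      rw [sq, Finset.card_filter, Finset.sum_mul_sum]
      refine Finset.sum_congr rfl fun i _ => Finset.sum_congr rfl fun j _ => ?_
      simp only [Finset.mem_inter]
      split_ifs <;> simp_all
    simp_rw [this]
    rw [Finset.sum_comm]
    refine Finset.sum_congr rfl fun i hi => ?_
    rw [Finset.sum_comm]
    refine Finset.sum_congr rfl fun j _ => ?_
    rw [← Finset.card_filter, Finset.filter_mem_eq_inter,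
      Finset.inter_eq_right.2 (Finset.inter_subset_left.trans (hS i hi))]
  have h3 : ∑ i ∈ s, ∑ j ∈ s, (S i ∩ S j).card ≤ σ + 2 * s.card ^ 2 := by
    calc ∑ i ∈ s, ∑ j ∈ s, (S i ∩ S j).card
        ≤ ∑ i ∈ s, ∑ j ∈ s, ((if i = j then (S i).card else 0) + 2) := by
          refine Finset.sum_le_sum fun i hi => Finset.sum_le_sum fun j hj => ?_
          split_ifs with h
          · exact (Finset.card_le_card Finset.inter_subset_left).trans (Nat.le_add_right _ _)
          · rw [zero_add]; exact hint i hi j hj h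
      _ = σ + 2 * s.card ^ 2 := by
          simp_rw [Finset.sum_add_distrib, Finset.sum_ite_eq]
          simp only [Finset.sum_const, smul_eq_mul]
          congr 1
          · exact Finset.sum_congr rfl fun i hi => if_pos hi
          · ring
  have h4 : σ ^ 2 ≤ n * (σ + 2 * s.card ^ 2) := by
    rw [← h1]
    refine sq_sum_le_card_mul_sum_sq.trans ?_
    rw [h2, h1]
    exact Nat.mul_le_mul_left _ h3
  have h5 : 8 * n * s.card ^ 2 ≤ σ ^ 2 := by
    have : σ ^ 2 = ∑ i ∈ s, ∑ j ∈ s, (S i).card * (S j).card := by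
      rw [sq, Finset.sum_mul_sum]
    rw [this]
    calc 8 * n * s.card ^ 2 = ∑ i ∈ s, ∑ j ∈ s, 8 * n := by
          simp only [Finset.sum_const, smul_eq_mul]; ring
      _ ≤ _ := by
        refine Finset.sum_le_sum fun i hi => Finset.sum_le_sum fun j hj => ?_
        rw [← Nat.pow_le_pow_iff_left (n := 2) two_ne_zero, mul_pow (S i).card, sq (8 * n)]
        exact Nat.mul_le_mul (hrich i hi) (hrich j hj)
  rcases Nat.eq_zero_or_pos σ with h | h
  · omega
  · by_contra! hlt
    nlinarith

section Curves

variable {k : Type*} [Field k]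

lemma card_circ_inter_le [DecidableEq k] (h2 : (2 : k) ≠ 0) {y y' : k × k} {r r' : k} (hr : r ≠ 0)
    (hne : (y, r) ≠ (y', r')) (S : Finset (k × k))
    (hS : ∀ x ∈ S, dist2 x y = r ∧ dist2 x y' = r') : S.card ≤ 2 := by
  by_contra! h
  obtain ⟨a, ha, b, hb, c, hc, hab, hac, hbc⟩ := Finset.two_lt_card.1 h
  obtain ⟨a1, a2⟩ := hS a ha
  obtain ⟨b1, b2⟩ := hS b hb
  obtain ⟨c1, c2⟩ := hS c hc
  have hy : y ≠ y' := by
    rintro rfl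
    exact hne (by rw [← a1, ← a2])
  simp only [dist2] at a1 a2 b1 b2 c1 c2
  have e1 : (y' - y).1 * (b - a).1 + (y' - y).2 * (b - a).2 = 0 := by
    apply mul_left_cancel₀ h2
    simp only [Prod.fst_sub, Prod.snd_sub]
    linear_combination b1 - b2 - a1 + a2
  have e2 : (y' - y).1 * (c - a).1 + (y' - y).2 * (c - a).2 = 0 := by
    apply mul_left_cancel₀ h2
    simp only [Prod.fst_sub, Prod.snd_sub]
    linear_combination c1 - c2 - a1 + a2
  have hpar : (b - a).1 * (c - a).2 = (b - a).2 * (c - a).1 := by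
    by_contra h
    have hd := sub_ne_zero.2 h
    refine hy (sub_eq_zero.1 (Prod.ext ?_ ?_)).symm
    · apply mul_right_cancel₀ hd
      simp only [Prod.fst_zero]
      linear_combination (c - a).2 * e1 - (b - a).2 * e2
    · apply mul_right_cancel₀ hd
      simp only [Prod.snd_zero]
      linear_combination -(c - a).1 * e1 + (b - a).1 * e2
  obtain ⟨t, ht⟩ := exists_smul_of_parallel (sub_ne_zero.2 hab.symm) hpar
  have hc1 : c.1 = a.1 + t * (b.1 - a.1) := by
    have := congrArg Prod.fst ht
    simp only [Prod.fst_sub, Prod.smul_fst, smul_eq_mul] at this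
    linear_combination this
  have hc2 : c.2 = a.2 + t * (b.2 - a.2) := by
    have := congrArg Prod.snd ht
    simp only [Prod.snd_sub, Prod.smul_snd, smul_eq_mul] at this
    linear_combination this
  have ht0 : t ≠ 0 := by
    rintro rfl
    exact hac (Prod.ext (by rw [hc1]; ring) (by rw [hc2]; ring))
  have ht1 : t - 1 ≠ 0 := by
    intro h
    rw [sub_eq_zero] at h
    subst h
    exact hbc (Prod.ext (by rw [hc1]; ring) (by rw [hc2]; ring))
  rw [hc1, hc2] at c1
  have e3 : (b.1 - a.1) ^ 2 + (b.2 - a.2) ^ 2 = 0 := by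
    apply mul_left_cancel₀ (mul_ne_zero ht0 ht1)
    linear_combination c1 - (1 - t) * a1 - t * b1
  have e4 : (b.1 - a.1) * (a.1 - y.1) + (b.2 - a.2) * (a.2 - y.2) = 0 := by
    apply mul_left_cancel₀ h2
    linear_combination b1 - a1 - e3
  have e5 : (b.1 - a.1) ^ 2 * r = 0 := by
    linear_combination -(b.1 - a.1) ^ 2 * a1 + (a.2 - y.2) ^ 2 * e3 + ((b.1 - a.1) * (a.1 - y.1) - (b.2 - a.2) * (a.2 - y.2)) * e4
  have e6 := pow_eq_zero_iff (two_ne_zero) |>.1 ((mul_eq_zero.1 e5).resolve_right hr)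
  rw [e6] at e3
  simp only [ne_eq, OfNat.ofNat_ne_zero, not_false_eq_true, zero_pow, zero_add,
    pow_eq_zero_iff] at e3
  exact hab (Prod.ext (sub_eq_zero.1 e6) (sub_eq_zero.1 e3)).symm

lemma dirForm_eq_zero_iff [DecidableEq k] {z : k × k} (hz : z ≠ 0) (o : Option k) :
    dirForm o z = 0 ↔ o = dirClass z := by
  unfold dirClass
  cases o with
  | none =>
    simp only [dirForm]
    split_ifs with h <;> simp [h]
  | some s =>
    simp only [dirForm]
    split_ifs with h
    · have : z.2 ≠ 0 := fun h' => hz (Prod.ext h h')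
      simp [h, this]
    · rw [Option.some_inj, eq_div_iff h, sub_eq_zero, eq_comm]

lemma card_line_inter_le [DecidableEq k] {o o' : Option k} {r r' : k} (hne : (o, r) ≠ (o', r'))
    (S : Finset (k × k)) (hS : ∀ x ∈ S, dirForm o x = r ∧ dirForm o' x = r') : S.card ≤ 1 := by
  refine Finset.card_le_one.2 fun a ha b hb => ?_
  by_contra hab
  obtain ⟨a1, a2⟩ := hS a ha
  obtain ⟨b1, b2⟩ := hS b hb
  have h1 := (dirForm_eq_zero_iff (sub_ne_zero.2 hab) o).1 (by rw [dirForm_sub, a1, b1, sub_self])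
  have h2 := (dirForm_eq_zero_iff (sub_ne_zero.2 hab) o').1 (by rw [dirForm_sub, a2, b2, sub_self])
  refine hne ?_
  rw [← a1, ← a2, h1, h2]

variable [Fintype k] [DecidableEq k]

lemma sum_card_richCirc (h2 : (2 : k) ≠ 0) (A : Finset (k × k)) :
    3 * ∑ y, (richCirc A y).card ≤ 4 * A.card := by
  set I : Finset ((k × k) × k) := Finset.univ.filter fun i => i.2 ≠ 0 ∧
    8 * A.card ≤ (A.filter fun x => dist2 x i.1 = i.2).card ^ 2 with hI
  have hint := sum_card_of_rich I (fun i => A.filter fun x => dist2 x i.1 = i.2)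
    (fun i _ => Finset.filter_subset _ _) (fun i hi => (Finset.mem_filter.1 hi).2.2) ?_
  · refine le_trans ?_ hint
    refine Nat.mul_le_mul_left _ ?_
    rw [hI, Finset.sum_filter, ← Finset.univ_product_univ (α := k × k), Finset.sum_product]
    refine Finset.sum_le_sum fun y _ => ?_
    rw [← Finset.sum_filter]
    refine le_trans (Finset.card_le_card ?_) Finset.card_biUnion_le
    intro a ha
    rw [richCirc, Finset.mem_filter] at ha
    simp only [Finset.mem_biUnion, Finset.mem_filter, Finset.mem_univ, true_and]
    exact ⟨_, ha.2, ha.1, rfl⟩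
  · intro i hi j hj hij
    refine card_circ_inter_le h2 (Finset.mem_filter.1 hi).2.1 hij _ fun x hx => ?_
    rw [Finset.mem_inter, Finset.mem_filter, Finset.mem_filter] at hx
    exact ⟨hx.1.2, hx.2.2⟩

lemma sum_card_richDir (A : Finset (k × k)) :
    3 * ∑ o, (richDir A o).card ≤ 4 * A.card := by
  set I : Finset (Option k × k) := Finset.univ.filter fun i =>
    8 * A.card ≤ (A.filter fun x => dirForm i.1 x = i.2).card ^ 2 with hI
  have hint := sum_card_of_rich I (fun i => A.filter fun x => dirForm i.1 x = i.2)
    (fun i _ => Finset.filter_subset _ _) (fun i hi => (Finset.mem_filter.1 hi).2) ?_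
  · refine le_trans ?_ hint
    refine Nat.mul_le_mul_left _ ?_
    rw [hI, Finset.sum_filter, Fintype.sum_prod_type]
    refine Finset.sum_le_sum fun y _ => ?_
    rw [← Finset.sum_filter]
    refine le_trans (Finset.card_le_card ?_) Finset.card_biUnion_le
    intro a ha
    rw [richDir, Finset.mem_filter] at ha
    simp only [Finset.mem_biUnion, Finset.mem_filter, Finset.mem_univ, true_and]
    exact ⟨_, ha.2, ha.1, rfl⟩
  · intro i hi j hj hij
    refine (card_line_inter_le hij _ fun x hx => ?_).trans one_le_two
    rw [Finset.mem_inter, Finset.mem_filter, Finset.mem_filter] at hx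
    exact ⟨hx.1.2, hx.2.2⟩

lemma card_cone_le (y : k × k) :
    (Finset.univ.filter fun a => dist2 a y = 0).card ≤ 2 * Fintype.card k := by
  by_cases hj : ∃ j : k, j ^ 2 = -1
  · obtain ⟨j, hj⟩ := hj
    have hsub : (Finset.univ.filter fun a => dist2 a y = 0) ⊆
        (Finset.univ.image fun t : k => (y.1 + j * t, y.2 + t)) ∪
        (Finset.univ.image fun t : k => (y.1 - j * t, y.2 + t)) := by
      intro a ha
      have ha := (Finset.mem_filter.1 ha).2
      rw [dist2] at ha
      simp only [Finset.mem_union, Finset.mem_image, Finset.mem_univ, true_and]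
      have h : (a.1 - y.1 - j * (a.2 - y.2)) * (a.1 - y.1 + j * (a.2 - y.2)) = 0 := by
        linear_combination ha - (a.2 - y.2) ^ 2 * hj
      rcases mul_eq_zero.1 h with h | h
      · exact Or.inl ⟨a.2 - y.2, Prod.ext (by simp only; linear_combination -h) (by simp)⟩
      · exact Or.inr ⟨a.2 - y.2, Prod.ext (by simp only; linear_combination -h) (by simp)⟩
    refine (Finset.card_le_card hsub).trans ((Finset.card_union_le _ _).trans ?_)
    rw [two_mul]
    exact Nat.add_le_add Finset.card_image_le Finset.card_image_le
  · have hsub : (Finset.univ.filter fun a => dist2 a y = 0) ⊆ {y} := by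
      intro a ha
      have ha := (Finset.mem_filter.1 ha).2
      rw [dist2] at ha
      rw [Finset.mem_singleton]
      have h0 : a.2 - y.2 = 0 := by
        by_contra h
        refine hj ⟨(a.1 - y.1) / (a.2 - y.2), ?_⟩
        rw [div_pow, div_eq_iff (pow_ne_zero 2 h)]
        linear_combination ha
      rw [h0] at ha
      simp only [ne_eq, OfNat.ofNat_ne_zero, not_false_eq_true, zero_pow, add_zero,
        pow_eq_zero_iff] at ha
      exact Prod.ext (sub_eq_zero.1 ha) (sub_eq_zero.1 h0)
    have := Fintype.card_pos (α := k)
    refine (Finset.card_le_card hsub).trans ?_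
    rw [Finset.card_singleton]
    omega

end Curves

section Quadruples

variable {k : Type*} [Field k]

lemma bisector_comm (a b : k × k) : bisector a b = bisector b a := by
  ext x
  exact eq_comm

lemma eq_of_bisector_eq [DecidableEq k] (h2 : (2 : k) ≠ 0) {c d d' : k × k}
    (hd : dot (d - c) (d - c) ≠ 0) (hd' : dot (d' - c) (d' - c) ≠ 0)
    (h : bisector c d = bisector c d') : d = d' := by
  have hx := midpoint_mem_bisector h2 c d
  refine eq_of_mem_bisector hd (sub_ne_zero.1 (ne_zero_of_dot hd')) ?_ hx (h ▸ hx)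
  refine dirClass_eq_of_parallel (ne_zero_of_dot hd) (ne_zero_of_dot hd') ?_
  have := (parallel_of_bisector_eq h2 h).1
  linear_combination -this

lemma dirClass_eq_of_bisector_eq [DecidableEq k] (h2 : (2 : k) ≠ 0) {a b c d : k × k}
    (hb : dot (b - a) (b - a) ≠ 0) (hd : dot (d - c) (d - c) ≠ 0)
    (h : bisector a b = bisector c d) : dirClass (b - a) = dirClass (d - c) := by
  refine dirClass_eq_of_parallel (ne_zero_of_dot hb) (ne_zero_of_dot hd) ?_
  have := (parallel_of_bisector_eq h2 h).1
  linear_combination -this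

lemma dist2_eq_of_bisector_eq {F : Type*} [Field F] [Algebra k F] (h2 : (2 : k) ≠ 0) {θ : F}
    (hθ : θ ^ 2 = -1) {a b c d : k × k} (h : bisector a b = bisector c d)
    (hab : dot (b - a) (b - a) ≠ 0) (hcd : dot (d - c) (d - c) ≠ 0) : dist2 d b = dist2 c a := by
  obtain ⟨h3, h4⟩ := iso_of_bisector_eq h2 hθ h hcd
  have h5 := dot_self_iso hθ (b - a)
  have h6 : iso θ (b - a) * iso (-θ) (b - a) ≠ 0 := by
    rw [← h5]; exact (map_ne_zero _).2 hab
  apply (algebraMap k F).injective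
  rw [dist2_iso hθ, dist2_iso hθ, ← iso_sub, ← iso_sub, ← iso_sub, ← iso_sub]
  apply mul_left_cancel₀ h6
  linear_combination (iso (-θ) (d - b) * iso θ (b - a)) * h3 -
    (iso (-θ) (c - a) * iso θ (b - a)) * h4

variable [DecidableEq k]

/-- A pair whose bisector avoids the centres of many rich circles, and is not orthogonal to the
direction of many rich lines. -/
def IsTame (A : Finset (k × k)) (κ : ℕ) (a b : k × k) : Prop :=
  dot (b - a) (b - a) ≠ 0 ∧ (∀ y ∈ bisector a b, (richCirc A y).card ≤ κ) ∧
    (richDir A (dirClass (b - a))).card ≤ κ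

open Classical in
/-- The quadruples `(a, b, c, d)` such that `(a, b)` and `(c, d)` have the same tame bisector. -/
noncomputable def quads (A A' : Finset (k × k)) (κ : ℕ) :
    Finset ((k × k) × (k × k) × (k × k) × (k × k)) :=
  (A' ×ˢ A' ×ˢ A' ×ˢ A').filter fun q => IsTame A κ q.1 q.2.1 ∧
    dot (q.2.2.2 - q.2.2.1) (q.2.2.2 - q.2.2.1) ≠ 0 ∧ bisector q.1 q.2.1 = bisector q.2.2.1 q.2.2.2

lemma mem_quads {A A' : Finset (k × k)} {κ : ℕ} {a b c d : k × k} :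
    (a, b, c, d) ∈ quads A A' κ ↔ (a ∈ A' ∧ b ∈ A' ∧ c ∈ A' ∧ d ∈ A') ∧ IsTame A κ a b ∧
      dot (d - c) (d - c) ≠ 0 ∧ bisector a b = bisector c d := by
  simp [quads]

lemma card_sigma_pairs_le {α β : Type*} [Fintype β] (f : β → Finset α) (κ n : ℕ)
    (h : 3 * ∑ y, (f y).card ≤ 4 * n) :
    3 * ((Finset.univ.filter fun y => (f y).card ≤ κ).sigma fun y => f y ×ˢ f y).card ≤
      4 * n * κ := by
  rw [Finset.card_sigma]
  calc 3 * ∑ y ∈ Finset.univ.filter fun y => (f y).card ≤ κ, (f y ×ˢ f y).card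
      ≤ 3 * ∑ y ∈ Finset.univ.filter fun y => (f y).card ≤ κ, (f y).card * κ := by
        refine Nat.mul_le_mul_left _ (Finset.sum_le_sum fun y hy => ?_)
        rw [Finset.card_product]
        exact Nat.mul_le_mul_left _ (Finset.mem_filter.1 hy).2
    _ ≤ 3 * ∑ y, (f y).card * κ :=
        Nat.mul_le_mul_left _ (Finset.sum_le_sum_of_subset (Finset.filter_subset _ _))
    _ ≤ 4 * n * κ := by
        rw [← Finset.sum_mul, ← mul_assoc]
        exact Nat.mul_le_mul_right _ h

variable [Fintype k]

open Classical in
lemma card_rich_quads_le (h2 : (2 : k) ≠ 0) {A A' : Finset (k × k)} (hA : A' ⊆ A) (κ : ℕ) :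
    3 * ((quads A A' κ).filter fun q => RichQuad A q.1 q.2.1 q.2.2.1).card ≤
      28 * A.card * κ * Fintype.card k := by
  set n := A.card
  set p := Fintype.card k
  set T₁ := (Finset.univ.filter fun o => (richDir A o).card ≤ κ).sigma
    fun o => richDir A o ×ˢ richDir A o
  set T₂ := (Finset.univ.filter fun y => (richCirc A y).card ≤ κ).sigma
    fun y => richCirc A y ×ˢ richCirc A y
  have hT₁ : 3 * T₁.card ≤ 4 * n * κ := card_sigma_pairs_le _ κ n (sum_card_richDir A)
  have hT₂ : 3 * T₂.card ≤ 4 * n * κ := card_sigma_pairs_le _ κ n (sum_card_richCirc h2 A)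
  have hT₃ : (T₂.sigma fun t => Finset.univ.filter fun x => dist2 x t.1 = 0).card ≤
      T₂.card * (2 * p) := by
    rw [Finset.card_sigma]
    exact (Finset.sum_le_card_nsmul _ _ _ fun t _ => card_cone_le t.1).trans_eq (smul_eq_mul _ _)
  set Q₁ := (quads A A' κ).filter fun q => q.1 ∈ richDir A (dirClass (q.2.1 - q.1)) ∧
    q.2.2.1 ∈ richDir A (dirClass (q.2.1 - q.1))
  set Q₂ := (quads A A' κ).filter fun q => ∃ y ∈ bisector q.1 q.2.1,
    q.1 ∈ richCirc A y ∧ q.2.2.1 ∈ richCirc A y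
  set Q₃ := (quads A A' κ).filter fun q => ∃ y ∈ bisector q.1 q.2.1,
    q.2.2.1 ∈ richCirc A y ∧ dist2 q.1 y = 0
  set Q₄ := (quads A A' κ).filter fun q => ∃ y ∈ bisector q.1 q.2.1,
    q.1 ∈ richCirc A y ∧ dist2 q.2.2.1 y = 0
  have b1 : Q₁.card ≤ (T₁ ×ˢ (Finset.univ : Finset k)).card := by
    refine Finset.card_le_card_of_forall_subsingleton (fun q t => t.1.1 = dirClass (q.2.1 - q.1) ∧
      t.1.2 = (q.1, q.2.2.1) ∧ t.2 = dirCoord (q.2.1 - q.1)) ?_ ?_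
    · rintro ⟨a, b, c, d⟩ hq
      obtain ⟨hq, ha, hc⟩ := Finset.mem_filter.1 hq
      have ht := (mem_quads.1 hq).2.1
      refine ⟨(⟨dirClass (b - a), (a, c)⟩, dirCoord (b - a)), ?_, rfl, rfl, rfl⟩
      simp only [T₁, Finset.mem_product, Finset.mem_sigma, Finset.mem_filter, Finset.mem_univ,
        true_and, and_true]
      exact ⟨ht.2.2, ha, hc⟩
    · rintro ⟨⟨o, a₀, c₀⟩, t⟩ -
      rintro ⟨a, b, c, d⟩ ⟨hq, e1, e2, e3⟩ ⟨a', b', c', d'⟩ ⟨hq', e1', e2', e3'⟩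
      simp only [Prod.mk.injEq] at e1 e2 e3 e1' e2' e3'
      obtain ⟨rfl, rfl⟩ := e2
      obtain ⟨rfl, rfl⟩ := e2'
      have hb : b = b' :=
        sub_left_injective (eq_of_dirClass_eq (e1.symm.trans e1') (e3.symm.trans e3'))
      subst hb
      obtain ⟨-, h1, h3, h4⟩ := mem_quads.1 (Finset.mem_filter.1 hq).1
      obtain ⟨-, h1', h3', h4'⟩ := mem_quads.1 (Finset.mem_filter.1 hq').1
      rw [eq_of_bisector_eq h2 h3 h3' (h4.symm.trans h4')]
  have b2 : Q₂.card ≤ (T₂ ×ˢ (Finset.univ : Finset (Option k))).card := by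
    refine Finset.card_le_card_of_forall_subsingleton (fun q t => t.1.1 ∈ bisector q.1 q.2.1 ∧
      t.1.2 = (q.1, q.2.2.1) ∧ t.2 = dirClass (q.2.1 - q.1)) ?_ ?_
    · rintro ⟨a, b, c, d⟩ hq
      obtain ⟨hq, y, hy, ha, hc⟩ := Finset.mem_filter.1 hq
      have ht := (mem_quads.1 hq).2.1
      refine ⟨(⟨y, (a, c)⟩, dirClass (b - a)), ?_, hy, rfl, rfl⟩
      simp only [T₂, Finset.mem_product, Finset.mem_sigma, Finset.mem_filter, Finset.mem_univ,
        true_and, and_true]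
      exact ⟨ht.2.1 y hy, ha, hc⟩
    · rintro ⟨⟨y, a₀, c₀⟩, t⟩ -
      rintro ⟨a, b, c, d⟩ ⟨hq, e1, e2, e3⟩ ⟨a', b', c', d'⟩ ⟨hq', e1', e2', e3'⟩
      simp only [Prod.mk.injEq] at e1 e2 e3 e1' e2' e3'
      obtain ⟨rfl, rfl⟩ := e2
      obtain ⟨rfl, rfl⟩ := e2'
      obtain ⟨-, h1, h3, h4⟩ := mem_quads.1 (Finset.mem_filter.1 hq).1
      obtain ⟨-, h1', h3', h4'⟩ := mem_quads.1 (Finset.mem_filter.1 hq').1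
      have hb : b = b' := eq_of_mem_bisector h1.1 (sub_ne_zero.1 (ne_zero_of_dot h1'.1))
        (e3.symm.trans e3') e1 e1'
      subst hb
      rw [eq_of_bisector_eq h2 h3 h3' (h4.symm.trans h4')]
  have b3 : Q₃.card ≤ (T₂.sigma fun t => Finset.univ.filter fun x => dist2 x t.1 = 0).card := by
    refine Finset.card_le_card_of_forall_subsingleton (fun q t => t.1.1 ∈ bisector q.1 q.2.1 ∧
      t.1.2 = (q.2.2.1, q.2.2.2) ∧ t.2 = q.1) ?_ ?_
    · rintro ⟨a, b, c, d⟩ hq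
      obtain ⟨hq, y, hy, hc, ha⟩ := Finset.mem_filter.1 hq
      obtain ⟨⟨-, -, -, hd⟩, ht, -, hB⟩ := mem_quads.1 hq
      refine ⟨⟨⟨y, (c, d)⟩, a⟩, ?_, hy, rfl, rfl⟩
      simp only [T₂, Finset.mem_product, Finset.mem_sigma, Finset.mem_filter, Finset.mem_univ,
        true_and]
      refine ⟨⟨ht.2.1 y hy, hc, ?_⟩, ha⟩
      have hy' : dist2 c y = dist2 d y := by
        have := hy
        rw [hB] at this
        exact this
      simp only [richCirc, Finset.mem_filter] at hc ⊢
      rw [← hy']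
      exact ⟨hA hd, hc.2⟩
    · rintro ⟨⟨y, a₀, c₀⟩, t⟩ -
      rintro ⟨a, b, c, d⟩ ⟨hq, e1, e2, e3⟩ ⟨a', b', c', d'⟩ ⟨hq', e1', e2', e3'⟩
      simp only [Prod.mk.injEq] at e1 e2 e3 e1' e2' e3'
      obtain ⟨rfl, rfl⟩ := e2
      obtain ⟨rfl, rfl⟩ := e2'
      subst e3
      subst e3'
      obtain ⟨-, h1, h3, h4⟩ := mem_quads.1 (Finset.mem_filter.1 hq).1
      obtain ⟨-, h1', h3', h4'⟩ := mem_quads.1 (Finset.mem_filter.1 hq').1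
      have hb : b = b' := eq_of_mem_bisector h1.1 (sub_ne_zero.1 (ne_zero_of_dot h1'.1))
        ((dirClass_eq_of_bisector_eq h2 h1.1 h3 h4).trans
          (dirClass_eq_of_bisector_eq h2 h1'.1 h3' h4').symm) e1 e1'
      rw [hb]
  have b4 : Q₄.card ≤ (T₂.sigma fun t => Finset.univ.filter fun x => dist2 x t.1 = 0).card := by
    refine Finset.card_le_card_of_forall_subsingleton (fun q t => t.1.1 ∈ bisector q.1 q.2.1 ∧
      t.1.2 = (q.1, q.2.1) ∧ t.2 = q.2.2.1) ?_ ?_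
    · rintro ⟨a, b, c, d⟩ hq
      obtain ⟨hq, y, hy, ha, hc⟩ := Finset.mem_filter.1 hq
      obtain ⟨⟨-, hb, -, -⟩, ht, -, hB⟩ := mem_quads.1 hq
      refine ⟨⟨⟨y, (a, b)⟩, c⟩, ?_, hy, rfl, rfl⟩
      simp only [T₂, Finset.mem_product, Finset.mem_sigma, Finset.mem_filter, Finset.mem_univ,
        true_and]
      refine ⟨⟨ht.2.1 y hy, ha, ?_⟩, hc⟩
      have hy' : dist2 a y = dist2 b y := hy
      simp only [richCirc, Finset.mem_filter] at ha ⊢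
      rw [← hy']
      exact ⟨hA hb, ha.2⟩
    · rintro ⟨⟨y, a₀, c₀⟩, t⟩ -
      rintro ⟨a, b, c, d⟩ ⟨hq, e1, e2, e3⟩ ⟨a', b', c', d'⟩ ⟨hq', e1', e2', e3'⟩
      simp only [Prod.mk.injEq] at e1 e2 e3 e1' e2' e3'
      obtain ⟨rfl, rfl⟩ := e2
      obtain ⟨rfl, rfl⟩ := e2'
      subst e3
      subst e3'
      obtain ⟨-, h1, h3, h4⟩ := mem_quads.1 (Finset.mem_filter.1 hq).1
      obtain ⟨-, h1', h3', h4'⟩ := mem_quads.1 (Finset.mem_filter.1 hq').1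
      rw [eq_of_bisector_eq h2 h3 h3' (h4.symm.trans h4')]
  have hsub : ((quads A A' κ).filter fun q => RichQuad A q.1 q.2.1 q.2.2.1) ⊆
      (Q₁ ∪ Q₂) ∪ (Q₃ ∪ Q₄) := by
    intro q hq
    obtain ⟨hq, h⟩ := Finset.mem_filter.1 hq
    simp only [Finset.mem_union, Q₁, Q₂, Q₃, Q₄, Finset.mem_filter, hq, true_and]
    rcases h with h | ⟨y, hy, h | h | h⟩
    · exact Or.inl (Or.inl h)
    · exact Or.inl (Or.inr ⟨y, hy, h⟩)
    · exact Or.inr (Or.inl ⟨y, hy, h⟩)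
    · exact Or.inr (Or.inr ⟨y, hy, h⟩)
  have hc := (Finset.card_le_card hsub).trans (Finset.card_union_le _ _)
  have hc1 := Finset.card_union_le Q₁ Q₂
  have hc2 := Finset.card_union_le Q₃ Q₄
  have hp : 1 ≤ p := Fintype.card_pos
  rw [Finset.card_product, Finset.card_univ] at b1 b2
  rw [Fintype.card_option] at b2
  have g1 := Nat.mul_le_mul_right p hT₁
  have g2 := Nat.mul_le_mul_right p hT₂
  have g3 := Nat.mul_le_mul_left (4 * n * κ) hp
  nlinarith

end Quadruples

section Energy

variable {k F : Type*} [Field k] [Field F] [Algebra k F] [DecidableEq k]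

open Classical in
lemma card_isotropic_quads (h2 : (2 : k) ≠ 0) {θ : F} (hθ : θ ^ 2 = -1) (A : Finset (k × k))
    {A' : Finset (k × k)} (κ : ℕ) {m : ℕ}
    (hm : ∀ z : F, ∀ S ⊆ A', (∀ x ∈ S, iso θ x = z) → S.card ≤ m) :
    ((quads A A' κ).filter fun q => dist2 q.2.2.1 q.1 = 0).card ≤ 2 * A'.card ^ 2 * m := by
  have hcard : ∀ f : (k × k) × (k × k) → k × k,
      ((A' ×ˢ A').sigma fun t => A'.filter fun x => iso θ x = iso θ (f t)).card ≤
        A'.card ^ 2 * m := by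
    intro f
    rw [Finset.card_sigma]
    refine (Finset.sum_le_card_nsmul _ _ m fun t _ => ?_).trans_eq ?_
    · exact hm (iso θ (f t)) _ (Finset.filter_subset _ _) fun x hx => (Finset.mem_filter.1 hx).2
    · rw [Finset.card_product, smul_eq_mul, sq]
  set Q₁ := (quads A A' κ).filter fun q => iso θ q.2.2.1 = iso θ q.1
  set Q₂ := (quads A A' κ).filter fun q => iso θ q.2.2.2 = iso θ q.2.1
  have b1 : Q₁.card ≤ A'.card ^ 2 * m := by
    refine le_trans ?_ (hcard Prod.fst)
    refine Finset.card_le_card_of_forall_subsingleton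
      (fun q t => t.1 = (q.1, q.2.1) ∧ t.2 = q.2.2.1) ?_ ?_
    · rintro ⟨a, b, c, d⟩ hq
      obtain ⟨hq, hc⟩ := Finset.mem_filter.1 hq
      have ht := (mem_quads.1 hq).1
      refine ⟨⟨(a, b), c⟩, ?_, rfl, rfl⟩
      simp only [Finset.mem_product, Finset.mem_sigma, Finset.mem_filter]
      exact ⟨⟨ht.1, ht.2.1⟩, ht.2.2.1, hc⟩
    · rintro ⟨⟨a₀, b₀⟩, t⟩ -
      rintro ⟨a, b, c, d⟩ ⟨hq, e1, e2⟩ ⟨a', b', c', d'⟩ ⟨hq', e1', e2'⟩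
      simp only [Prod.mk.injEq] at e1 e2 e1' e2'
      obtain ⟨rfl, rfl⟩ := e1
      obtain ⟨rfl, rfl⟩ := e1'
      subst e2
      subst e2'
      obtain ⟨-, -, h3, h4⟩ := mem_quads.1 (Finset.mem_filter.1 hq).1
      obtain ⟨-, -, h3', h4'⟩ := mem_quads.1 (Finset.mem_filter.1 hq').1
      rw [eq_of_bisector_eq h2 h3 h3' (h4.symm.trans h4')]
  have b2 : Q₂.card ≤ A'.card ^ 2 * m := by
    refine le_trans ?_ (hcard Prod.snd)
    refine Finset.card_le_card_of_forall_subsingleton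
      (fun q t => t.1 = (q.1, q.2.1) ∧ t.2 = q.2.2.2) ?_ ?_
    · rintro ⟨a, b, c, d⟩ hq
      obtain ⟨hq, hc⟩ := Finset.mem_filter.1 hq
      have ht := (mem_quads.1 hq).1
      refine ⟨⟨(a, b), d⟩, ?_, rfl, rfl⟩
      simp only [Finset.mem_product, Finset.mem_sigma, Finset.mem_filter]
      exact ⟨⟨ht.1, ht.2.1⟩, ht.2.2.2, hc⟩
    · rintro ⟨⟨a₀, b₀⟩, t⟩ -
      rintro ⟨a, b, c, d⟩ ⟨hq, e1, e2⟩ ⟨a', b', c', d'⟩ ⟨hq', e1', e2'⟩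
      simp only [Prod.mk.injEq] at e1 e2 e1' e2'
      obtain ⟨rfl, rfl⟩ := e1
      obtain ⟨rfl, rfl⟩ := e1'
      subst e2
      subst e2'
      obtain ⟨-, -, h3, h4⟩ := mem_quads.1 (Finset.mem_filter.1 hq).1
      obtain ⟨-, -, h3', h4'⟩ := mem_quads.1 (Finset.mem_filter.1 hq').1
      have hn : ∀ x y : k × k, dot (x - y) (x - y) = dot (y - x) (y - x) := fun x y => by
        simp only [dot, Prod.fst_sub, Prod.snd_sub]; ring
      have hc : c = c' := eq_of_bisector_eq h2 (hn t c ▸ h3) (hn t c' ▸ h3')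
        ((bisector_comm _ _).trans (h4.symm.trans (h4'.trans (bisector_comm _ _))))
      rw [hc]
  have hsub : ((quads A A' κ).filter fun q => dist2 q.2.2.1 q.1 = 0) ⊆ Q₁ ∪ Q₂ := by
    rintro ⟨a, b, c, d⟩ hq
    obtain ⟨hq, h⟩ := Finset.mem_filter.1 hq
    simp only [Finset.mem_union, Q₁, Q₂, Finset.mem_filter, hq, true_and]
    obtain ⟨-, ht, h3, h4⟩ := mem_quads.1 hq
    have h5 := dist2_iso hθ c a
    simp only at h
    rw [h, map_zero, eq_comm, mul_eq_zero, sub_eq_zero] at h5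
    refine h5.imp_right fun h6 => ?_
    have h7 := (iso_of_bisector_eq h2 hθ h4 h3).1
    rw [iso_sub (-θ) c a, h6, zero_mul, add_zero, mul_eq_zero] at h7
    rcases h7 with h7 | h7
    · rw [iso_sub, sub_eq_zero] at h7; exact h7
    · exact absurd ((map_eq_zero _).1 ((dot_self_iso hθ (b - a)).trans (by rw [h7, mul_zero])))
        ht.1
  have := (Finset.card_le_card hsub).trans (Finset.card_union_le _ _)
  linarith

open Classical in
lemma card_nonrich_quads [Infinite F] (h2 : (2 : k) ≠ 0) {θ : F} (hθ : θ ^ 2 = -1)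
    {A A' : Finset (k × k)} (hA : A' ⊆ A) (κ : ℕ) {m : ℕ}
    (hm : ∀ z : F, ∀ S ⊆ A', (∀ x ∈ S, iso θ x = z) → S.card ≤ m) {r : k} (hr : r ≠ 0)
    {ν D p : ℕ} (hν : ν = ((A' ×ˢ A').filter fun x => dist2 x.2 x.1 = r).card)
    (hchar : ∀ m : ℕ, 0 < m → m < p → (m : F) ≠ 0) (hD : 12168 * ν < D ^ 2)
    (hDp : 39 * ν < D * p) (hD2 : 2 ≤ D) (hmD : m < D) (hAD : 8 * A.card ≤ D ^ 2) :
    ((quads A A' κ).filter fun q => dist2 q.2.2.1 q.1 = r ∧ ¬ RichQuad A q.1 q.2.1 q.2.2.1).card ≤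
      4 * D * ν := by
  set R := algebraMap k F r
  have hR : R ≠ 0 := (map_ne_zero _).2 hr
  set N := (A' ×ˢ A').filter fun x : (k × k) × (k × k) => dist2 x.2 x.1 = r
  have hN : ∀ i : N, (i.1.1 ∈ A' ∧ i.1.2 ∈ A') ∧ dist2 i.1.2 i.1.1 = r := fun i =>
    (Finset.mem_filter.1 i.2).imp_left Finset.mem_product.1
  set q : N → F := fun i => iso θ i.1.1
  set α : N → F := fun i => iso θ i.1.2 - iso θ i.1.1
  set γ : N → F := fun i => iso (-θ) i.1.1 * α i / R
  have hαβ : ∀ i, α i * (iso (-θ) i.1.2 - iso (-θ) i.1.1) = R := fun i => by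
    rw [← dist2_iso hθ, (hN i).2]
  have hα0 : ∀ i, α i ≠ 0 := fun i h => hR (by rw [← hαβ i, h, zero_mul])
  have hγ : ∀ i, γ i * R = iso (-θ) i.1.1 * α i := fun i => div_mul_cancel₀ _ hR
  set Q := (quads A A' κ).filter fun q =>
    dist2 q.2.2.1 q.1 = r ∧ ¬ RichQuad A q.1 q.2.1 q.2.2.1
  set E : Finset (N × N) := Finset.univ.filter fun x =>
    (x.1.1.1, x.2.1.1, x.1.1.2, x.2.1.2) ∈ Q
  have hE : ∀ x ∈ E, q x.1 - q x.2 + γ x.1 * α x.2 - α x.1 * γ x.2 = 0 := by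
    rintro ⟨i, j⟩ hx
    obtain ⟨-, -, h3, h4⟩ := mem_quads.1 (Finset.mem_filter.1 (Finset.mem_filter.1 hx).2).1
    have h7 := (iso_of_bisector_eq h2 hθ h4 h3).1
    simp only [iso_sub] at h7
    apply mul_right_cancel₀ hR
    rw [zero_mul]
    simp only
    linear_combination (α j) * hγ i - (α i) * hγ j - (α i) * h7 +
      (iso θ j.1.1 - iso θ i.1.1) * hαβ i
  have hinj : Function.Injective fun i => (q i, γ i, α i) := by
    intro i j hij
    simp only [Prod.mk.injEq] at hij
    obtain ⟨e1, e2, e3⟩ := hij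
    have e4 : iso (-θ) i.1.1 = iso (-θ) j.1.1 := by
      apply mul_right_cancel₀ (hα0 i)
      rw [← hγ i, e2, hγ j, e3]
    have e5 : iso (-θ) i.1.2 - iso (-θ) i.1.1 = iso (-θ) j.1.2 - iso (-θ) j.1.1 := by
      apply mul_left_cancel₀ (hα0 i)
      rw [hαβ i, e3, hαβ j]
    refine Subtype.ext (Prod.ext (eq_of_iso h2 hθ e1 e4) (eq_of_iso h2 hθ ?_ ?_))
    · have : iso θ i.1.2 - iso θ i.1.1 = iso θ j.1.2 - iso θ j.1.1 := e3
      rwa [show iso θ i.1.1 = iso θ j.1.1 from e1, sub_left_inj] at this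
    · rwa [e4, sub_left_inj] at e5
  have hcN : Fintype.card N = ν := by rw [hν, Fintype.card_coe]
  have hQE : Q.card ≤ E.card := by
    refine le_trans (Finset.card_le_card ?_) (Finset.card_image_le (s := E)
      (f := fun x => (x.1.1.1, x.2.1.1, x.1.1.2, x.2.1.2)))
    rintro ⟨a, b, c, d⟩ hq
    obtain ⟨hq', h, -⟩ := Finset.mem_filter.1 hq
    obtain ⟨⟨ha, hb, hc, hd⟩, h1, h3, h4⟩ := mem_quads.1 hq'
    have h' := dist2_eq_of_bisector_eq h2 hθ h4 h1.1 h3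
    refine Finset.mem_image.2 ⟨(⟨(a, c), ?_⟩, ⟨(b, d), ?_⟩), ?_, rfl⟩
    · exact Finset.mem_filter.2 ⟨Finset.mk_mem_product ha hc, h⟩
    · exact Finset.mem_filter.2 ⟨Finset.mk_mem_product hb hd, h'.trans h⟩
    · exact Finset.mem_filter.2 ⟨Finset.mem_univ _, hq⟩
  by_contra! hlt
  obtain ⟨i₀, j, h0, i₁, -, h1, hS⟩ := exists_collinear_of_card hinj E hE hchar (hcN ▸ hD)
    (hcN ▸ hDp) hD2 (hcN ▸ hlt.trans_le hQE)
  have h0' := (Finset.mem_filter.1 h0).2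
  obtain ⟨hq, -, hnr⟩ := Finset.mem_filter.1 h0'
  obtain ⟨-, ht, -, -⟩ := mem_quads.1 hq
  refine hnr (richQuad_of_collinear h2 hθ hA hm (P := fun i : N => i.1.1) (Q := fun i => i.1.2)
    (fun i => (hN i).1.1) (fun i => (hN i).1.2) (fun i j e e' => Subtype.ext (Prod.ext e e')) hr
    (fun i => (hN i).2) (fun i => rfl) (fun i => rfl) hγ (hE _ h0) h1
    (sub_ne_zero.1 (ne_zero_of_dot ht.1)) _ (hmD.trans_le hS)
    (fun i hi => (Finset.mem_filter.1 hi).2) (hAD.trans (Nat.pow_le_pow_left hS 2)))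

open Classical in
/-- The number of quadruples with a common tame bisector, bounded through the multiplicities of
the distances. -/
lemma card_quads_le [Infinite F] [Fintype k] (h2 : (2 : k) ≠ 0) {θ : F} (hθ : θ ^ 2 = -1)
    {A A' : Finset (k × k)} (hA : A' ⊆ A) (κ : ℕ) {m : ℕ}
    (hm : ∀ z : F, ∀ S ⊆ A', (∀ x ∈ S, iso θ x = z) → S.card ≤ m) {ν D : k → ℕ} {p : ℕ}
    (hν : ∀ r, ν r = ((A' ×ˢ A').filter fun x => dist2 x.2 x.1 = r).card)
    (hchar : ∀ m : ℕ, 0 < m → m < p → (m : F) ≠ 0) (hD : ∀ r, 12168 * ν r < D r ^ 2)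
    (hDp : ∀ r, 39 * ν r < D r * p) (hD2 : ∀ r, 2 ≤ D r) (hmD : ∀ r, m < D r)
    (hAD : ∀ r, 8 * A.card ≤ D r ^ 2) :
    3 * (quads A A' κ).card ≤ 6 * A.card ^ 2 * m + 28 * A.card * κ * Fintype.card k +
      12 * ∑ r ∈ Finset.univ.filter fun r => r ≠ 0, D r * ν r := by
  set Q₁ := (quads A A' κ).filter fun q => dist2 q.2.2.1 q.1 = 0
  set Q₂ := (quads A A' κ).filter fun q => RichQuad A q.1 q.2.1 q.2.2.1
  set Q₃ : k → Finset ((k × k) × (k × k) × (k × k) × (k × k)) := fun r =>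
    (quads A A' κ).filter fun q => dist2 q.2.2.1 q.1 = r ∧ ¬ RichQuad A q.1 q.2.1 q.2.2.1
  have hsub : quads A A' κ ⊆ (Q₁ ∪ Q₂) ∪ (Finset.univ.filter fun r => r ≠ 0).biUnion Q₃ := by
    intro q hq
    simp only [Finset.mem_union, Finset.mem_biUnion, Q₁, Q₂, Q₃, Finset.mem_filter, hq, true_and,
      Finset.mem_univ]
    by_cases h : dist2 q.2.2.1 q.1 = 0
    · exact Or.inl (Or.inl h)
    · by_cases h' : RichQuad A q.1 q.2.1 q.2.2.1
      · exact Or.inl (Or.inr h')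
      · exact Or.inr ⟨_, h, rfl, h'⟩
  have b1 := card_isotropic_quads h2 hθ A κ hm
  have b2 := card_rich_quads_le h2 hA κ
  have b3 : ((Finset.univ.filter fun r => r ≠ 0).biUnion Q₃).card ≤
      ∑ r ∈ Finset.univ.filter fun r => r ≠ 0, 4 * (D r * ν r) := by
    refine Finset.card_biUnion_le.trans (Finset.sum_le_sum fun r hr => ?_)
    rw [← mul_assoc]
    exact card_nonrich_quads h2 hθ hA κ hm (Finset.mem_filter.1 hr).2 (hν r) hchar (hD r) (hDp r)
      (hD2 r) (hmD r) (hAD r)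
  have hc := (Finset.card_le_card hsub).trans (Finset.card_union_le _ _)
  have hc1 := Finset.card_union_le Q₁ Q₂
  have hc2 : 2 * A'.card ^ 2 * m ≤ 2 * A.card ^ 2 * m := by gcongr
  rw [← Finset.mul_sum] at b3
  simp only [Q₁, Q₂] at hc1
  linarith

end Energy

section SecondMoment

lemma sum_card_fiber_sq {α β : Type*} [DecidableEq α] [DecidableEq β] [Fintype β] (A : Finset α)
    (g : α → β) :
    ∑ c, (A.filter fun x => g x = c).card ^ 2 =
      ((A ×ˢ A).filter fun x => g x.1 = g x.2).card := by
  rw [Finset.card_eq_sum_card_fiberwise (f := fun x => g x.1) (t := Finset.univ)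
    (fun x _ => Finset.mem_coe.2 (Finset.mem_univ _))]
  refine Finset.sum_congr rfl fun c _ => ?_
  rw [sq, ← Finset.card_product]
  congr 1
  ext x
  simp only [Finset.mem_product, Finset.mem_filter]
  constructor
  · rintro ⟨⟨h1, h2⟩, h3, h4⟩
    exact ⟨⟨⟨h1, h3⟩, h2.trans h4.symm⟩, h2⟩
  · rintro ⟨⟨⟨h1, h3⟩, h4⟩, h2⟩
    exact ⟨⟨h1, h2⟩, h3, h4.symm.trans h2⟩

variable {k : Type*} [Field k] [DecidableEq k]

/-- The perpendicular bisector as a pair of a direction class and a level. -/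
def bisLine (q : (k × k) × (k × k)) : Option k × k :=
  (dirClass (-(q.2 - q.1).2, (q.2 - q.1).1), dirForm (dirClass (-(q.2 - q.1).2, (q.2 - q.1).1))
    ((q.1.1 + q.2.1) / 2, (q.1.2 + q.2.2) / 2))

lemma mem_bisector_iff_bisLine (h2 : (2 : k) ≠ 0) {q : (k × k) × (k × k)} (hq : q.2 ≠ q.1)
    (x : k × k) : x ∈ bisector q.1 q.2 ↔ dirForm (bisLine q).1 x = (bisLine q).2 := by
  have hn : (-(q.2 - q.1).2, (q.2 - q.1).1) ≠ (0 : k × k) := fun h => hq <| by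
    simp only [Prod.mk_eq_zero, neg_eq_zero] at h
    exact sub_eq_zero.1 (Prod.ext h.2 h.1)
  have h0 := midpoint_mem_bisector h2 q.1 q.2
  rw [bisLine, dirForm_dirClass_eq hn]
  rw [mem_bisector] at h0 ⊢
  simp only [dot, Prod.fst_sub, Prod.snd_sub] at h0 ⊢
  constructor
  · intro h
    apply mul_left_cancel₀ h2
    linear_combination h0 - h
  · intro h
    linear_combination h0 - 2 * h

lemma bisector_eq_of_bisLine_eq (h2 : (2 : k) ≠ 0) {q q' : (k × k) × (k × k)} (hq : q.2 ≠ q.1)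
    (hq' : q'.2 ≠ q'.1) (h : bisLine q = bisLine q') : bisector q.1 q.2 = bisector q'.1 q'.2 := by
  ext x
  rw [mem_bisector_iff_bisLine h2 hq, mem_bisector_iff_bisLine h2 hq', h]

variable [Fintype k]

/-- The deviation of the number of points of `A` on a line from its average. -/
noncomputable def lineExc (A : Finset (k × k)) (ℓ : Option k × k) : ℝ :=
  (A.filter fun x => dirForm ℓ.1 x = ℓ.2).card - (A.card : ℝ) / Fintype.card k

/-- The deviation of the number of points of `A` on a bisector from its average. -/
noncomputable def bisExc (A : Finset (k × k)) (q : (k × k) × (k × k)) : ℝ :=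
  (A.filter fun x => dist2 q.1 x = dist2 q.2 x).card - (A.card : ℝ) / Fintype.card k

lemma bisExc_eq_lineExc (h2 : (2 : k) ≠ 0) (A : Finset (k × k)) {q : (k × k) × (k × k)}
    (hq : q.2 ≠ q.1) : bisExc A q = lineExc A (bisLine q) := by
  rw [bisExc, lineExc]
  congr 3
  exact Finset.filter_congr fun x _ => mem_bisector_iff_bisLine h2 hq x

lemma card_dir_filter_le (x y : k × k) :
    (Finset.univ.filter fun o => dirForm o x = dirForm o y).card ≤
      (if x = y then Fintype.card k else 0) + 1 := by
  split_ifs with h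
  · rw [← Fintype.card_option, ← Finset.card_univ]
    exact Finset.card_le_card (Finset.filter_subset _ _)
  · rw [zero_add, Finset.card_le_one]
    have : ∀ o, dirForm o x = dirForm o y → o = dirClass (x - y) := fun o ho =>
      (dirForm_eq_zero_iff (sub_ne_zero.2 h) o).1 (by rw [dirForm_sub, ho, sub_self])
    intro a ha b hb
    rw [this a (Finset.mem_filter.1 ha).2, this b (Finset.mem_filter.1 hb).2]

lemma sum_card_line_sq_le (A : Finset (k × k)) :
    ∑ o, ∑ c, (A.filter fun x => dirForm o x = c).card ^ 2 ≤
      A.card * Fintype.card k + A.card ^ 2 := by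
  calc ∑ o, ∑ c, (A.filter fun x => dirForm o x = c).card ^ 2
      = ∑ o : Option k, ∑ x ∈ A ×ˢ A, if dirForm o x.1 = dirForm o x.2 then 1 else 0 := by
        refine Finset.sum_congr rfl fun o _ => ?_
        rw [sum_card_fiber_sq, Finset.card_filter]
    _ = ∑ x ∈ A ×ˢ A, (Finset.univ.filter fun o => dirForm o x.1 = dirForm o x.2).card := by
        rw [Finset.sum_comm]
        simp only [Finset.card_filter]
    _ ≤ ∑ x ∈ A ×ˢ A, ((if x.1 = x.2 then Fintype.card k else 0) + 1) :=
        Finset.sum_le_sum fun x _ => card_dir_filter_le _ _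
    _ = A.card * Fintype.card k + A.card ^ 2 := by
        rw [Finset.sum_add_distrib, Finset.sum_product]
        simp [sq, Finset.card_product]

lemma sum_sq_lineExc_le (A : Finset (k × k)) :
    ∑ ℓ, lineExc A ℓ ^ 2 ≤ (A.card : ℝ) * Fintype.card k := by
  have hp : (0 : ℝ) < Fintype.card k := Nat.cast_pos.2 Fintype.card_pos
  have h1 := sum_card_line_sq_le A
  have h2 : ∀ o : Option k, ∑ c : k, ((A.filter fun x => dirForm o x = c).card : ℝ) = A.card := by
    intro o
    rw [Finset.card_eq_sum_card_fiberwise (f := dirForm o) (t := Finset.univ)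
      (fun x _ => Finset.mem_coe.2 (Finset.mem_univ _)), Nat.cast_sum]
  have h3 : (∑ o, ∑ c, ((A.filter fun x => dirForm o x = c).card : ℝ) ^ 2) ≤
      A.card * Fintype.card k + (A.card : ℝ) ^ 2 := by exact_mod_cast h1
  have h4 : ∀ o : Option k, ∑ c : k, lineExc A (o, c) ^ 2 =
      (∑ c, ((A.filter fun x => dirForm o x = c).card : ℝ) ^ 2) -
        (A.card : ℝ) ^ 2 / Fintype.card k := by
    intro o
    simp only [lineExc, sub_sq]
    rw [Finset.sum_add_distrib, Finset.sum_sub_distrib, ← Finset.sum_mul, ← Finset.mul_sum, h2,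
      Finset.sum_const, Finset.card_univ, nsmul_eq_mul]
    field_simp
    ring
  rw [Fintype.sum_prod_type]
  simp only [h4]
  rw [Finset.sum_sub_distrib, Finset.sum_const, Finset.card_univ, Fintype.card_option,
    nsmul_eq_mul]
  have h5 : (A.card : ℝ) ^ 2 ≤ ((Fintype.card k + 1 : ℕ) : ℝ) *
      ((A.card : ℝ) ^ 2 / Fintype.card k) := by
    rw [mul_div_assoc', le_div_iff₀ hp]
    push_cast
    nlinarith [sq_nonneg (A.card : ℝ)]
  linarith

/-- The second moment bound: sums of `bisExc` are controlled by the bisector energy. -/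
lemma sum_bisExc_sq_le (h2 : (2 : k) ≠ 0) (A : Finset (k × k))
    (S : Finset ((k × k) × (k × k))) (hS : ∀ q ∈ S, q.2 ≠ q.1) :
    (∑ q ∈ S, bisExc A q) ^ 2 ≤ (A.card : ℝ) * Fintype.card k *
      ((S ×ˢ S).filter fun x => bisLine x.1 = bisLine x.2).card := by
  have h1 : ∑ q ∈ S, bisExc A q =
      ∑ ℓ, lineExc A ℓ * ((S.filter fun q => bisLine q = ℓ).card : ℝ) := by
    rw [← Finset.sum_fiberwise_of_maps_to (g := bisLine) (t := Finset.univ)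
      (fun x _ => Finset.mem_univ _)]
    refine Finset.sum_congr rfl fun ℓ _ => ?_
    rw [mul_comm, ← nsmul_eq_mul, ← Finset.sum_const]
    refine Finset.sum_congr rfl fun q hq => ?_
    obtain ⟨hq1, rfl⟩ := Finset.mem_filter.1 hq
    exact bisExc_eq_lineExc h2 A (hS q hq1)
  rw [h1]
  refine (Finset.sum_mul_sq_le_sq_mul_sq _ _ _).trans ?_
  have h3 : ∑ ℓ, ((S.filter fun q => bisLine q = ℓ).card : ℝ) ^ 2 =
      ((S ×ˢ S).filter fun x => bisLine x.1 = bisLine x.2).card := by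
    exact_mod_cast sum_card_fiber_sq S bisLine
  rw [h3]
  exact mul_le_mul_of_nonneg_right (sum_sq_lineExc_le A) (Nat.cast_nonneg _)

open Classical in
lemma sum_bisExc_tame_sq_le (h2 : (2 : k) ≠ 0) (A A' : Finset (k × k)) (κ : ℕ) :
    (∑ q ∈ (A' ×ˢ A').filter fun q => IsTame A κ q.1 q.2, bisExc A q) ^ 2 ≤
      (A.card : ℝ) * Fintype.card k * (quads A A' κ).card := by
  refine (sum_bisExc_sq_le h2 A _ fun q hq => ?_).trans ?_
  · exact sub_ne_zero.1 (ne_zero_of_dot (Finset.mem_filter.1 hq).2.1)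
  · gcongr
    refine Finset.card_le_card_of_injOn (fun x => (x.1.1, x.1.2, x.2.1, x.2.2)) ?_ ?_
    · rintro ⟨⟨a, b⟩, ⟨c, d⟩⟩ hx
      simp only [Finset.mem_coe, Finset.mem_filter, Finset.mem_product] at hx
      obtain ⟨⟨⟨⟨ha, hb⟩, h1⟩, ⟨hc, hd⟩, h3⟩, h4⟩ := hx
      refine Finset.mem_coe.2 (mem_quads.2 ⟨⟨ha, hb, hc, hd⟩, h1, h3.1, ?_⟩)
      exact bisector_eq_of_bisLine_eq h2 (q := (a, b)) (q' := (c, d))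
        (sub_ne_zero.1 (ne_zero_of_dot h1.1)) (sub_ne_zero.1 (ne_zero_of_dot h3.1)) h4
    · rintro ⟨⟨a, b⟩, ⟨c, d⟩⟩ - ⟨⟨a', b'⟩, ⟨c', d'⟩⟩ - h
      simp only [Prod.mk.injEq] at h ⊢
      tauto

end SecondMoment

section SignedTriangles

lemma sum_sq_le_card_mul_sum_fiber {α β : Type*} [DecidableEq α] [DecidableEq β] [Fintype β]
    (B : Finset α) (g : α → β) (f : α → ℝ) :
    (∑ a ∈ B, f a) ^ 2 ≤ Fintype.card β *
      ∑ q ∈ (B ×ˢ B).filter fun q => g q.1 = g q.2, f q.1 * f q.2 := by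
  have h1 : ∑ q ∈ (B ×ˢ B).filter (fun q => g q.1 = g q.2), f q.1 * f q.2 =
      ∑ c, (∑ a ∈ B.filter fun a => g a = c, f a) ^ 2 := by
    rw [← Finset.sum_fiberwise_of_maps_to (g := fun q => g q.1) (t := Finset.univ)
      (fun x _ => Finset.mem_univ _)]
    refine Finset.sum_congr rfl fun c _ => ?_
    rw [sq, Finset.sum_mul_sum, ← Finset.sum_product']
    refine Finset.sum_congr ?_ fun _ _ => rfl
    ext x
    simp only [Finset.mem_product, Finset.mem_filter]
    constructor
    · rintro ⟨⟨⟨h1, h3⟩, h4⟩, h2⟩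
      exact ⟨⟨h1, h2⟩, h3, h4.symm.trans h2⟩
    · rintro ⟨⟨h1, h2⟩, h3, h4⟩
      exact ⟨⟨⟨h1, h3⟩, h2.trans h4.symm⟩, h2⟩
  rw [h1, ← Finset.sum_fiberwise_of_maps_to (g := g) (t := Finset.univ) (s := B)
      (fun x _ => Finset.mem_univ _), ← Finset.card_univ]
  exact sq_sum_le_card_mul_sum_sq

variable {k : Type*} [Field k]

lemma dist2_eq_dot (x y : k × k) : dist2 x y = dot (x - y) (x - y) := by
  simp only [dist2, dot, Prod.fst_sub, Prod.snd_sub]; ring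

lemma dist2_comm (x y : k × k) : dist2 x y = dist2 y x := by
  simp only [dist2]; ring

lemma eq_or_dist2_eq_zero_of_isotropic {F : Type*} [Field F] [Algebra k F] (h2 : (2 : k) ≠ 0)
    {θ : F} (hθ : θ ^ 2 = -1) {a b x : k × k} (h : dist2 a x = dist2 b x)
    (h0 : dot (b - a) (b - a) = 0) : a = b ∨ dist2 a x = 0 := by
  rw [← dist2_eq_dot] at h0
  have e0 := (dist2_iso hθ b a).symm
  rw [h0, map_zero, mul_eq_zero, sub_eq_zero, sub_eq_zero] at e0
  have e := congrArg (algebraMap k F) h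
  rw [dist2_iso hθ, dist2_iso hθ] at e
  have hz : ∀ u v : F, algebraMap k F (dist2 a x) = u * v → u = 0 ∨ v = 0 → dist2 a x = 0 := by
    intro u v h3 h4
    rw [mul_eq_zero.2 h4] at h3
    exact (map_eq_zero _).1 h3
  rcases e0 with e0 | e0
  · have h5 : (iso θ a - iso θ x) * (iso (-θ) b - iso (-θ) a) = 0 := by
      rw [e0] at e
      linear_combination -e
    rcases mul_eq_zero.1 h5 with h5 | h5
    · exact Or.inr (hz _ _ (dist2_iso hθ a x) (Or.inl h5))
    · exact Or.inl (eq_of_iso h2 hθ e0 (sub_eq_zero.1 h5)).symm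
  · have h5 : (iso (-θ) a - iso (-θ) x) * (iso θ b - iso θ a) = 0 := by
      rw [e0] at e
      linear_combination -e
    rcases mul_eq_zero.1 h5 with h5 | h5
    · exact Or.inr (hz _ _ (dist2_iso hθ a x) (Or.inr h5))
    · exact Or.inl (eq_of_iso h2 hθ (sub_eq_zero.1 h5) e0).symm

variable [DecidableEq k]

/-- The ordered pairs of `A` with a non-isotropic difference. -/
def nondegPairs (A : Finset (k × k)) : Finset ((k × k) × (k × k)) :=
  (A ×ˢ A).filter fun q => dot (q.2 - q.1) (q.2 - q.1) ≠ 0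

lemma card_two_cones_le {F : Type*} [Field F] [Algebra k F] (h2 : (2 : k) ≠ 0)
    {θ : F} (hθ : θ ^ 2 = -1) (A : Finset (k × k)) {a b : k × k} (h0 : dot (b - a) (b - a) ≠ 0) :
    (A.filter fun x => dist2 a x = 0 ∧ dist2 b x = 0).card ≤ 2 := by
  classical
  set s : Finset (F × F) := {(iso θ a, iso (-θ) b), (iso θ b, iso (-θ) a)}
  refine le_trans (Finset.card_le_card_of_injOn (t := s) (fun x => (iso θ x, iso (-θ) x)) ?_ ?_)
    Finset.card_le_two
  · intro x hx
    obtain ⟨-, h3, h4⟩ := Finset.mem_filter.1 hx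
    rw [← dist2_eq_dot] at h0
    have e0 : (iso θ b - iso θ a) * (iso (-θ) b - iso (-θ) a) ≠ 0 := by
      rw [← dist2_iso hθ]; exact (map_ne_zero _).2 h0
    have e3 := (dist2_iso hθ a x).symm
    have e4 := (dist2_iso hθ b x).symm
    rw [h3, map_zero, mul_eq_zero, sub_eq_zero, sub_eq_zero] at e3
    rw [h4, map_zero, mul_eq_zero, sub_eq_zero, sub_eq_zero] at e4
    obtain ⟨n1, n2⟩ := mul_ne_zero_iff.1 e0
    simp only [s, Finset.coe_insert, Finset.coe_singleton, Set.mem_insert_iff,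
      Set.mem_singleton_iff, Prod.mk.injEq]
    rcases e3 with e3 | e3 <;> rcases e4 with e4 | e4
    · exact absurd (sub_eq_zero.2 (e4.trans e3.symm)) n1
    · exact Or.inl ⟨e3.symm, e4.symm⟩
    · exact Or.inr ⟨e4.symm, e3.symm⟩
    · exact absurd (sub_eq_zero.2 (e4.trans e3.symm)) n2
  · intro x _ y _ h
    simp only [Prod.mk.injEq] at h
    exact eq_of_iso h2 hθ h.1 h.2

lemma neg_card_le_sum {α : Type*} (S : Finset α) {f : α → ℝ} (hf : ∀ x, |f x| ≤ 1) :
    -(S.card : ℝ) ≤ ∑ x ∈ S, f x := by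
  have := Finset.card_nsmul_le_sum S f (-1) fun x _ => (abs_le.1 (hf x)).1
  rw [nsmul_eq_mul] at this
  linarith

lemma abs_sum_le_card {α : Type*} (S : Finset α) {f : α → ℝ} (hf : ∀ x, |f x| ≤ 1) :
    |∑ x ∈ S, f x| ≤ S.card := by
  refine (Finset.abs_sum_le_sum_abs _ _).trans ?_
  have := Finset.sum_le_card_nsmul S (fun x => |f x|) 1 fun x _ => hf x
  rwa [nsmul_eq_mul, mul_one] at this

variable [Fintype k]

lemma sum_vertex_ge {F : Type*} [Field F] [Algebra k F] (h2 : (2 : k) ≠ 0)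
    {θ : F} (hθ : θ ^ 2 = -1) (A : Finset (k × k)) {f : k × k → ℝ} (hf : ∀ x, |f x| ≤ 1)
    (x : k × k) :
    (∑ a ∈ A, f a) ^ 2 / Fintype.card k - 5 * A.card -
      ((nondegPairs A).filter fun q => dist2 q.1 x = 0 ∧ dist2 q.2 x = 0).card ≤
    ∑ q ∈ (nondegPairs A).filter fun q => dist2 q.1 x = dist2 q.2 x, f q.1 * f q.2 := by
  have hp : (0 : ℝ) < Fintype.card k := Nat.cast_pos.2 Fintype.card_pos
  have hff : ∀ q : (k × k) × (k × k), |f q.1 * f q.2| ≤ 1 := fun q => by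
    rw [abs_mul]; exact mul_le_one₀ (hf _) (abs_nonneg _) (hf _)
  set B := A.filter fun a => dist2 a x ≠ 0
  set S := (nondegPairs A).filter fun q => dist2 q.1 x = dist2 q.2 x
  set S₀ := (nondegPairs A).filter fun q => dist2 q.1 x = 0 ∧ dist2 q.2 x = 0
  have h1 : ∑ q ∈ S, f q.1 * f q.2 = ∑ q ∈ S.filter (fun q => dist2 q.1 x ≠ 0), f q.1 * f q.2 +
      ∑ q ∈ S₀, f q.1 * f q.2 := by
    rw [← Finset.sum_filter_add_sum_filter_not S fun q => dist2 q.1 x ≠ 0]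
    congr 2
    ext q
    simp only [S, S₀, Finset.mem_filter, not_not]
    constructor
    · rintro ⟨⟨h1, h2⟩, h3⟩
      exact ⟨h1, h3, h2.symm.trans h3⟩
    · rintro ⟨h1, h2, h3⟩
      exact ⟨⟨h1, h2.trans h3.symm⟩, h2⟩
  have h3 := neg_card_le_sum S₀ hff
  have h4 : ∑ q ∈ (B ×ˢ B).filter (fun q => dist2 q.1 x = dist2 q.2 x), f q.1 * f q.2 =
      ∑ q ∈ S.filter (fun q => dist2 q.1 x ≠ 0), f q.1 * f q.2 + ∑ a ∈ B, f a * f a := by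
    rw [← Finset.sum_filter_add_sum_filter_not _ fun q => q.1 ≠ q.2]
    congr 1
    · refine Finset.sum_congr ?_ fun _ _ => rfl
      ext ⟨a, b⟩
      simp only [S, B, nondegPairs, Finset.mem_filter, Finset.mem_product]
      constructor
      · rintro ⟨⟨⟨⟨ha, ha0⟩, hb, -⟩, h⟩, hab⟩
        refine ⟨⟨⟨⟨ha, hb⟩, fun h0 => ?_⟩, h⟩, ha0⟩
        exact (eq_or_dist2_eq_zero_of_isotropic h2 hθ h h0).elim hab ha0
      · rintro ⟨⟨⟨⟨ha, hb⟩, h0⟩, h⟩, ha0⟩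
        exact ⟨⟨⟨⟨ha, ha0⟩, hb, h ▸ ha0⟩, h⟩, fun hab => ne_zero_of_dot h0 (sub_eq_zero.2 hab.symm)⟩
    · symm
      refine Finset.sum_bij (fun a _ => (a, a)) ?_ ?_ ?_ ?_
      · intro a ha
        simpa using ha
      · intro a _ b _ h
        exact congrArg Prod.fst h
      · rintro ⟨a, b⟩ h
        simp only [Finset.mem_filter, Finset.mem_product, not_not] at h
        exact ⟨a, h.1.1.1, by rw [h.2]⟩
      · intro a _
        rfl
  have h5 : ∑ a ∈ B, f a * f a ≤ A.card := by
    refine (le_abs_self _).trans ((abs_sum_le_card B (f := fun a => f a * f a)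
      fun a => hff (a, a)).trans ?_)
    exact_mod_cast Finset.card_le_card (Finset.filter_subset _ _)
  have h6 := sum_sq_le_card_mul_sum_fiber B (fun a => dist2 a x) f
  have h7 := abs_sum_le_card A hf
  have h8 : |∑ a ∈ A.filter (fun a => ¬ dist2 a x ≠ 0), f a| ≤ 2 * Fintype.card k := by
    refine (abs_sum_le_card _ hf).trans ?_
    have : (A.filter (fun a => ¬ dist2 a x ≠ 0)).card ≤ 2 * Fintype.card k := by
      refine le_trans (Finset.card_le_card fun a ha => ?_) (card_cone_le x)
      simpa using (Finset.mem_filter.1 ha).2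
    exact_mod_cast this
  have h9 := Finset.sum_filter_add_sum_filter_not A (fun a => dist2 a x ≠ 0) f
  set φ := ∑ a ∈ A, f a
  set φ₀ := ∑ a ∈ A.filter (fun a => ¬ dist2 a x ≠ 0), f a
  set φ₁ := ∑ a ∈ B, f a
  set R := ∑ q ∈ (B ×ˢ B).filter (fun q => dist2 q.1 x = dist2 q.2 x), f q.1 * f q.2
  have h10 : φ ^ 2 / Fintype.card k - 4 * A.card ≤ R := by
    rw [sub_le_iff_le_add, div_le_iff₀ hp]
    have h11 : φ * φ₀ ≤ A.card * (2 * Fintype.card k) := by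
      refine (le_abs_self _).trans ?_
      rw [abs_mul]
      exact mul_le_mul h7 h8 (abs_nonneg _) (Nat.cast_nonneg _)
    have h12 : φ₁ = φ - φ₀ := by linarith
    rw [h12] at h6
    nlinarith [sq_nonneg φ₀]
  linarith

open Classical in
/-- Signed counts of isosceles triangles cannot be much smaller than expected. -/
lemma sum_signed_bisExc_ge {F : Type*} [Field F] [Algebra k F] (h2 : (2 : k) ≠ 0)
    {θ : F} (hθ : θ ^ 2 = -1) (A : Finset (k × k)) {f : k × k → ℝ} (hf : ∀ x, |f x| ≤ 1) :
    -(9 * (A.card : ℝ) ^ 2) ≤ ∑ q ∈ nondegPairs A, f q.1 * f q.2 * bisExc A q := by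
  have hp : (0 : ℝ) < Fintype.card k := Nat.cast_pos.2 Fintype.card_pos
  have hff : ∀ q : (k × k) × (k × k), |f q.1 * f q.2| ≤ 1 := fun q => by
    rw [abs_mul]; exact mul_le_one₀ (hf _) (abs_nonneg _) (hf _)
  have h1 : ∑ q ∈ nondegPairs A, f q.1 * f q.2 * bisExc A q =
      ∑ x ∈ A, ∑ q ∈ (nondegPairs A).filter (fun q => dist2 q.1 x = dist2 q.2 x), f q.1 * f q.2 -
      (A.card : ℝ) / Fintype.card k * ∑ q ∈ nondegPairs A, f q.1 * f q.2 := by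
    simp only [bisExc, mul_sub]
    rw [Finset.sum_sub_distrib, ← Finset.sum_mul, mul_comm _ ((A.card : ℝ) / _)]
    congr 1
    simp only [Finset.card_filter, Nat.cast_sum, Finset.mul_sum, Finset.sum_filter]
    rw [Finset.sum_comm]
    refine Finset.sum_congr rfl fun x _ => Finset.sum_congr rfl fun q _ => ?_
    split_ifs <;> simp
  have h3 : ∑ x ∈ A, ((nondegPairs A).filter fun q => dist2 q.1 x = 0 ∧ dist2 q.2 x = 0).card ≤
      2 * A.card ^ 2 := by
    simp only [Finset.card_filter]
    rw [Finset.sum_comm]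
    simp only [← Finset.card_filter]
    calc ∑ q ∈ nondegPairs A, (A.filter fun x => dist2 q.1 x = 0 ∧ dist2 q.2 x = 0).card
        ≤ ∑ q ∈ nondegPairs A, 2 := Finset.sum_le_sum fun q hq =>
          card_two_cones_le h2 hθ A (Finset.mem_filter.1 hq).2
      _ = 2 * (nondegPairs A).card := by rw [Finset.sum_const, smul_eq_mul, mul_comm]
      _ ≤ 2 * A.card ^ 2 := by
          rw [sq, ← Finset.card_product]
          exact Nat.mul_le_mul_left _ (Finset.card_le_card (Finset.filter_subset _ _))
  have h3' : ∑ x ∈ A, (((nondegPairs A).filter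
      fun q => dist2 q.1 x = 0 ∧ dist2 q.2 x = 0).card : ℝ) ≤ 2 * (A.card : ℝ) ^ 2 := by
    exact_mod_cast h3
  have h4 := Finset.sum_le_sum fun x (_ : x ∈ A) => sum_vertex_ge h2 hθ A hf x
  rw [Finset.sum_sub_distrib, Finset.sum_const, nsmul_eq_mul] at h4
  have h5 : ∑ q ∈ nondegPairs A, f q.1 * f q.2 ≤
      (∑ a ∈ A, f a) ^ 2 + 2 * A.card * Fintype.card k := by
    have e := Finset.sum_filter_add_sum_filter_not (A ×ˢ A)
      (fun q => dot (q.2 - q.1) (q.2 - q.1) ≠ 0) fun q => f q.1 * f q.2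
    have e1 := neg_card_le_sum
      ((A ×ˢ A).filter fun q => ¬ dot (q.2 - q.1) (q.2 - q.1) ≠ 0) hff
    have e2 : ((A ×ˢ A).filter fun q => ¬ dot (q.2 - q.1) (q.2 - q.1) ≠ 0).card ≤
        A.card * (2 * Fintype.card k) := by
      rw [Finset.card_filter, Finset.sum_product, ← smul_eq_mul]
      refine Finset.sum_le_card_nsmul _ _ _ fun a _ => ?_
      rw [← Finset.card_filter]
      refine le_trans (Finset.card_le_card fun b hb => ?_) (card_cone_le a)
      simpa [dist2_eq_dot] using (Finset.mem_filter.1 hb).2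
    have e3 : (((A ×ˢ A).filter fun q => ¬ dot (q.2 - q.1) (q.2 - q.1) ≠ 0).card : ℝ) ≤
        A.card * (2 * Fintype.card k) := by exact_mod_cast e2
    have e4 : ∑ q ∈ A ×ˢ A, f q.1 * f q.2 = (∑ a ∈ A, f a) ^ 2 := by
      rw [sq, Finset.sum_mul_sum, Finset.sum_product]
    rw [nondegPairs]
    linarith
  have h6 := mul_le_mul_of_nonneg_left h5 (div_nonneg (Nat.cast_nonneg A.card) hp.le)
  have h7 : (A.card : ℝ) / Fintype.card k *
      ((∑ a ∈ A, f a) ^ 2 + 2 * A.card * Fintype.card k) =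
      A.card * ((∑ a ∈ A, f a) ^ 2 / Fintype.card k) + 2 * (A.card : ℝ) ^ 2 := by
    field_simp
  rw [h1]
  nlinarith

end SignedTriangles

section NonTame

variable {k : Type*} [Field k]

lemma parallel_of_dot_eq_zero {n m z : k × k} (hz : z ≠ 0) (hn : dot n z = 0) (hm : dot m z = 0) :
    n.1 * m.2 = n.2 * m.1 := by
  rw [dot] at hn hm
  by_cases h : z.1 = 0
  · have h' : z.2 ≠ 0 := fun h' => hz (Prod.ext h h')
    apply mul_right_cancel₀ h'
    linear_combination n.1 * hm - m.1 * hn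
  · apply mul_right_cancel₀ h
    linear_combination m.2 * hn - n.2 * hm

lemma dot_sub_eq_zero_of_mem_bisector (h2 : (2 : k) ≠ 0) {a b x y : k × k}
    (hx : x ∈ bisector a b) (hy : y ∈ bisector a b) : dot (b - a) (x - y) = 0 := by
  rw [mem_bisector] at hx hy
  apply mul_left_cancel₀ h2
  simp only [dot, Prod.fst_sub, Prod.snd_sub] at hx hy ⊢
  linear_combination hx - hy

variable [DecidableEq k]

lemma eq_of_two_mem_bisector (h2 : (2 : k) ≠ 0) {a b b' x y : k × k}
    (hb : dot (b - a) (b - a) ≠ 0) (hb' : b' ≠ a) (hxy : x ≠ y) (hx : x ∈ bisector a b)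
    (hy : y ∈ bisector a b) (hx' : x ∈ bisector a b') (hy' : y ∈ bisector a b') : b = b' := by
  refine eq_of_mem_bisector hb hb' ?_ hx hx'
  exact dirClass_eq_of_parallel (ne_zero_of_dot hb) (sub_ne_zero.2 hb') <|
    parallel_of_dot_eq_zero (sub_ne_zero.2 hxy) (dot_sub_eq_zero_of_mem_bisector h2 hx hy)
      (dot_sub_eq_zero_of_mem_bisector h2 hx' hy')

lemma card_lt_card_le {α β : Type*} [Fintype β] (f : β → Finset α) (κ n : ℕ)
    (h : 3 * ∑ y, (f y).card ≤ 4 * n) :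
    3 * ((Finset.univ.filter fun y => κ < (f y).card).card * (κ + 1)) ≤ 4 * n := by
  refine le_trans (Nat.mul_le_mul_left _ ?_) h
  rw [← smul_eq_mul]
  refine (Finset.card_nsmul_le_sum _ (fun y => (f y).card) (κ + 1) fun y hy => ?_).trans
    (Finset.sum_le_sum_of_subset (Finset.filter_subset _ _))
  exact (Finset.mem_filter.1 hy).2

open Classical in
/-- The non-degenerate pairs whose bisector meets the centre of many rich circles, or is orthogonal
to the direction of many rich lines. -/
noncomputable def wildPairs (A : Finset (k × k)) (κ : ℕ) : Finset ((k × k) × (k × k)) :=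
  (nondegPairs A).filter fun q => ¬ IsTame A κ q.1 q.2

open Classical in
lemma mem_wildPairs {A : Finset (k × k)} {κ : ℕ} {a b : k × k} :
    (a, b) ∈ wildPairs A κ ↔ (a ∈ A ∧ b ∈ A) ∧ dot (b - a) (b - a) ≠ 0 ∧
      ((∃ y ∈ bisector a b, κ < (richCirc A y).card) ∨ κ < (richDir A (dirClass (b - a))).card) := by
  rw [wildPairs, Finset.mem_filter, nondegPairs, Finset.mem_filter, Finset.mem_product, IsTame]
  simp only [not_and_or, not_forall, not_le, exists_prop, ne_eq]
  constructor
  · rintro ⟨⟨h1, h2⟩, h3⟩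
    exact ⟨h1, h2, h3.resolve_left fun h => h h2⟩
  · rintro ⟨h1, h2, h3⟩
    exact ⟨⟨h1, h2⟩, Or.inr h3⟩

variable [Fintype k]

open Classical in
lemma card_wildPairs_le (A : Finset (k × k)) (κ : ℕ) :
    (wildPairs A κ).card ≤
      (Finset.univ.filter fun y => κ < (richCirc A y).card).card * (A.card * (Fintype.card k + 1)) +
      (Finset.univ.filter fun o => κ < (richDir A o).card).card * (A.card * Fintype.card k) := by
  set C₁ := Finset.univ.filter fun y => κ < (richCirc A y).card
  set V₁ := Finset.univ.filter fun o => κ < (richDir A o).card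
  set W₁ := (wildPairs A κ).filter fun q => ∃ y ∈ bisector q.1 q.2, κ < (richCirc A y).card
  set W₂ := (wildPairs A κ).filter fun q => κ < (richDir A (dirClass (q.2 - q.1))).card
  have hsub : wildPairs A κ ⊆ W₁ ∪ W₂ := by
    rintro ⟨a, b⟩ hq
    simp only [W₁, W₂, Finset.mem_union, Finset.mem_filter, hq, true_and]
    exact (mem_wildPairs.1 hq).2.2
  have b1 : W₁.card ≤ (C₁ ×ˢ A ×ˢ (Finset.univ : Finset (Option k))).card := by
    refine Finset.card_le_card_of_forall_subsingleton (fun q t => t.1 ∈ bisector q.1 q.2 ∧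
      t.2.1 = q.1 ∧ t.2.2 = dirClass (q.2 - q.1)) ?_ ?_
    · rintro ⟨a, b⟩ hq
      obtain ⟨hq, y, hy, hc⟩ := Finset.mem_filter.1 hq
      refine ⟨(y, a, dirClass (b - a)), ?_, hy, rfl, rfl⟩
      simp only [C₁, Finset.mem_product, Finset.mem_filter, Finset.mem_univ, true_and, and_true]
      exact ⟨hc, (mem_wildPairs.1 hq).1.1⟩
    · rintro ⟨y, a₀, o⟩ -
      rintro ⟨a, b⟩ ⟨hq, e1, e2, e3⟩ ⟨a', b'⟩ ⟨hq', e1', e2', e3'⟩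
      simp only at e1 e2 e3 e1' e2' e3'
      subst e2
      subst e2'
      have h := (mem_wildPairs.1 (Finset.mem_filter.1 hq).1).2.1
      have h' := (mem_wildPairs.1 (Finset.mem_filter.1 hq').1).2.1
      rw [eq_of_mem_bisector h (sub_ne_zero.1 (ne_zero_of_dot h')) (e3.symm.trans e3') e1 e1']
  have b2 : W₂.card ≤ (V₁ ×ˢ A ×ˢ (Finset.univ : Finset k)).card := by
    refine Finset.card_le_card_of_injOn
      (fun q => (dirClass (q.2 - q.1), q.1, dirCoord (q.2 - q.1))) ?_ ?_
    · rintro ⟨a, b⟩ hq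
      obtain ⟨hq, hc⟩ := Finset.mem_filter.1 hq
      simp only [V₁, Finset.coe_product, Set.mem_prod, Finset.mem_coe, Finset.mem_filter,
        Finset.mem_univ, true_and, and_true]
      exact ⟨hc, (mem_wildPairs.1 hq).1.1⟩
    · rintro ⟨a, b⟩ - ⟨a', b'⟩ - h
      simp only [Prod.mk.injEq] at h
      obtain ⟨h1, rfl, h3⟩ := h
      rw [sub_left_injective (eq_of_dirClass_eq h1 h3)]
  rw [Finset.card_product, Finset.card_product, Finset.card_univ] at b1 b2
  rw [Fintype.card_option] at b1
  exact (Finset.card_le_card hsub).trans ((Finset.card_union_le _ _).trans (add_le_add b1 b2))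

open Classical in
lemma sum_wildPairs_le (h2 : (2 : k) ≠ 0) (A : Finset (k × k)) (κ : ℕ) :
    ∑ q ∈ wildPairs A κ, (A.filter fun x => dist2 q.1 x = dist2 q.2 x).card ≤
      (Finset.univ.filter fun y => κ < (richCirc A y).card).card *
        (A.card * A.card + A.card * (Fintype.card k + 1)) +
      (Finset.univ.filter fun o => κ < (richDir A o).card).card * (A.card * A.card) := by
  set C₁ := Finset.univ.filter fun y => κ < (richCirc A y).card
  set V₁ := Finset.univ.filter fun o => κ < (richDir A o).card
  set S := (wildPairs A κ ×ˢ A).filter fun t => dist2 t.1.1 t.2 = dist2 t.1.2 t.2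
  have hS : ∑ q ∈ wildPairs A κ, (A.filter fun x => dist2 q.1 x = dist2 q.2 x).card = S.card := by
    simp only [S, Finset.card_filter, Finset.sum_product]
  set W₁ := S.filter fun t => ∃ y ∈ bisector t.1.1 t.1.2, κ < (richCirc A y).card ∧ t.2 ≠ y
  set W₂ := S.filter fun t => κ < (richCirc A t.2).card
  set W₃ := S.filter fun t => κ < (richDir A (dirClass (t.1.2 - t.1.1))).card
  have hmem : ∀ {a b x : k × k}, ((a, b), x) ∈ S ↔
      ((a, b) ∈ wildPairs A κ ∧ x ∈ A) ∧ x ∈ bisector a b := by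
    intro a b x
    simp only [S, Finset.mem_filter, Finset.mem_product, bisector, Set.mem_ofPred_eq]
  have hsub : S ⊆ (W₁ ∪ W₂) ∪ W₃ := by
    rintro ⟨⟨a, b⟩, x⟩ hq
    simp only [W₁, W₂, W₃, Finset.mem_union, Finset.mem_filter, hq, true_and]
    rcases (mem_wildPairs.1 (hmem.1 hq).1.1).2.2 with ⟨y, hy, h⟩ | h
    · by_cases hxy : x = y
      · exact Or.inl (Or.inr (hxy ▸ h))
      · exact Or.inl (Or.inl ⟨y, hy, h, hxy⟩)
    · exact Or.inr h
  have b1 : W₁.card ≤ (C₁ ×ˢ A ×ˢ A).card := by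
    refine Finset.card_le_card_of_forall_subsingleton (fun t s => s.1 ∈ bisector t.1.1 t.1.2 ∧
      t.2 ≠ s.1 ∧ s.2 = (t.2, t.1.1)) ?_ ?_
    · rintro ⟨⟨a, b⟩, x⟩ hq
      obtain ⟨hq, y, hy, hc, hxy⟩ := Finset.mem_filter.1 hq
      have h := hmem.1 hq
      refine ⟨(y, x, a), ?_, hy, hxy, rfl⟩
      simp only [C₁, Finset.mem_product, Finset.mem_filter, Finset.mem_univ, true_and]
      exact ⟨hc, h.1.2, (mem_wildPairs.1 h.1.1).1.1⟩
    · rintro ⟨y, x₀, a₀⟩ -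
      rintro ⟨⟨a, b⟩, x⟩ ⟨hq, e1, e2, e3⟩ ⟨⟨a', b'⟩, x'⟩ ⟨hq', e1', e2', e3'⟩
      simp only [Prod.mk.injEq] at e1 e2 e3 e1' e2' e3'
      obtain ⟨rfl, rfl⟩ := e3
      obtain ⟨rfl, rfl⟩ := e3'
      obtain ⟨h3, h4⟩ := hmem.1 (Finset.mem_filter.1 hq).1
      obtain ⟨h3', h4'⟩ := hmem.1 (Finset.mem_filter.1 hq').1
      have h := (mem_wildPairs.1 h3.1).2.1
      have h' := (mem_wildPairs.1 h3'.1).2.1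
      rw [eq_of_two_mem_bisector h2 h (sub_ne_zero.1 (ne_zero_of_dot h')) e2 h4 e1 h4' e1']
  have b2 : W₂.card ≤ (C₁ ×ˢ A ×ˢ (Finset.univ : Finset (Option k))).card := by
    refine Finset.card_le_card_of_injOn (fun t => (t.2, t.1.1, dirClass (t.1.2 - t.1.1))) ?_ ?_
    · rintro ⟨⟨a, b⟩, x⟩ hq
      obtain ⟨hq, hc⟩ := Finset.mem_filter.1 hq
      simp only [C₁, Finset.coe_product, Set.mem_prod, Finset.mem_coe, Finset.mem_filter,
        Finset.mem_univ, true_and, and_true]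
      exact ⟨hc, (mem_wildPairs.1 (hmem.1 hq).1.1).1.1⟩
    · rintro ⟨⟨a, b⟩, x⟩ hq ⟨⟨a', b'⟩, x'⟩ hq' e
      simp only [Prod.mk.injEq] at e
      obtain ⟨rfl, rfl, e⟩ := e
      obtain ⟨h3, h4⟩ := hmem.1 (Finset.mem_filter.1 hq).1
      obtain ⟨h3', h4'⟩ := hmem.1 (Finset.mem_filter.1 hq').1
      have h := (mem_wildPairs.1 h3.1).2.1
      have h' := (mem_wildPairs.1 h3'.1).2.1
      rw [eq_of_mem_bisector h (sub_ne_zero.1 (ne_zero_of_dot h')) e h4 h4']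
  have b3 : W₃.card ≤ (V₁ ×ˢ A ×ˢ A).card := by
    refine Finset.card_le_card_of_injOn (fun t => (dirClass (t.1.2 - t.1.1), t.2, t.1.1)) ?_ ?_
    · rintro ⟨⟨a, b⟩, x⟩ hq
      obtain ⟨hq, hc⟩ := Finset.mem_filter.1 hq
      have h := hmem.1 hq
      simp only [V₁, Finset.coe_product, Set.mem_prod, Finset.mem_coe, Finset.mem_filter,
        Finset.mem_univ, true_and]
      exact ⟨hc, h.1.2, (mem_wildPairs.1 h.1.1).1.1⟩
    · rintro ⟨⟨a, b⟩, x⟩ hq ⟨⟨a', b'⟩, x'⟩ hq' e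
      simp only [Prod.mk.injEq] at e
      obtain ⟨e, rfl, rfl⟩ := e
      obtain ⟨h3, h4⟩ := hmem.1 (Finset.mem_filter.1 hq).1
      obtain ⟨h3', h4'⟩ := hmem.1 (Finset.mem_filter.1 hq').1
      have h := (mem_wildPairs.1 h3.1).2.1
      have h' := (mem_wildPairs.1 h3'.1).2.1
      rw [eq_of_mem_bisector h (sub_ne_zero.1 (ne_zero_of_dot h')) e h4 h4']
  have hc := (Finset.card_le_card hsub).trans (Finset.card_union_le _ _)
  have hc1 := Finset.card_union_le W₁ W₂
  simp only [Finset.card_product, Finset.card_univ, Fintype.card_option] at b1 b2 b3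
  rw [hS]
  linarith

/-- The total deviation of the wild pairs is small. -/
lemma sum_abs_bisExc_wildPairs_le (h2 : (2 : k) ≠ 0) (A : Finset (k × k)) (κ : ℕ)
    (hn : Fintype.card k ≤ A.card) :
    (κ + 1) * ∑ q ∈ wildPairs A κ, |bisExc A q| ≤ 11 * (A.card : ℝ) ^ 3 := by
  have hp : (1 : ℝ) ≤ Fintype.card k := Nat.one_le_cast.2 Fintype.card_pos
  have hn' : (Fintype.card k : ℝ) ≤ A.card := Nat.cast_le.2 hn
  have h1 : ∑ q ∈ wildPairs A κ, |bisExc A q| ≤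
      ∑ q ∈ wildPairs A κ, ((A.filter fun x => dist2 q.1 x = dist2 q.2 x).card +
        (A.card : ℝ) / Fintype.card k) := by
    refine Finset.sum_le_sum fun q _ => ?_
    rw [bisExc]
    refine (abs_sub _ _).trans ?_
    rw [abs_of_nonneg (Nat.cast_nonneg _), abs_of_nonneg (by positivity)]
  rw [Finset.sum_add_distrib, Finset.sum_const, nsmul_eq_mul] at h1
  have h3 := (Nat.cast_le (α := ℝ)).2 (sum_wildPairs_le h2 A κ)
  have h4 := (Nat.cast_le (α := ℝ)).2 (card_wildPairs_le A κ)
  have h5 := (Nat.cast_le (α := ℝ)).2 (card_lt_card_le _ κ A.card (sum_card_richCirc h2 A))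
  have h6 := (Nat.cast_le (α := ℝ)).2 (card_lt_card_le _ κ A.card (sum_card_richDir A))
  push_cast at h3 h4 h5 h6
  set c : ℝ := ((Finset.univ.filter fun y => κ < (richCirc A y).card).card : ℝ)
  set v : ℝ := ((Finset.univ.filter fun o => κ < (richDir A o).card).card : ℝ)
  set n : ℝ := (A.card : ℝ)
  set p : ℝ := (Fintype.card k : ℝ)
  have hc : 0 ≤ c := Nat.cast_nonneg _
  have hv : 0 ≤ v := Nat.cast_nonneg _
  have h7 : n * (p + 1) ≤ 2 * n ^ 2 := by nlinarith
  have h8 : ((wildPairs A κ).card : ℝ) * (n / p) ≤ c * (2 * n ^ 2) + v * n ^ 2 := by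
    refine (mul_le_mul_of_nonneg_right h4 (by positivity)).trans ?_
    rw [mul_div_assoc', div_le_iff₀ (by positivity)]
    have : n ^ 2 * (p + 1) ≤ n ^ 2 * (2 * p) := by gcongr; linarith
    nlinarith [mul_le_mul_of_nonneg_left this hc]
  have h9 : ∑ q ∈ wildPairs A κ, |bisExc A q| ≤ 5 * n ^ 2 * c + 2 * n ^ 2 * v := by
    nlinarith [mul_le_mul_of_nonneg_left h7 hc]
  have hκ : (0 : ℝ) ≤ κ := Nat.cast_nonneg _
  have h10 : c * (κ + 1) ≤ 4 / 3 * n := by linarith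
  have h11 : v * (κ + 1) ≤ 4 / 3 * n := by linarith
  calc (κ + 1) * ∑ q ∈ wildPairs A κ, |bisExc A q|
      ≤ (κ + 1) * (5 * n ^ 2 * c + 2 * n ^ 2 * v) := by gcongr
    _ = 5 * n ^ 2 * (c * (κ + 1)) + 2 * n ^ 2 * (v * (κ + 1)) := by ring
    _ ≤ 5 * n ^ 2 * (4 / 3 * n) + 2 * n ^ 2 * (4 / 3 * n) := by gcongr
    _ ≤ 11 * n ^ 3 := by nlinarith [pow_nonneg (Nat.cast_nonneg A.card : (0 : ℝ) ≤ n) 3]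

end NonTame

section Distances

/-- The threshold in the fibrewise energy bound, for a fibre with `ν` elements. -/
def energyThreshold (n p ν : ℕ) : ℕ :=
  Nat.sqrt (12168 * ν) + Nat.sqrt (8 * n) + 39 * ν / p + 2

lemma lt_energyThreshold_sq (n p ν : ℕ) : 12168 * ν < energyThreshold n p ν ^ 2 := by
  refine (Nat.lt_succ_sqrt' (12168 * ν)).trans_le (Nat.pow_le_pow_left ?_ 2)
  rw [energyThreshold]
  generalize 39 * ν / p = c
  omega

lemma le_energyThreshold_sq (n p ν : ℕ) : 8 * n ≤ energyThreshold n p ν ^ 2 := by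
  refine (Nat.lt_succ_sqrt' (8 * n)).le.trans (Nat.pow_le_pow_left ?_ 2)
  rw [energyThreshold]
  generalize 39 * ν / p = c
  omega

lemma lt_energyThreshold_mul (n : ℕ) {p : ℕ} (hp : 0 < p) (ν : ℕ) :
    39 * ν < energyThreshold n p ν * p := by
  have h := Nat.div_add_mod (39 * ν) p
  have h' := Nat.mod_lt (39 * ν) hp
  have : (39 * ν / p + 1) * p ≤ energyThreshold n p ν * p :=
    Nat.mul_le_mul_right _ (by rw [energyThreshold]; omega)
  linarith [mul_comm p (39 * ν / p), add_mul (39 * ν / p) 1 p]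

lemma energyThreshold_le (n p ν : ℕ) :
    (energyThreshold n p ν : ℝ) ≤ 111 * √ν + (√(8 * n) + 2) + 39 * ν / p := by
  have h1 : (Nat.sqrt (12168 * ν) : ℝ) ≤ 111 * √ν := by
    refine Real.nat_sqrt_le_real_sqrt.trans ?_
    rw [Real.sqrt_le_iff]
    refine ⟨by positivity, ?_⟩
    rw [mul_pow, Real.sq_sqrt (Nat.cast_nonneg _)]
    push_cast
    nlinarith [(Nat.cast_nonneg ν : (0 : ℝ) ≤ ν)]
  have h2 : (Nat.sqrt (8 * n) : ℝ) ≤ √(8 * n) := by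
    exact_mod_cast Real.nat_sqrt_le_real_sqrt (a := 8 * n)
  have h3 : ((39 * ν / p : ℕ) : ℝ) ≤ 39 * ν / p := by
    exact_mod_cast Nat.cast_div_le (α := ℝ) (m := 39 * ν) (n := p)
  rw [energyThreshold]
  push_cast
  linarith

lemma sum_energyThreshold_mul_le {ι : Type*} (s : Finset ι) (ν : ι → ℕ) (n p : ℕ) {V : ℝ}
    (hn : ∑ r ∈ s, ν r ≤ n ^ 2) (hV : ∑ r ∈ s, (ν r : ℝ) ^ 2 ≤ V) :
    ((∑ r ∈ s, energyThreshold n p (ν r) * ν r : ℕ) : ℝ) ≤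
      111 * (n * √V) + (√(8 * n) + 2) * n ^ 2 + 39 * V / p := by
  have hn' : ∑ r ∈ s, (ν r : ℝ) ≤ (n : ℝ) ^ 2 := by exact_mod_cast hn
  have hV0 : 0 ≤ V := le_trans (Finset.sum_nonneg fun r _ => sq_nonneg _) hV
  have hcs : ∑ r ∈ s, √(ν r) * (ν r : ℝ) ≤ n * √V := by
    refine le_of_sq_le_sq ?_ (by positivity)
    refine (Finset.sum_mul_sq_le_sq_mul_sq _ _ _).trans ?_
    rw [mul_pow, Real.sq_sqrt hV0]
    simp only [Real.sq_sqrt (Nat.cast_nonneg (α := ℝ) _)]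
    gcongr
  have h : ∀ r ∈ s, ((energyThreshold n p (ν r) * ν r : ℕ) : ℝ) ≤
      111 * (√(ν r) * (ν r : ℝ)) + (√(8 * n) + 2) * (ν r : ℝ) + 39 / p * (ν r : ℝ) ^ 2 := by
    intro r _
    push_cast
    refine (mul_le_mul_of_nonneg_right (energyThreshold_le n p (ν r))
      (Nat.cast_nonneg _)).trans_eq ?_
    ring
  rw [Nat.cast_sum]
  refine (Finset.sum_le_sum h).trans ?_
  rw [Finset.sum_add_distrib, Finset.sum_add_distrib, ← Finset.mul_sum, ← Finset.mul_sum,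
    ← Finset.mul_sum, mul_div_right_comm]
  gcongr

variable {k : Type*} [Field k] [DecidableEq k]

lemma sum_card_eq_of_dist_le {F : Type*} [Field F] [Algebra k F] [Fintype k] (h2 : (2 : k) ≠ 0)
    {θ : F} (hθ : θ ^ 2 = -1) (A : Finset (k × k)) :
    ∑ a ∈ A, ∑ r ∈ Finset.univ.filter (fun r => r ≠ 0),
      (A.filter fun b => dist2 b a = r).card ^ 2 ≤
    A.card ^ 2 + ∑ q ∈ nondegPairs A, (A.filter fun x => dist2 q.1 x = dist2 q.2 x).card := by
  set S := (A ×ˢ (A ×ˢ A)).filter fun t => dist2 t.2.1 t.1 = dist2 t.2.2 t.1 ∧ dist2 t.2.1 t.1 ≠ 0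
  have h1 : ∑ a ∈ A, ∑ r ∈ Finset.univ.filter (fun r => r ≠ 0),
      (A.filter fun b => dist2 b a = r).card ^ 2 = S.card := by
    simp only [S, Finset.card_filter, Finset.sum_product (s := A)]
    refine Finset.sum_congr rfl fun a _ => ?_
    rw [← Finset.sum_product', ← Finset.card_filter, Finset.card_eq_sum_card_fiberwise
      (f := fun x => dist2 x.1 a) (t := Finset.univ.filter fun r => r ≠ 0) (fun x hx => ?_)]
    · refine Finset.sum_congr rfl fun r hr => ?_
      rw [sq, ← Finset.card_filter, ← Finset.card_product]
      congr 1
      ext x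
      have := (Finset.mem_filter.1 hr).2
      simp only [Finset.mem_product, Finset.mem_filter]
      constructor
      · rintro ⟨⟨h1, h2⟩, h3, h4⟩
        exact ⟨⟨⟨h1, h3⟩, h2.trans h4.symm, h2 ▸ this⟩, h2⟩
      · rintro ⟨⟨⟨h1, h3⟩, h4, -⟩, h2⟩
        exact ⟨⟨h1, h2⟩, h3, h4.symm.trans h2⟩
    · have := (Finset.mem_filter.1 (Finset.mem_coe.1 hx)).2.2
      simpa using this
  have h3 : ∑ q ∈ nondegPairs A, (A.filter fun x => dist2 q.1 x = dist2 q.2 x).card =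
      ((nondegPairs A ×ˢ A).filter fun t => dist2 t.1.1 t.2 = dist2 t.1.2 t.2).card := by
    simp only [Finset.card_filter, Finset.sum_product]
  rw [h1, h3]
  have h4 : (S.filter fun t => t.2.1 = t.2.2).card ≤ (A ×ˢ A).card := by
    refine Finset.card_le_card_of_injOn (fun t => (t.1, t.2.1)) ?_ ?_
    · rintro ⟨a, b, c⟩ ht
      simp only [S, Finset.coe_filter, Finset.mem_filter, Finset.mem_product,
        Set.mem_ofPred_eq] at ht
      simpa using ⟨ht.1.1.1, ht.1.1.2.1⟩
    · rintro ⟨a, b, c⟩ ht ⟨a', b', c'⟩ ht' h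
      have e := (Finset.mem_filter.1 ht).2
      have e' := (Finset.mem_filter.1 ht').2
      simp only [Prod.mk.injEq] at h e e' ⊢
      exact ⟨h.1, h.2, e ▸ e' ▸ h.2⟩
  have h5 : (S.filter fun t => ¬ t.2.1 = t.2.2).card ≤
      ((nondegPairs A ×ˢ A).filter fun t => dist2 t.1.1 t.2 = dist2 t.1.2 t.2).card := by
    refine Finset.card_le_card_of_injOn (fun t => (t.2, t.1)) ?_ ?_
    · rintro ⟨a, b, c⟩ ht
      simp only [S, Finset.coe_filter, Finset.mem_filter, Finset.mem_product,
        Set.mem_ofPred_eq] at ht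
      obtain ⟨⟨⟨ha, hb, hc⟩, h, h0⟩, hbc⟩ := ht
      simp only [nondegPairs, Finset.coe_filter, Finset.mem_filter, Finset.mem_product,
        Set.mem_ofPred_eq]
      refine ⟨⟨⟨⟨hb, hc⟩, fun hd => ?_⟩, ha⟩, h⟩
      exact (eq_or_dist2_eq_zero_of_isotropic h2 hθ h hd).elim hbc h0
    · rintro ⟨a, b, c⟩ - ⟨a', b', c'⟩ - h
      simp only [Prod.mk.injEq] at h ⊢
      tauto
  rw [Finset.card_product, ← sq] at h4
  have h6 := Finset.card_filter_add_card_filter_not (s := S) (fun t => t.2.1 = t.2.2)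
  omega

end Distances

section Decomposition

variable {k : Type*} [Field k] [DecidableEq k] {F : Type*} [Field F] [Algebra k F]

/-- The number of triangles with apex in `A` and base a non-degenerate pair of `A`. -/
def isoCount (A : Finset (k × k)) : ℕ :=
  ∑ q ∈ nondegPairs A, (A.filter fun x => dist2 q.1 x = dist2 q.2 x).card

lemma sum_card_dist_sq_le [Fintype k] (h2 : (2 : k) ≠ 0) {θ : F} (hθ : θ ^ 2 = -1)
    {A A' : Finset (k × k)} (hA : A' ⊆ A) :
    ∑ r ∈ Finset.univ.filter (fun r : k => r ≠ 0),
      (((A' ×ˢ A').filter fun x => dist2 x.2 x.1 = r).card : ℝ) ^ 2 ≤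
    A.card * (A.card ^ 2 + isoCount A) := by
  have h := sum_card_eq_of_dist_le h2 hθ A
  have h1 : ∀ r : k, ((A' ×ˢ A').filter fun x => dist2 x.2 x.1 = r).card ^ 2 ≤
      A.card * ∑ a ∈ A, (A.filter fun b => dist2 b a = r).card ^ 2 := by
    intro r
    refine le_trans ?_ sq_sum_le_card_mul_sum_sq
    refine Nat.pow_le_pow_left ?_ 2
    have h3 : ((A ×ˢ A).filter fun x => dist2 x.2 x.1 = r).card =
        ∑ a ∈ A, (A.filter fun b => dist2 b a = r).card := by
      simp only [Finset.card_filter, Finset.sum_product]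
    rw [← h3]
    exact Finset.card_le_card (Finset.filter_subset_filter _ (Finset.product_subset_product hA hA))
  rw [Finset.sum_comm] at h
  have h4 := (Finset.sum_le_sum fun r (_ : r ∈ Finset.univ.filter fun r : k => r ≠ 0) =>
    h1 r).trans ((Finset.mul_sum _ _ _).symm.trans_le (Nat.mul_le_mul_left _ h))
  exact_mod_cast h4

lemma sum_card_dist_le [Fintype k] {A A' : Finset (k × k)} (hA : A' ⊆ A) (s : Finset k) :
    ∑ r ∈ s, ((A' ×ˢ A').filter fun x => dist2 x.2 x.1 = r).card ≤ A.card ^ 2 := by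
  refine (Finset.sum_le_sum_of_subset (Finset.subset_univ s)).trans ?_
  rw [← Finset.card_eq_sum_card_fiberwise (f := fun x : (k × k) × (k × k) => dist2 x.2 x.1)
    (t := Finset.univ) (fun x _ => Finset.mem_coe.2 (Finset.mem_univ _)), sq,
    ← Finset.card_product]
  exact Finset.card_le_card (Finset.product_subset_product hA hA)

lemma card_quads_le_real [Infinite F] [Fintype k] (h2 : (2 : k) ≠ 0) {θ : F} (hθ : θ ^ 2 = -1)
    {A A' : Finset (k × k)} (hA : A' ⊆ A) (κ : ℕ)
    (hm : ∀ z : F, ∀ S ⊆ A', (∀ x ∈ S, iso θ x = z) → S.card ≤ Nat.sqrt (8 * A.card))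
    (hchar : ∀ m : ℕ, 0 < m → m < Fintype.card k → (m : F) ≠ 0) {V : ℝ}
    (hV : A.card * (A.card ^ 2 + isoCount A) ≤ V) :
    ((quads A A' κ).card : ℝ) ≤ 6 * √(8 * A.card) * A.card ^ 2 + 10 * (A.card * κ * Fintype.card k)
      + 4 * (111 * (A.card * √V) + 2 * A.card ^ 2 + 39 * V / Fintype.card k) := by
  set n := A.card
  set p := Fintype.card k
  set ν : k → ℕ := fun r => ((A' ×ˢ A').filter fun x => dist2 x.2 x.1 = r).card
  have h := card_quads_le h2 hθ hA κ hm (ν := ν) (D := fun r => energyThreshold n p (ν r))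
    (fun r => rfl) hchar (fun r => lt_energyThreshold_sq n p _)
    (fun r => lt_energyThreshold_mul n Fintype.card_pos _)
    (fun r => by simp only [energyThreshold]; generalize 39 * ν r / p = c; omega)
    (fun r => by simp only [energyThreshold]; generalize 39 * ν r / p = c; omega)
    (fun r => le_energyThreshold_sq n p _)
  have h1 := sum_energyThreshold_mul_le (Finset.univ.filter fun r : k => r ≠ 0) ν n p
    (sum_card_dist_le hA _) ((sum_card_dist_sq_le h2 hθ hA).trans hV)
  have h' := (Nat.cast_le (α := ℝ)).2 h
  have h3 : (Nat.sqrt (8 * n) : ℝ) ≤ √(8 * n) := by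
    exact_mod_cast Real.nat_sqrt_le_real_sqrt (a := 8 * n)
  push_cast at h' h1
  have h4 := mul_le_mul_of_nonneg_left h3 (sq_nonneg (n : ℝ))
  have h5 : (0 : ℝ) ≤ n * κ * p := by positivity
  nlinarith

open Classical in
/-- The tame part of the deviation sum over the non-degenerate pairs of `A`. -/
noncomputable def tameSum [Fintype k] (A : Finset (k × k)) (κ : ℕ) : ℝ :=
  ∑ q ∈ (nondegPairs A).filter (fun q => IsTame A κ q.1 q.2), bisExc A q

lemma card_le_of_iso_rich (h2 : (2 : k) ≠ 0) [DecidableEq F] {θ : F} (hθ : θ ^ 2 = -1)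
    {A S : Finset (k × k)} (hSA : S ⊆ A) (z : F)
    (hS : ∀ x ∈ S, 8 * A.card ≤ (A.filter fun y => iso (-θ) y = iso (-θ) x).card ^ 2)
    (hz : ∀ x ∈ S, iso θ x = z) : S.card ≤ Nat.sqrt (8 * A.card) := by
  have hdisj : (S : Set (k × k)).PairwiseDisjoint
      fun x => A.filter fun y => iso (-θ) y = iso (-θ) x := by
    intro x hx y hy hxy
    refine Finset.disjoint_left.2 fun w hw hw' => hxy ?_
    exact eq_of_iso h2 hθ ((hz x hx).trans (hz y hy).symm)
      ((Finset.mem_filter.1 hw).2.symm.trans (Finset.mem_filter.1 hw').2)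
  have h1 : S.card * Nat.sqrt (8 * A.card) ≤ A.card := by
    refine le_trans ?_ (Finset.card_le_card (Finset.biUnion_subset.2
      fun x (_ : x ∈ S) => Finset.filter_subset (fun y => iso (-θ) y = iso (-θ) x) A))
    rw [Finset.card_biUnion hdisj, ← smul_eq_mul]
    refine Finset.card_nsmul_le_sum _ _ _ fun x hx => ?_
    exact (Nat.sqrt_le_sqrt (hS x hx)).trans_eq (Nat.sqrt_eq' _)
  by_contra! hlt
  have h3 := Nat.lt_succ_sqrt (8 * A.card)
  have h4 : (Nat.sqrt (8 * A.card)).succ * Nat.sqrt (8 * A.card) ≤ A.card :=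
    (Nat.mul_le_mul_right _ hlt).trans h1
  have h5 : 1 ≤ Nat.sqrt (8 * A.card) := by
    have := Finset.card_le_card hSA
    rw [Nat.le_sqrt]
    omega
  nlinarith

lemma tameSum_le [Infinite F] [Fintype k] (h2 : (2 : k) ≠ 0) {θ : F} (hθ : θ ^ 2 = -1)
    (A : Finset (k × k)) (κ : ℕ) (hn : Fintype.card k ≤ A.card)
    (hchar : ∀ m : ℕ, 0 < m → m < Fintype.card k → (m : F) ≠ 0) {V Q : ℝ}
    (hV : A.card * (A.card ^ 2 + isoCount A) ≤ V)
    (hQ : 6 * √(8 * A.card) * A.card ^ 2 + 10 * (A.card * κ * Fintype.card k)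
      + 4 * (111 * (A.card * √V) + 2 * A.card ^ 2 + 39 * V / Fintype.card k) ≤ Q) :
    tameSum A κ ≤ 4 * √(A.card * Fintype.card k * Q) + 9 * (A.card : ℝ) ^ 2 +
      11 * (A.card : ℝ) ^ 3 / (κ + 1) := by
  classical
  set A₁ := A.filter fun a => 8 * A.card ≤ (A.filter fun y => iso (-θ) y = iso (-θ) a).card ^ 2
  set A₂ := A.filter fun a => ¬ 8 * A.card ≤ (A.filter fun y => iso (-θ) y = iso (-θ) a).card ^ 2
  have hθ' : (-θ) ^ 2 = -1 := by rw [neg_sq, hθ]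
  have q1 : ((quads A A₁ κ).card : ℝ) ≤ Q :=
    (card_quads_le_real h2 hθ (Finset.filter_subset _ _) κ (fun z S hS hz =>
      card_le_of_iso_rich h2 hθ (hS.trans (Finset.filter_subset _ _)) z
        (fun x hx => (Finset.mem_filter.1 (hS hx)).2) hz)
      hchar hV).trans hQ
  have q2 : ((quads A A₂ κ).card : ℝ) ≤ Q := by
    refine (card_quads_le_real h2 hθ' (Finset.filter_subset _ _) κ (fun z S hS hz => ?_)
      hchar hV).trans hQ
    rcases S.eq_empty_or_nonempty with rfl | ⟨a, ha⟩
    · simp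
    · have h := (Finset.mem_filter.1 (hS ha)).2
      rw [not_le] at h
      rw [Nat.le_sqrt']
      refine (Nat.pow_le_pow_left (Finset.card_le_card fun x hx => ?_) 2).trans h.le
      exact Finset.mem_filter.2 ⟨(Finset.mem_filter.1 (hS hx)).1, (hz x hx).trans (hz a ha).symm⟩
  set f : k × k → ℝ := fun x => if x ∈ A₁ then 1 else -1
  have hf : ∀ x, |f x| ≤ 1 := fun x => by
    simp only [f]; split_ifs <;> simp
  have hs := sum_signed_bisExc_ge h2 hθ A hf
  have hw := sum_abs_bisExc_wildPairs_le h2 A κ hn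
  set W := (nondegPairs A).filter (fun q => IsTame A κ q.1 q.2)
  set S : Finset (k × k) → ℝ := fun A' =>
    ∑ q ∈ (A' ×ˢ A').filter (fun q => IsTame A κ q.1 q.2), bisExc A q
  have hS : ∀ A' : Finset (k × k), ((quads A A' κ).card : ℝ) ≤ Q →
      S A' ≤ √(A.card * Fintype.card k * Q) := by
    intro A' hA'
    refine Real.le_sqrt_of_sq_le ((sum_bisExc_tame_sq_le h2 A A' κ).trans ?_)
    gcongr
  have hsplit : ∑ q ∈ nondegPairs A, f q.1 * f q.2 * bisExc A q =
      ∑ q ∈ W, f q.1 * f q.2 * bisExc A q + ∑ q ∈ wildPairs A κ, f q.1 * f q.2 * bisExc A q :=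
    (Finset.sum_filter_add_sum_filter_not _ _ _).symm
  have hwild : ∑ q ∈ wildPairs A κ, f q.1 * f q.2 * bisExc A q ≤
      ∑ q ∈ wildPairs A κ, |bisExc A q| := by
    refine Finset.sum_le_sum fun q _ => (le_abs_self _).trans ?_
    rw [abs_mul, abs_mul]
    exact mul_le_of_le_one_left (abs_nonneg _) (mul_le_one₀ (hf _) (abs_nonneg _) (hf _))
  have hsub : ∀ A' : Finset (k × k), A' ⊆ A → S A' =
      ∑ q ∈ W, if q.1 ∈ A' ∧ q.2 ∈ A' then bisExc A q else 0 := by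
    intro A' hA'
    rw [← Finset.sum_filter]
    refine Finset.sum_congr ?_ fun _ _ => rfl
    ext q
    simp only [W, nondegPairs, Finset.mem_filter, Finset.mem_product]
    constructor
    · rintro ⟨⟨h1, h2⟩, h3⟩
      exact ⟨⟨⟨⟨hA' h1, hA' h2⟩, h3.1⟩, h3⟩, h1, h2⟩
    · rintro ⟨⟨-, h3⟩, h1, h2⟩
      exact ⟨⟨h1, h2⟩, h3⟩
  have hmain : tameSum A κ + ∑ q ∈ W, f q.1 * f q.2 * bisExc A q = 2 * S A₁ + 2 * S A₂ := by
    rw [hsub A₁ (Finset.filter_subset _ _), hsub A₂ (Finset.filter_subset _ _), tameSum,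
      ← Finset.sum_add_distrib, Finset.mul_sum, Finset.mul_sum, ← Finset.sum_add_distrib]
    refine Finset.sum_congr rfl fun q hq => ?_
    have hq' := Finset.mem_product.1 (Finset.mem_filter.1 (Finset.mem_filter.1 hq).1).1
    have hx : ∀ x ∈ A, x ∈ A₂ ↔ x ∉ A₁ := fun x hx => by
      simp only [A₁, A₂, Finset.mem_filter, hx, true_and]
    simp only [hx _ hq'.1, hx _ hq'.2, f]
    by_cases h1 : q.1 ∈ A₁ <;> by_cases h2 : q.2 ∈ A₁ <;> simp only [h1, h2] <;> simp <;> ring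
  have hw' : ∑ q ∈ wildPairs A κ, |bisExc A q| ≤ 11 * (A.card : ℝ) ^ 3 / (κ + 1) := by
    rw [le_div_iff₀' (by positivity)]
    exact hw
  have := hS A₁ q1
  have := hS A₂ q2
  linarith

end Decomposition

section Numeric

/-- The numerical conclusion, with the twelfth roots `a`, `b` of the two parameters. -/
lemma le_of_le_sqrt_add {a b κ T Q V W : ℝ} (ha : 1 ≤ a) (hab : a ≤ b) (hba : b ^ 3 ≤ a ^ 4)
    (hκ0 : 0 ≤ κ) (hκ : κ * a ^ 8 ≤ b ^ 16) (hκ' : b ^ 16 ≤ (κ + 1) * a ^ 8) (hT0 : 0 ≤ T)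
    (hV : V = 2 * b ^ 48 / a ^ 12 + 4 * b ^ 12 * T)
    (hQ : Q = 6 * √(8 * b ^ 12) * (b ^ 12) ^ 2 + 10 * (b ^ 12 * κ * a ^ 12)
      + 4 * (111 * (b ^ 12 * √V) + 2 * (b ^ 12) ^ 2 + 39 * V / a ^ 12))
    (hT : T ≤ 4 * √(b ^ 12 * a ^ 12 * Q) + 9 * (b ^ 12) ^ 2 + 11 * (b ^ 12) ^ 3 / (κ + 1))
    (h1 : a ^ 8 * b ^ 20 ≤ W) (h2 : a ^ 3 * b ^ 24 ≤ W) (h3 : a ^ 6 * b ^ 21 ≤ W) :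
    T ≤ 100000 * W := by
  have hb : 1 ≤ b := ha.trans hab
  have ha0 : 0 < a := by linarith
  have hb0 : 0 < b := by linarith
  have hW : 0 ≤ W := le_trans (by positivity) h1
  obtain ⟨s, hs0, rfl⟩ : ∃ s : ℝ, 0 ≤ s ∧ T = s ^ 2 :=
    ⟨√T, Real.sqrt_nonneg _, (Real.sq_sqrt hT0).symm⟩
  by_contra! hlt
  have e1 : √(8 * b ^ 12) ≤ 3 * b ^ 6 := by
    rw [Real.sqrt_le_iff]
    exact ⟨by positivity, by nlinarith [pow_pos hb0 12]⟩
  have e2 : √V ≤ 2 * b ^ 24 / a ^ 6 + 2 * b ^ 6 * s := by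
    rw [Real.sqrt_le_iff]
    refine ⟨by positivity, ?_⟩
    have e3 : (2 * b ^ 24 / a ^ 6) ^ 2 = 4 * (b ^ 48 / a ^ 12) := by
      field_simp
      norm_num
    have e4 : 0 ≤ b ^ 48 / a ^ 12 := by positivity
    have e5 : 0 ≤ (2 * b ^ 24 / a ^ 6) * (2 * b ^ 6 * s) := by positivity
    rw [add_sq, e3, hV, mul_div_assoc]
    nlinarith
  -- the contribution of each term of `Q`
  have t1 : b ^ 12 * a ^ 12 * (6 * √(8 * b ^ 12) * (b ^ 12) ^ 2) ≤ 18 * W ^ 2 := by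
    calc b ^ 12 * a ^ 12 * (6 * √(8 * b ^ 12) * (b ^ 12) ^ 2)
        ≤ b ^ 12 * a ^ 12 * (6 * (3 * b ^ 6) * (b ^ 12) ^ 2) := by gcongr
      _ = 18 * (a ^ 6 * b ^ 21) ^ 2 := by ring
      _ ≤ 18 * W ^ 2 := by gcongr
  have t2 : b ^ 12 * a ^ 12 * (10 * (b ^ 12 * κ * a ^ 12)) ≤ 10 * W ^ 2 := by
    calc b ^ 12 * a ^ 12 * (10 * (b ^ 12 * κ * a ^ 12))
        = 10 * (b ^ 24 * a ^ 16 * (κ * a ^ 8)) := by ring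
      _ ≤ 10 * (b ^ 24 * a ^ 16 * b ^ 16) := by gcongr
      _ = 10 * (a ^ 8 * b ^ 20) ^ 2 := by ring
      _ ≤ 10 * W ^ 2 := by gcongr
  have t3 : b ^ 12 * a ^ 12 * (444 * (b ^ 12 * √V)) ≤ 888 * W ^ 2 + 888 * (s * (√W * W)) := by
    have hc : a ^ 12 * b ^ 30 ≤ √W * W := by
      have := Real.sqrt_le_sqrt h1
      rw [show a ^ 8 * b ^ 20 = (a ^ 4 * b ^ 10) ^ 2 by ring, Real.sqrt_sq (by positivity)] at this
      calc a ^ 12 * b ^ 30 = (a ^ 4 * b ^ 10) * (a ^ 8 * b ^ 20) := by ring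
        _ ≤ √W * W := by gcongr
    calc b ^ 12 * a ^ 12 * (444 * (b ^ 12 * √V))
        ≤ b ^ 12 * a ^ 12 * (444 * (b ^ 12 * (2 * b ^ 24 / a ^ 6 + 2 * b ^ 6 * s))) := by gcongr
      _ = 888 * (a ^ 3 * b ^ 24) ^ 2 + 888 * (s * (a ^ 12 * b ^ 30)) := by
          field_simp
          ring
      _ ≤ 888 * W ^ 2 + 888 * (s * (√W * W)) := by gcongr
  have t4 : b ^ 12 * a ^ 12 * (8 * (b ^ 12) ^ 2) ≤ 8 * W ^ 2 := by
    calc b ^ 12 * a ^ 12 * (8 * (b ^ 12) ^ 2) = 8 * (a ^ 12 * b ^ 36) * 1 := by ring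
      _ ≤ 8 * (a ^ 12 * b ^ 36) * b ^ 6 := by gcongr; exact one_le_pow₀ hb
      _ = 8 * (a ^ 6 * b ^ 21) ^ 2 := by ring
      _ ≤ 8 * W ^ 2 := by gcongr
  have hW2 : b ^ 24 ≤ W := by
    refine le_trans ?_ h2
    exact le_mul_of_one_le_left (by positivity) (one_le_pow₀ ha)
  have t5 : b ^ 12 * a ^ 12 * (156 * V / a ^ 12) ≤ 312 * W ^ 2 + 624 * (W * s ^ 2) := by
    have hd : b ^ 60 / a ^ 12 ≤ W ^ 2 := by
      rw [div_le_iff₀ (by positivity)]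
      calc b ^ 60 = b ^ 48 * (b ^ 3) ^ 4 := by ring
        _ ≤ b ^ 48 * (a ^ 4) ^ 4 := by gcongr
        _ = b ^ 48 * a ^ 16 * 1 := by ring
        _ ≤ b ^ 48 * a ^ 16 * a ^ 2 := by gcongr; exact one_le_pow₀ ha
        _ = (a ^ 3 * b ^ 24) ^ 2 * a ^ 12 := by ring
        _ ≤ W ^ 2 * a ^ 12 := by gcongr
    calc b ^ 12 * a ^ 12 * (156 * V / a ^ 12)
        = 312 * (b ^ 60 / a ^ 12) + 624 * (b ^ 24 * s ^ 2) := by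
          rw [hV]
          field_simp
          ring
      _ ≤ 312 * W ^ 2 + 624 * (W * s ^ 2) := by gcongr
  have t6 : 11 * (b ^ 12) ^ 3 / (κ + 1) ≤ 11 * W := by
    rw [div_le_iff₀ (by linarith)]
    have : b ^ 36 ≤ W * (κ + 1) := by
      calc b ^ 36 = b ^ 20 * b ^ 16 := by ring
        _ ≤ b ^ 20 * ((κ + 1) * a ^ 8) := by gcongr
        _ = a ^ 8 * b ^ 20 * (κ + 1) := by ring
        _ ≤ W * (κ + 1) := by gcongr
    linarith
  have hws : √W ≤ s / 300 := by
    rw [Real.sqrt_le_iff]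
    exact ⟨by positivity, by linarith [div_pow s 300 2]⟩
  have hW' : W ≤ s ^ 2 / 100000 := by linarith
  have hQ' : b ^ 12 * a ^ 12 * Q ≤ (s ^ 2 / 8) ^ 2 := by
    have u1 : s * (√W * W) ≤ s * (s / 300 * (s ^ 2 / 100000)) := by gcongr
    have u2 : W ^ 2 ≤ (s ^ 2 / 100000) ^ 2 := by gcongr
    have u3 : W * s ^ 2 ≤ s ^ 2 / 100000 * s ^ 2 := by gcongr
    have u4 : b ^ 12 * a ^ 12 * Q ≤ 1236 * W ^ 2 + 888 * (s * (√W * W)) + 624 * (W * s ^ 2) := by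
      have : b ^ 12 * a ^ 12 * Q = b ^ 12 * a ^ 12 * (6 * √(8 * b ^ 12) * (b ^ 12) ^ 2) +
          b ^ 12 * a ^ 12 * (10 * (b ^ 12 * κ * a ^ 12)) +
          b ^ 12 * a ^ 12 * (444 * (b ^ 12 * √V)) + b ^ 12 * a ^ 12 * (8 * (b ^ 12) ^ 2) +
          b ^ 12 * a ^ 12 * (156 * V / a ^ 12) := by rw [hQ]; ring
      linarith
    nlinarith [pow_nonneg hs0 4]
  have hr : √(b ^ 12 * a ^ 12 * Q) ≤ s ^ 2 / 8 := Real.sqrt_le_iff.2 ⟨by positivity, hQ'⟩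
  have h4 : (b ^ 12) ^ 2 ≤ W := by linarith
  linarith

end Numeric

section Translation

lemma ncard_inter_eq {α : Type*} (A : Finset α) (P : α → Prop) [DecidablePred P] :
    ((A : Set α) ∩ {x | P x}).ncard = (A.filter P).card := by
  rw [← Set.ncard_coe_finset, Finset.coe_filter]
  rfl

variable {k : Type*} [Field k] [DecidableEq k]

lemma iA_bisector (A : Finset (k × k)) (a b : k × k) :
    iA A (bisector a b) = (A.filter fun x => dist2 a x = dist2 b x).card :=
  ncard_inter_eq A _

open Classical in
lemma bstarL_eq_card (A : Finset (k × k)) (ℓ : Set (k × k)) :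
    bstarL A ℓ = ((nondegPairs A).filter fun q => bisector q.1 q.2 = ℓ).card := by
  rw [bstarL, ← Set.ncard_coe_finset]
  congr 1
  ext ⟨a, b⟩
  have h : dot (a - b) (a - b) = dot (b - a) (b - a) := by
    simp only [dot, Prod.fst_sub, Prod.snd_sub]
    ring
  simp only [nondegPairs, Finset.coe_filter, Finset.mem_filter, Finset.mem_product,
    Set.mem_ofPred_eq, h]
  constructor
  · rintro ⟨h1, h2, -, h3, h4⟩
    exact ⟨⟨⟨h1, h2⟩, h3⟩, h4⟩
  · rintro ⟨⟨⟨h1, h2⟩, h3⟩, h4⟩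
    exact ⟨h1, h2, (sub_ne_zero.1 (ne_zero_of_dot h3)).symm, h3, h4⟩

lemma bstarL_bisector_pos {A : Finset (k × k)} {q : (k × k) × (k × k)} (hq : q ∈ nondegPairs A) :
    0 < bstarL A (bisector q.1 q.2) := by
  classical
  rw [bstarL_eq_card]
  exact Finset.card_pos.2 ⟨q, Finset.mem_filter.2 ⟨hq, rfl⟩⟩

lemma Tstar_eq_isoCount (A : Finset (k × k)) : Tstar A = isoCount A := by
  have h : isoCount A =
      ((nondegPairs A ×ˢ A).filter fun t => dist2 t.1.1 t.2 = dist2 t.1.2 t.2).card := by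
    simp only [isoCount, Finset.card_filter, Finset.sum_product]
  rw [h, Tstar, ← Set.ncard_coe_finset]
  refine Set.ncard_congr (fun t _ => (t.2, t.1)) ?_ ?_ ?_
  · rintro ⟨a, b, c⟩ ⟨ha, hb, hc, h1, h2⟩
    rw [← dist2_eq_dot, dist2_comm, dist2_eq_dot] at h2
    simp only [nondegPairs, Finset.coe_filter, Finset.mem_filter, Finset.mem_product,
      Set.mem_ofPred_eq]
    exact ⟨⟨⟨⟨hb, hc⟩, h2⟩, ha⟩, by rwa [dist2_comm b, dist2_comm c]⟩
  · rintro ⟨a, b, c⟩ ⟨a', b', c'⟩ - - h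
    simp only [Prod.mk.injEq] at h ⊢
    tauto
  · rintro ⟨⟨b, c⟩, a⟩ h
    simp only [nondegPairs, Finset.coe_filter, Finset.mem_filter, Finset.mem_product,
      Set.mem_ofPred_eq] at h
    obtain ⟨⟨⟨⟨hb, hc⟩, h2⟩, ha⟩, h1⟩ := h
    rw [← dist2_eq_dot, dist2_comm, dist2_eq_dot] at h2
    exact ⟨(a, b, c), ⟨ha, hb, hc, by rwa [dist2_comm a b, dist2_comm a c], h2⟩, rfl⟩

lemma mem_line_iff {v : k × k} (hv : v ≠ 0) (x y : k × k) :
    (∃ t : k, y = x + t • v) ↔ dirForm (dirClass v) y = dirForm (dirClass v) x := by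
  rw [dirForm_dirClass_eq hv]
  constructor
  · rintro ⟨t, rfl⟩
    simp only [add_sub_cancel_left, Prod.smul_fst, Prod.smul_snd, smul_eq_mul]
    ring
  · intro h
    obtain ⟨t, ht⟩ := exists_smul_of_parallel hv (m := y - x) (by linear_combination h)
    exact ⟨t, by rw [← ht, add_sub_cancel]⟩

lemma hasDir_bisector (h2 : (2 : k) ≠ 0) {a b : k × k} (h : b ≠ a) :
    HasDir (bisector a b) (-(b - a).2, (b - a).1) := by
  refine ⟨((a.1 + b.1) / 2, (a.2 + b.2) / 2), ?_⟩
  have hn : (-(b - a).2, (b - a).1) ≠ (0 : k × k) := fun h' => h <| by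
    simp only [Prod.mk_eq_zero, neg_eq_zero] at h'
    exact sub_eq_zero.1 (Prod.ext h'.2 h'.1)
  ext x
  rw [mem_bisector_iff_bisLine h2 (q := (a, b)) h]
  exact (mem_line_iff hn _ _).symm

lemma exists_hasDir_bisector_iff (h2 : (2 : k) ≠ 0) {a b v : k × k} (h : b ≠ a) (hv : v ≠ 0) :
    (∃ w, HasDir (bisector a b) w ∧ dot w v = 0) ↔ dirClass v = dirClass (b - a) := by
  have hd := hasDir_bisector h2 h
  have hba := sub_ne_zero.2 h
  constructor
  · rintro ⟨w, ⟨x, hx⟩, hwv⟩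
    obtain ⟨y, hy⟩ := hd
    have h1 : y + (1 : k) • (-(b - a).2, (b - a).1) ∈ bisector a b := hy ▸ ⟨1, rfl⟩
    have h0 : y ∈ bisector a b := hy ▸ ⟨0, by rw [zero_smul, add_zero]⟩
    rw [hx] at h0 h1
    obtain ⟨s, hs⟩ := h0
    obtain ⟨t, ht⟩ := h1
    rw [hs, one_smul] at ht
    have e1 := congrArg Prod.fst ht
    have e2 := congrArg Prod.snd ht
    simp only [Prod.fst_add, Prod.snd_add, Prod.smul_fst, Prod.smul_snd, smul_eq_mul] at e1 e2
    rw [dot] at hwv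
    refine dirClass_eq_of_parallel hv hba ?_
    linear_combination (-v.1) * e1 - v.2 * e2 + (s - t) * hwv
  · intro e
    refine ⟨_, hd, ?_⟩
    have := parallel_of_dirClass_eq e
    simp only [dot]
    linear_combination -this

lemma circRich_eq (A : Finset (k × k)) (c : k × k) :
    {a | a ∈ A ∧ ∃ γ ∈ {γ : Set (k × k) | (IsLine γ ∨ IsCircle γ) ∧
        √(8 * (A.card : ℝ)) ≤ (((A : Set (k × k)) ∩ γ).ncard : ℝ)},
      IsCircleCentred γ c ∧ a ∈ γ} = (richCirc A c : Set (k × k)) := by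
  ext a
  simp only [richCirc, Finset.coe_filter, Set.mem_ofPred_eq]
  refine and_congr_right fun _ => ⟨?_, fun ⟨h0, h⟩ => ?_⟩
  · rintro ⟨γ, ⟨-, h⟩, ⟨r, hr, rfl⟩, rfl⟩
    rw [ncard_inter_eq, Real.sqrt_le_iff] at h
    exact ⟨hr, by exact_mod_cast h.2⟩
  · refine ⟨{x | dist2 x c = dist2 a c}, ⟨Or.inr ⟨c, _, h0, rfl⟩, ?_⟩, ⟨_, h0, rfl⟩, rfl⟩
    rw [ncard_inter_eq, Real.sqrt_le_iff]
    exact ⟨Nat.cast_nonneg _, by exact_mod_cast h⟩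

lemma lineRich_eq (A : Finset (k × k)) {v : k × k} (hv : v ≠ 0) :
    {a | a ∈ A ∧ ∃ γ ∈ {γ : Set (k × k) | (IsLine γ ∨ IsCircle γ) ∧
        √(8 * (A.card : ℝ)) ≤ (((A : Set (k × k)) ∩ γ).ncard : ℝ)},
      IsLine γ ∧ HasDir γ v ∧ a ∈ γ} = (richDir A (dirClass v) : Set (k × k)) := by
  have hline : ∀ x : k × k, {y | ∃ t : k, y = x + t • v} =
      {y | dirForm (dirClass v) y = dirForm (dirClass v) x} := fun x => by
    ext y
    exact mem_line_iff hv x y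
  ext a
  simp only [richDir, Finset.coe_filter, Set.mem_ofPred_eq]
  refine and_congr_right fun _ => ⟨?_, fun h => ?_⟩
  · rintro ⟨γ, ⟨-, h⟩, -, ⟨x, rfl⟩, ha⟩
    rw [hline] at h ha
    rw [ncard_inter_eq, Real.sqrt_le_iff] at h
    rw [Set.mem_ofPred_eq] at ha
    rw [ha]
    exact_mod_cast h.2
  · have hl : IsLine {y | ∃ t : k, y = a + t • v} := ⟨a, v, hv, rfl⟩
    refine ⟨_, ⟨Or.inl hl, ?_⟩, hl, ⟨a, rfl⟩, 0, by rw [zero_smul, add_zero]⟩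
    rw [hline, ncard_inter_eq, Real.sqrt_le_iff]
    exact ⟨Nat.cast_nonneg _, by exact_mod_cast h⟩

lemma isTame_iff_bisector (h2 : (2 : k) ≠ 0) (A : Finset (k × k)) {K : ℝ} (hK : 0 ≤ K)
    {q : (k × k) × (k × k)} (hq : q ∈ nondegPairs A) :
    IsTame A ⌊K⌋₊ q.1 q.2 ↔
      ¬ ((∃ c, K < (richCirc A c).card ∧ c ∈ bisector q.1 q.2) ∨
        ∃ v, (v ≠ 0 ∧ K < (richDir A (dirClass v)).card) ∧
          ∃ w, HasDir (bisector q.1 q.2) w ∧ dot w v = 0) := by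
  have hq' := (Finset.mem_filter.1 hq).2
  have hne := ne_zero_of_dot hq'
  have hne' := sub_ne_zero.1 hne
  simp only [← Nat.floor_lt hK]
  rw [IsTame, not_or]
  refine ⟨fun ⟨_, h3, h4⟩ => ⟨?_, ?_⟩, fun ⟨h3, h4⟩ => ⟨hq', fun y hy => ?_, ?_⟩⟩
  · rintro ⟨c, hc, hc'⟩
    exact (h3 c hc').not_gt hc
  · rintro ⟨v, ⟨hv, hvc⟩, hw⟩
    rw [(exists_hasDir_bisector_iff h2 hne' hv).1 hw] at hvc
    exact h4.not_gt hvc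
  · by_contra! h
    exact h3 ⟨y, h, hy⟩
  · by_contra! h
    exact h4 ⟨q.2 - q.1, ⟨hne, h⟩, (exists_hasDir_bisector_iff h2 hne' hne).2 rfl⟩

open Classical in
lemma finsum_mem_bisExc [Fintype k] (A : Finset (k × k)) (L : Set (Set (k × k))) :
    ∑ᶠ ℓ ∈ L, ((iA A ℓ : ℝ) - (A.card : ℝ) / Fintype.card k) * (bstarL A ℓ : ℝ) =
      ∑ q ∈ (nondegPairs A).filter (fun q => bisector q.1 q.2 ∈ L), bisExc A q := by
  rw [finsum_mem_eq_finite_toFinset_sum _ L.toFinite,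
    ← Finset.sum_fiberwise_of_maps_to (g := fun q : (k × k) × (k × k) => bisector q.1 q.2)
      (t := L.toFinite.toFinset)
      (fun q hq => (Set.Finite.mem_toFinset _).2 (Finset.mem_filter.1 hq).2)]
  refine Finset.sum_congr rfl fun ℓ hℓ => ?_
  rw [Set.Finite.mem_toFinset] at hℓ
  rw [bstarL_eq_card, mul_comm, ← nsmul_eq_mul, ← Finset.sum_const, Finset.filter_filter]
  refine Finset.sum_congr (Finset.filter_congr fun q _ => ?_) fun q hq => ?_
  · exact ⟨fun h => ⟨h ▸ hℓ, h⟩, fun h => h.2⟩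
  · rw [bisExc, ← iA_bisector, (Finset.mem_filter.1 hq).2.2]

end Translation

section Conclusion

lemma rpow_eq_twelfth_root_pow {x : ℝ} (hx : 0 ≤ x) {r : ℝ} (m : ℕ) (h : r * 12 = m) :
    x ^ r = (x ^ ((1 : ℝ) / 12)) ^ m := by
  rw [← Real.rpow_natCast, ← Real.rpow_mul hx, ← h]
  congr 1
  ring

lemma sum_bisExc_le_cube {k : Type*} [Field k] [DecidableEq k] [Fintype k] (A : Finset (k × k))
    {S : Finset ((k × k) × (k × k))} (hS : S ⊆ nondegPairs A) :
    ∑ q ∈ S, bisExc A q ≤ (A.card : ℝ) ^ 3 := by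
  have h1 : S.card ≤ A.card ^ 2 := by
    rw [sq, ← Finset.card_product]
    exact Finset.card_le_card (hS.trans (Finset.filter_subset _ _))
  have h2 : ∀ q ∈ S, bisExc A q ≤ A.card := fun q _ => by
    have : ((A.filter fun x => dist2 q.1 x = dist2 q.2 x).card : ℝ) ≤ A.card :=
      Nat.cast_le.2 (Finset.card_filter_le _ _)
    have : (0 : ℝ) ≤ A.card / Fintype.card k := by positivity
    rw [bisExc]
    linarith
  refine (Finset.sum_le_card_nsmul _ _ _ h2).trans ?_
  have h3 : (S.card : ℝ) ≤ (A.card : ℝ) ^ 2 := by exact_mod_cast h1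
  rw [nsmul_eq_mul, pow_succ]
  gcongr

lemma tameSum_le_of_isoCount_le {p : ℕ} [Fact p.Prime] (hp2 : p ≠ 2)
    {A : Finset (ZMod p × ZMod p)} {a b K W : ℝ} (ha : 0 < a) (hb : 0 < b)
    (hpa : (p : ℝ) = a ^ 12) (hnb : (A.card : ℝ) = b ^ 12) (hab : a ≤ b) (hba : b ^ 3 ≤ a ^ 4)
    (hK : K * a ^ 8 = b ^ 16) (h1 : a ^ 8 * b ^ 20 ≤ W) (h2 : a ^ 3 * b ^ 24 ≤ W)
    (h3 : a ^ 6 * b ^ 21 ≤ W)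
    (h : (isoCount A : ℝ) - (A.card : ℝ) ^ 3 / p ≤ 4 * tameSum A ⌊K⌋₊) :
    tameSum A ⌊K⌋₊ ≤ 100000 * W := by
  rcases le_or_gt (tameSum A ⌊K⌋₊) 0 with hT | hT
  · exact hT.trans (mul_nonneg (by norm_num) (le_trans (by positivity) h1))
  have h2' : (2 : ZMod p) ≠ 0 := by
    have : ((2 : ℕ) : ZMod p) ≠ 0 := fun h0 => by
      rw [ZMod.natCast_eq_zero_iff, Nat.prime_dvd_prime_iff_eq Fact.out Nat.prime_two] at h0
      exact hp2 h0
    exact_mod_cast this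
  have ha1 : 1 ≤ a := by
    have : a ^ 3 ≤ a ^ 4 := (by gcongr : a ^ 3 ≤ b ^ 3).trans hba
    by_contra! hlt
    exact this.not_gt (pow_lt_pow_right_of_lt_one₀ ha hlt (by norm_num))
  have hcard : Fintype.card (ZMod p) = p := ZMod.card p
  have hn : Fintype.card (ZMod p) ≤ A.card := by
    rw [hcard, ← Nat.cast_le (α := ℝ), hpa, hnb]
    gcongr
  obtain ⟨θ, hθ⟩ := IsAlgClosed.exists_pow_nat_eq (-1 : AlgebraicClosure (ZMod p)) two_pos
  have hchar : ∀ m : ℕ, 0 < m → m < Fintype.card (ZMod p) →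
      (m : AlgebraicClosure (ZMod p)) ≠ 0 := fun m h0 hm hz => by
    rw [hcard] at hm
    rw [CharP.cast_eq_zero_iff _ p] at hz
    exact (Nat.le_of_dvd h0 hz).not_gt hm
  have hK0 : 0 ≤ K := by
    by_contra! hlt
    have : 0 < b ^ 16 := by positivity
    nlinarith [pow_pos ha 8]
  have hI : (isoCount A : ℝ) ≤ b ^ 36 / a ^ 12 + 4 * tameSum A ⌊K⌋₊ := by
    rw [hpa, hnb] at h
    have : (b ^ 12) ^ 3 = b ^ 36 := by ring
    rw [this] at h
    linarith
  have key := tameSum_le h2' hθ A ⌊K⌋₊ hn hchar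
    (V := 2 * b ^ 48 / a ^ 12 + 4 * b ^ 12 * tameSum A ⌊K⌋₊) ?_ le_rfl
  · rw [hcard, hpa, hnb] at key
    refine le_of_le_sqrt_add ha1 hab hba (Nat.cast_nonneg ⌊K⌋₊) ?_ ?_ hT.le rfl rfl key h1 h2 h3
    · rw [← hK]
      gcongr
      exact Nat.floor_le hK0
    · rw [← hK]
      gcongr
      exact (Nat.lt_floor_add_one K).le
  · rw [hnb]
    have e1 : b ^ 36 ≤ b ^ 48 / a ^ 12 := by
      rw [le_div_iff₀ (by positivity)]
      calc b ^ 36 * a ^ 12 ≤ b ^ 36 * b ^ 12 := by gcongr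
        _ = b ^ 48 := by ring
    calc b ^ 12 * ((b ^ 12) ^ 2 + isoCount A)
        ≤ b ^ 12 * ((b ^ 12) ^ 2 + (b ^ 36 / a ^ 12 + 4 * tameSum A ⌊K⌋₊)) := by gcongr
      _ = b ^ 36 + b ^ 48 / a ^ 12 + 4 * b ^ 12 * tameSum A ⌊K⌋₊ := by ring
      _ ≤ 2 * b ^ 48 / a ^ 12 + 4 * b ^ 12 * tameSum A ⌊K⌋₊ := by
        rw [mul_div_assoc]
        linarith

end Conclusion

/-- Triangles not interacting with rich lines and circles: with the notation of the
decomposition (`k`, `K`, `Γ`, `A_c`, `A_v`, `C₁`, `V₁`, `L₁`, `L₂`, and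
`T*₂(A) = Σ_{ℓ ∈ L₂} (i_A(ℓ) - |A|/p)·b*_A(ℓ)`), if `T*(A) - |A|³/p ≤ 4·T*₂(A)` then
`T*₂(A) ≤ C·(p^(2/3)|A|^(5/3) + p^(1/4)|A|² + p^(1/2)|A|^(7/4) + p·K^(1/2)·|A|)`. -/
theorem nonrich_triangle_bound :
    ∃ C : ℝ, 0 < C ∧
      ∀ p : ℕ, p.Prime →
      ∀ A : Finset (ZMod p × ZMod p),
        (p : ℝ) ≤ (A.card : ℝ) → (A.card : ℝ) ≤ (p : ℝ) ^ ((4 : ℝ) / 3) →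
      ∀ k K : ℝ,
        k = Real.sqrt (8 * (A.card : ℝ)) →
        K = (A.card : ℝ) ^ ((4 : ℝ) / 3) * (p : ℝ) ^ (-((2 : ℝ) / 3)) →
      ∀ Γ : Set (Set (ZMod p × ZMod p)),
        Γ = {γ | (IsLine γ ∨ IsCircle γ) ∧
              k ≤ (((A : Set (ZMod p × ZMod p)) ∩ γ).ncard : ℝ)} →
      ∀ Ac : (ZMod p × ZMod p) → Set (ZMod p × ZMod p),
        Ac = (fun c => {a | a ∈ A ∧ ∃ γ ∈ Γ, IsCircleCentred γ c ∧ a ∈ γ}) →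
      ∀ Av : (ZMod p × ZMod p) → Set (ZMod p × ZMod p),
        Av = (fun v => {a | a ∈ A ∧ ∃ γ ∈ Γ, IsLine γ ∧ HasDir γ v ∧ a ∈ γ}) →
      ∀ C₁ : Set (ZMod p × ZMod p), C₁ = {c | K < ((Ac c).ncard : ℝ)} →
      ∀ V₁ : Set (ZMod p × ZMod p), V₁ = {v | v ≠ 0 ∧ K < ((Av v).ncard : ℝ)} →
      ∀ L₁ : Set (Set (ZMod p × ZMod p)),
        L₁ = {ℓ | 0 < bstarL A ℓ ∧
              ((∃ c ∈ C₁, c ∈ ℓ) ∨ (∃ v ∈ V₁, ∃ w, HasDir ℓ w ∧ dot w v = 0))} →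
      ∀ L₂ : Set (Set (ZMod p × ZMod p)),
        L₂ = {ℓ | 0 < bstarL A ℓ ∧ ℓ ∉ L₁} →
      ∀ T₂ : ℝ,
        T₂ = ∑ᶠ ℓ ∈ L₂, ((iA A ℓ : ℝ) - (A.card : ℝ) / (p : ℝ)) * (bstarL A ℓ : ℝ) →
      (Tstar A : ℝ) - (A.card : ℝ) ^ 3 / (p : ℝ) ≤ 4 * T₂ →
      T₂ ≤ C * ((p : ℝ) ^ ((2 : ℝ) / 3) * (A.card : ℝ) ^ ((5 : ℝ) / 3) +
            (p : ℝ) ^ ((1 : ℝ) / 4) * (A.card : ℝ) ^ 2 +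
            (p : ℝ) ^ ((1 : ℝ) / 2) * (A.card : ℝ) ^ ((7 : ℝ) / 4) +
            (p : ℝ) * K ^ ((1 : ℝ) / 2) * (A.card : ℝ)) := by
  refine ⟨100000, by norm_num, ?_⟩
  intro p hp A hpn hnp k K hk hK Γ hΓ Ac hAc Av hAv C₁ hC₁ V₁ hV₁ L₁ hL₁ L₂ hL₂ T₂ hT₂ hT
  classical
  have : Fact p.Prime := ⟨hp⟩
  have hp0 : (0 : ℝ) < p := Nat.cast_pos.2 hp.pos
  have hn0 : (0 : ℝ) < A.card := hp0.trans_le hpn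
  set a : ℝ := (p : ℝ) ^ ((1 : ℝ) / 12)
  set b : ℝ := (A.card : ℝ) ^ ((1 : ℝ) / 12)
  have hpr : ∀ {r : ℝ} (m : ℕ), r * 12 = m → (p : ℝ) ^ r = a ^ m :=
    fun m h => rpow_eq_twelfth_root_pow hp0.le m h
  have hnr : ∀ {r : ℝ} (m : ℕ), r * 12 = m → (A.card : ℝ) ^ r = b ^ m :=
    fun m h => rpow_eq_twelfth_root_pow hn0.le m h
  have ha0 : 0 < a := Real.rpow_pos_of_pos hp0 _
  have hb0 : 0 < b := Real.rpow_pos_of_pos hn0 _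
  have hpa : (p : ℝ) = a ^ 12 := by rw [← hpr (r := 1) 12 (by norm_num), Real.rpow_one]
  have hnb : (A.card : ℝ) = b ^ 12 := by rw [← hnr (r := 1) 12 (by norm_num), Real.rpow_one]
  have hab : a ≤ b := Real.rpow_le_rpow hp0.le hpn (by norm_num)
  have ha1 : 1 ≤ a := Real.one_le_rpow (by exact_mod_cast hp.one_le) (by norm_num)
  clear_value a b
  rw [hpr 16 (by norm_num), hnb] at hnp
  have hba : b ^ 3 ≤ a ^ 4 := by
    refine le_of_pow_le_pow_left₀ (n := 4) (by norm_num) (by positivity) ?_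
    rwa [← pow_mul, ← pow_mul]
  rw [Real.rpow_neg hp0.le, hpr 8 (by norm_num), hnr 16 (by norm_num)] at hK
  have hK' : K * a ^ 8 = b ^ 16 := by
    rw [hK, inv_mul_cancel_right₀ (by positivity)]
  have hK0 : 0 ≤ K := by
    rw [hK]
    positivity
  rw [hpr 8 (by norm_num), hnr 20 (by norm_num), hpr 3 (by norm_num), hpr 6 (by norm_num),
    hnr 21 (by norm_num)]
  have h4 : 0 ≤ (p : ℝ) * K ^ ((1 : ℝ) / 2) * (A.card : ℝ) := by positivity
  have h1 : 0 ≤ a ^ 8 * b ^ 20 := by positivity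
  have h2 : 0 ≤ a ^ 3 * (A.card : ℝ) ^ 2 := by positivity
  have h3 : 0 ≤ a ^ 6 * b ^ 21 := by positivity
  have hsum := finsum_mem_bisExc A L₂
  rw [ZMod.card, ← hT₂] at hsum
  by_cases hp2 : p = 2
  · have h5 := hsum.trans_le (sum_bisExc_le_cube A (Finset.filter_subset _ _))
    have h6 : (A.card : ℝ) ^ 3 ≤ 16 := by
      calc (A.card : ℝ) ^ 3 = (b ^ 3) ^ 12 := by rw [hnb]; ring
        _ ≤ (a ^ 4) ^ 12 := by gcongr
        _ = (a ^ 12) ^ 4 := by ring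
        _ = 16 := by rw [← hpa, hp2]; norm_num
    have h8 : 1 ≤ a ^ 8 * b ^ 20 :=
      one_le_mul_of_one_le_of_one_le (one_le_pow₀ ha1) (one_le_pow₀ (ha1.trans hab))
    linarith
  · have h2' : (2 : ZMod p) ≠ 0 := fun h0 => hp2 <| by
      rwa [← Nat.cast_ofNat, ZMod.natCast_eq_zero_iff, Nat.prime_dvd_prime_iff_eq hp Nat.prime_two]
        at h0
    have hC : ∀ c, c ∈ C₁ ↔ K < (richCirc A c).card := fun c => by
      have h := congrArg Set.ncard (circRich_eq A c)
      rw [Set.ncard_coe_finset] at h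
      rw [← h, hC₁, hAc, hΓ, hk]
      rfl
    have hV : ∀ v, v ∈ V₁ ↔ v ≠ 0 ∧ K < (richDir A (dirClass v)).card := fun v => by
      rw [hV₁, Set.mem_ofPred_eq]
      refine and_congr_right fun hv => ?_
      have h := congrArg Set.ncard (lineRich_eq A hv)
      rw [Set.ncard_coe_finset] at h
      rw [← h, hAv, hΓ, hk]
    have htame : T₂ = tameSum A ⌊K⌋₊ := by
      rw [hsum, tameSum]
      refine Finset.sum_congr (Finset.filter_congr fun q hq => ?_) fun _ _ => rfl
      rw [isTame_iff_bisector h2' A hK0 hq, hL₂, hL₁]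
      simp only [Set.mem_ofPred_eq, bstarL_bisector_pos hq, true_and, hC, hV]
    rw [Tstar_eq_isoCount, htame] at hT
    rw [htame]
    refine tameSum_le_of_isoCount_le hp2 ha0 hb0 hpa hnb hab hba hK' ?_ ?_ ?_ hT
    · linarith
    · have : a ^ 3 * b ^ 24 = a ^ 3 * (A.card : ℝ) ^ 2 := by rw [hnb]; ring
      linarith
    · linarith

end Stmt16
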